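/- arXiv:math/9902004 — 11 statements merged into one kernel-verified Lean document; each statement's English description precedes it below -/
import Mathlib

section
/- Let n be a positive integer, F a field, and X_1,...,X_n nonzero elements of F. Then det_{1≤i,j≤n}(X_i^j − X_i^{−j}) = (X_1···X_n)^{−n} · ∏_{1≤i<j≤n}((X_i − X_j)(1 − X_i X_j)) · ∏_{i=1}^{n}(X_i^2 − 1). -/
open Finset

open Polynomial in
theorem Polynomial.Chebyshev.monic_S_and_natDegree_S (R : Type*) [CommRing R] [Nontrivial R]
    (n : ℕ) : (Chebyshev.S R n).Monic ∧ (Chebyshev.S R n).natDegree = n := by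
  induction n using Nat.twoStepInduction with
  | zero => simp
  | one => simp [monic_X]
  | more n ih₀ ih₁ =>
    have h_natDegree : (X * Chebyshev.S R ((n + 1 : ℕ) : ℤ)).natDegree = n + 2 := by
      rw [monic_X.natDegree_mul ih₁.1, natDegree_X, ih₁.2]
      ring
    have h_lt : (Chebyshev.S R (n : ℤ)).natDegree <
        (X * Chebyshev.S R ((n + 1 : ℕ) : ℤ)).natDegree := by
      rw [h_natDegree, ih₀.2]
      omega
    have h_rec : Chebyshev.S R ((n + 2 : ℕ) : ℤ) =
        X * Chebyshev.S R ((n + 1 : ℕ) : ℤ) - Chebyshev.S R (n : ℤ) := by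
      push_cast
      exact Chebyshev.S_add_two R n
    rw [h_rec]
    exact ⟨(monic_X.mul ih₁.1).sub_of_left (degree_lt_degree h_lt),
      (natDegree_sub_eq_left_of_natDegree_lt h_lt).trans h_natDegree⟩

open Polynomial in
theorem Polynomial.Chebyshev.sub_inv_mul_S_eval_add_inv {F : Type*} [Field F] {x : F}
    (hx : x ≠ 0) (n : ℕ) :
    (x - x⁻¹) * (Chebyshev.S F n).eval (x + x⁻¹) = x ^ (n + 1) - x⁻¹ ^ (n + 1) := by
  induction n using Nat.twoStepInduction with
  | zero => simp
  | one =>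
    simp
    ring
  | more n ih₀ ih₁ =>
    have h_rec : Chebyshev.S F ((n + 2 : ℕ) : ℤ) =
        X * Chebyshev.S F ((n + 1 : ℕ) : ℤ) - Chebyshev.S F (n : ℤ) := by
      push_cast
      exact Chebyshev.S_add_two F n
    have h_inv : x * x⁻¹ = 1 := mul_inv_cancel₀ hx
    rw [h_rec, eval_sub, eval_mul, eval_X]
    linear_combination (x + x⁻¹) * ih₁ - ih₀ + (x ^ (n + 1) - x⁻¹ ^ (n + 1)) * h_inv

theorem Fin.prod_prod_Ioi_mul_eq_prod_pow {M : Type*} [CommMonoid M] {n : ℕ} (x : Fin n → M) :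
    ∏ i, ∏ j ∈ Ioi i, (x i * x j) = (∏ i, x i) ^ (n - 1) := by
  rw [prod_prod_Ioi_mul_eq_prod_prod_off_diag (fun _ i => x i)]
  simp [card_compl, prod_pow]

/-- The "symplectic" Vandermonde determinant evaluation (Weyl denominator of type C):
`det_{1≤i,j≤n}(X_i^j − X_i^{−j})`. Rows/columns are indexed by `Fin n` (0-based), so
the 1-based exponent `j` is `(j : ℕ) + 1`. -/
theorem stmt_1 (n : ℕ) (hn : 0 < n) (F : Type*) [Field F]
    (X : Fin n → F) (hX : ∀ i, X i ≠ 0) :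
    Matrix.det (Matrix.of fun i j : Fin n =>
        X i ^ ((j : ℕ) + 1) - (X i)⁻¹ ^ ((j : ℕ) + 1)) =
      ((∏ i : Fin n, X i)⁻¹) ^ n *
        (∏ i : Fin n, ∏ j ∈ Ioi i, ((X i - X j) * (1 - X i * X j))) *
        ∏ i : Fin n, (X i ^ 2 - 1) := by
  have h_diff (i j : Fin n) : (X j + (X j)⁻¹) - (X i + (X i)⁻¹) =
      ((X i)⁻¹ * (X j)⁻¹) * ((X i - X j) * (1 - X i * X j)) := by
    have := hX i
    have := hX j
    field_simp
    ring
  have h_row (i : Fin n) : X i - (X i)⁻¹ = (X i)⁻¹ * (X i ^ 2 - 1) := by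
    have := hX i
    field_simp
  have h_vandermonde := Matrix.det_eval_matrixOfPolynomials_eq_det_vandermonde
    (fun i => X i + (X i)⁻¹) (fun j : Fin n => Polynomial.Chebyshev.S F (j : ℕ))
    (fun j => (Polynomial.Chebyshev.monic_S_and_natDegree_S F j).2)
    (fun j => (Polynomial.Chebyshev.monic_S_and_natDegree_S F j).1)
  simp_rw [← Polynomial.Chebyshev.sub_inv_mul_S_eval_add_inv (hX _)]
  refine (Matrix.det_mul_column (fun i => X i - (X i)⁻¹) (Matrix.of fun i j : Fin n =>
    (Polynomial.Chebyshev.S F (j : ℕ)).eval (X i + (X i)⁻¹))).trans ?_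
  rw [← h_vandermonde, Matrix.det_vandermonde]
  have h_prod : ∏ i, ∏ j ∈ Ioi i, ((X j + (X j)⁻¹) - (X i + (X i)⁻¹)) =
      ((∏ i, X i)⁻¹) ^ (n - 1) * ∏ i, ∏ j ∈ Ioi i, ((X i - X j) * (1 - X i * X j)) := by
    rw [← prod_inv_distrib, ← Fin.prod_prod_Ioi_mul_eq_prod_pow, ← prod_mul_distrib]
    simp_rw [← prod_mul_distrib, h_diff]
  rw [h_prod]
  simp_rw [h_row]
  rw [prod_mul_distrib, prod_inv_distrib]
  obtain ⟨m, rfl⟩ := Nat.exists_eq_succ_of_ne_zero hn.ne'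
  simp only [Nat.succ_eq_add_one, Nat.add_sub_cancel, pow_succ]
  ring
end

section
/- Let n be a positive integer, F a field, and X_1,...,X_n nonzero elements of F. Then det_{1≤i,j≤n}(X_i^{j−1} + X_i^{−(j−1)}) = 2 · (X_1···X_n)^{−n+1} · ∏_{1≤i<j≤n}((X_i − X_j)(1 − X_i X_j)). -/
open Finset

open Polynomial in
theorem chebyshev_C_succ_monic (R : Type*) [CommRing R] [Nontrivial R] (k : ℕ) :
    (Chebyshev.C R (k + 1 : ℕ)).Monic ∧ (Chebyshev.C R (k + 1 : ℕ)).natDegree = k + 1 := by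
  induction k using Nat.twoStepInduction with
  | zero => simp [monic_X]
  | one =>
    have h : Chebyshev.C R ((1 + 1 : ℕ) : ℤ) = X ^ 2 - C 2 := by
      rw [map_ofNat]
      exact_mod_cast Chebyshev.C_two R
    rw [h]
    exact ⟨monic_X_pow_sub_C _ (by norm_num), natDegree_X_pow_sub_C⟩
  | more k ih₁ ih₂ =>
    have h : Chebyshev.C R ((k + 2 + 1 : ℕ) : ℤ) =
        X * Chebyshev.C R ((k + 1 + 1 : ℕ) : ℤ) - Chebyshev.C R ((k + 1 : ℕ) : ℤ) := by
      have := Chebyshev.C_add_two R (k + 1 : ℤ)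
      push_cast
      convert this using 2
      ring
    have hX : (X * Chebyshev.C R ((k + 1 + 1 : ℕ) : ℤ)).Monic := monic_X.mul ih₂.1
    have hdeg : (X * Chebyshev.C R ((k + 1 + 1 : ℕ) : ℤ)).natDegree = k + 2 + 1 := by
      rw [natDegree_X_mul ih₂.1.ne_zero, ih₂.2]
    have hlt : (Chebyshev.C R ((k + 1 : ℕ) : ℤ)).natDegree <
        (X * Chebyshev.C R ((k + 1 + 1 : ℕ) : ℤ)).natDegree := by
      rw [hdeg, ih₁.2]; omega
    rw [h]
    exact ⟨hX.sub_of_left (degree_lt_degree hlt),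
      (natDegree_sub_eq_left_of_natDegree_lt hlt).trans hdeg⟩

open Polynomial in
theorem chebyshev_C_eval_add_inv {F : Type*} [Field F] {x : F} (hx : x ≠ 0) (k : ℕ) :
    (Chebyshev.C F k).eval (x + x⁻¹) = x ^ k + x⁻¹ ^ k := by
  induction k using Nat.twoStepInduction with
  | zero => norm_num
  | one => simp
  | more k ih₁ ih₂ =>
    push_cast at ih₁ ih₂ ⊢
    rw [Chebyshev.C_add_two, eval_sub, eval_mul, eval_X, ih₁, ih₂]
    have h := mul_inv_cancel₀ hx
    generalize x⁻¹ = y at h ⊢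
    linear_combination (x ^ k + y ^ k) * h

theorem prod_prod_Ioi_mul {R : Type*} [CommMonoid R] {n : ℕ} (x : Fin n → R) :
    ∏ i, ∏ j ∈ Ioi i, x i * x j = (∏ i, x i) ^ (n - 1) := by
  rw [prod_prod_Ioi_mul_eq_prod_prod_off_diag fun _ i => x i]
  simp [card_compl, prod_pow]

/-- The "even orthogonal" Vandermonde determinant evaluation (Weyl denominator of type D):
`det_{1≤i,j≤n}(X_i^{j−1} + X_i^{−(j−1)})`. Rows/columns are indexed by `Fin n` (0-based),
so the 1-based exponent `j − 1` is `(j : ℕ)`. -/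
theorem stmt_2 (n : ℕ) (hn : 0 < n) (F : Type*) [Field F]
    (X : Fin n → F) (hX : ∀ i, X i ≠ 0) :
    Matrix.det (Matrix.of fun i j : Fin n =>
        X i ^ (j : ℕ) + (X i)⁻¹ ^ (j : ℕ)) =
      2 * ((∏ i : Fin n, X i)⁻¹) ^ (n - 1) *
        ∏ i : Fin n, ∏ j ∈ Ioi i, ((X i - X j) * (1 - X i * X j)) := by
  obtain ⟨m, rfl⟩ : ∃ m, n = m + 1 := ⟨n - 1, by omega⟩
  let p : Fin (m + 1) → Polynomial F := Fin.cons 1 fun k => Polynomial.Chebyshev.C F (k + 1 : ℕ)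
  let c : Fin (m + 1) → F := Fin.cons 2 fun _ => 1
  have hdeg : ∀ i, (p i).natDegree = i := by
    refine Fin.cases (by simp [p]) fun k => ?_
    simpa only [p, Fin.cons_succ, Fin.val_succ] using (chebyshev_C_succ_monic F k).2
  have hmonic : ∀ i, (p i).Monic := by
    refine Fin.cases (by simp [p]) fun k => ?_
    simpa only [p, Fin.cons_succ] using (chebyshev_C_succ_monic F k).1
  have hmat : (Matrix.of fun i j : Fin (m + 1) => X i ^ (j : ℕ) + (X i)⁻¹ ^ (j : ℕ)) =
      Matrix.of fun i j => c j * (Matrix.of fun i j => (p j).eval (X i + (X i)⁻¹)) i j := by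
    ext i j
    refine Fin.cases ?_ (fun k => ?_) j
    · simp only [Matrix.of_apply, c, p, Fin.cons_zero]
      norm_num
    · simp only [Matrix.of_apply, c, p, Fin.cons_succ, one_mul, Fin.val_succ]
      exact (chebyshev_C_eval_add_inv (hX i) _).symm
  have hc : ∏ i, c i = 2 := by simp [c, Fin.prod_univ_succ]
  rw [hmat, Matrix.det_mul_row, hc,
    ← Matrix.det_eval_matrixOfPolynomials_eq_det_vandermonde _ p hdeg hmonic,
    Matrix.det_vandermonde, mul_assoc, ← prod_inv_distrib, ← prod_prod_Ioi_mul]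
  simp only [← prod_mul_distrib]
  congr 1
  refine prod_congr rfl fun i _ => prod_congr rfl fun j _ => ?_
  have hi := hX i
  have hj := hX j
  field_simp
  ring
end

section
/- Let n be a positive integer, F a field, and X_1,...,X_n, Y_1,...,Y_n elements of F such that X_i + Y_j ≠ 0 for all 1 ≤ i,j ≤ n. Then det_{1≤i,j≤n}(1/(X_i + Y_j)) = (∏_{1≤i<j≤n}(X_i − X_j)(Y_i − Y_j)) / (∏_{1≤i,j≤n}(X_i + Y_j)). (Cauchy's double alternant.) -/
open Finset

/-- One step of Gaussian elimination on the Cauchy matrix. -/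
theorem det_cauchy_succ {F : Type*} [Field F] {n : ℕ} (X Y : Fin (n + 1) → F)
    (h : ∀ i j, X i + Y j ≠ 0) :
    Matrix.det (Matrix.of fun i j => (X i + Y j)⁻¹) =
      (X 0 + Y 0)⁻¹ * ((∏ i : Fin n, (X 0 - X i.succ) / (X i.succ + Y 0)) *
        ((∏ j : Fin n, (Y 0 - Y j.succ) / (X 0 + Y j.succ)) *
          Matrix.det (Matrix.of fun i j : Fin n => (X i.succ + Y j.succ)⁻¹))) := by
  let B : Matrix (Fin (n + 1)) (Fin (n + 1)) F := Matrix.of <| Fin.cons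
    (fun j => (X 0 + Y j)⁻¹)
    (fun i j => (X 0 - X i.succ) / (X i.succ + Y 0) *
      ((Y 0 - Y j) / (X 0 + Y j) * (X i.succ + Y j)⁻¹))
  have hB : Matrix.det (Matrix.of fun i j => (X i + Y j)⁻¹) = B.det := by
    refine Matrix.det_eq_of_forall_row_eq_smul_add_const
      (Fin.cons 0 fun i => (X 0 + Y 0) / (X i.succ + Y 0)) 0 rfl fun i j => ?_
    cases i using Fin.cases with
    | zero => simp [B]
    | succ i =>
      have h₁ := h i.succ j
      have h₂ := h i.succ 0
      have h₃ := h 0 j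
      simp only [B, Matrix.of_apply, Fin.cons_succ, Fin.cons_zero]
      field_simp
      ring
  rw [hB, Matrix.det_succ_column_zero, Fin.sum_univ_succ, ← Matrix.det_mul_row,
    ← Matrix.det_mul_column]
  simp only [B, Matrix.of_apply, Fin.cons_succ, Fin.cons_zero, sub_self, zero_div, zero_mul,
    mul_zero, sum_const_zero, add_zero, Fin.val_zero, pow_zero, one_mul]
  rfl

/-- Cauchy's double alternant:
`det_{1≤i,j≤n}(1/(X_i+Y_j)) = ∏_{i<j}(X_i−X_j)(Y_i−Y_j) / ∏_{i,j}(X_i+Y_j)`. -/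
theorem stmt_3 (n : ℕ) (hn : 0 < n) (F : Type*) [Field F]
    (X Y : Fin n → F) (h : ∀ i j : Fin n, X i + Y j ≠ 0) :
    Matrix.det (Matrix.of fun i j : Fin n => (X i + Y j)⁻¹) =
      (∏ i : Fin n, ∏ j ∈ Ioi i, ((X i - X j) * (Y i - Y j))) /
        ∏ i : Fin n, ∏ j : Fin n, (X i + Y j) := by
  clear hn
  induction n with
  | zero => simp
  | succ n ih =>
    rw [det_cauchy_succ X Y h, ih _ _ fun i j => h i.succ j.succ]
    simp only [Fin.prod_univ_succ, Fin.prod_Ioi_zero, Fin.prod_Ioi_succ, prod_mul_distrib,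
      div_eq_mul_inv, mul_inv, prod_inv_distrib]
    ring
end

section
/- Let n be a positive integer, R a commutative ring, and X_1,...,X_n, A_2,...,A_n, B_2,...,B_n elements of R. Then det_{1≤i,j≤n}( (X_i+A_n)(X_i+A_{n−1})···(X_i+A_{j+1}) · (X_i+B_j)(X_i+B_{j−1})···(X_i+B_2) ) = ∏_{1≤i<j≤n}(X_i − X_j) · ∏_{2≤i≤j≤n}(B_i − A_j). -/
open Finset

/-- The product `(X+A_n)⋯(X+A_{j+2}) · (X+B_{j+1})⋯(X+B_2)`, as a polynomial in `X`. -/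
noncomputable def mixedProd {R : Type*} [CommRing R] (n : ℕ) (A B : ℕ → R) (j : ℕ) :
    Polynomial R :=
  (∏ k ∈ Icc (j + 2) n, (Polynomial.X + Polynomial.C (A k))) *
    ∏ k ∈ Icc 2 (j + 1), (Polynomial.X + Polynomial.C (B k))

theorem natDegree_prod_X_add_C_le {R ι : Type*} [CommRing R] (s : Finset ι) (f : ι → R) :
    (∏ k ∈ s, (Polynomial.X + Polynomial.C (f k))).natDegree ≤ #s := by
  refine (Polynomial.natDegree_prod_le _ _).trans ?_
  rw [card_eq_sum_ones]
  exact sum_le_sum fun k _ => Polynomial.natDegree_add_C.trans_le Polynomial.natDegree_X_le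

theorem natDegree_mixedProd_le {R : Type*} [CommRing R] {n j : ℕ} (A B : ℕ → R) (hj : j < n) :
    (mixedProd n A B j).natDegree ≤ n - 1 := by
  refine Polynomial.natDegree_mul_le.trans ?_
  have hA := natDegree_prod_X_add_C_le (Icc (j + 2) n) A
  have hB := natDegree_prod_X_add_C_le (Icc 2 (j + 1)) B
  simp only [Nat.card_Icc] at hA hB
  omega

theorem coeff_mixedProd_zero {R : Type*} [CommRing R] (n : ℕ) (A B : ℕ → R) :
    (mixedProd (n + 1) A B 0).coeff n = 1 := by
  have h := Polynomial.coeff_prod_of_natDegree_le (Icc 2 (n + 1))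
    (fun k => Polynomial.X + Polynomial.C (A k)) 1
    fun k _ => Polynomial.natDegree_add_C.trans_le Polynomial.natDegree_X_le
  simpa [mixedProd, Polynomial.coeff_C] using h

theorem mixedProd_succ {R : Type*} [CommRing R] {n j : ℕ} (A B : ℕ → R) (hj : j < n) :
    mixedProd (n + 1) A B (j + 1) = Polynomial.C (B (j + 2) - A (j + 2)) *
      mixedProd n (fun k => A (k + 1)) B j + mixedProd (n + 1) A B j := by
  have hshift : ∏ k ∈ Icc (j + 2) n, (Polynomial.X + Polynomial.C (A (k + 1))) =
      ∏ k ∈ Icc (j + 3) (n + 1), (Polynomial.X + Polynomial.C (A k)) := by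
    rw [← Finset.map_add_right_Icc (j + 2) n 1, prod_map]
    rfl
  have hA : ∏ k ∈ Icc (j + 2) (n + 1), (Polynomial.X + Polynomial.C (A k)) =
      (Polynomial.X + Polynomial.C (A (j + 2))) *
        ∏ k ∈ Icc (j + 3) (n + 1), (Polynomial.X + Polynomial.C (A k)) := by
    rw [← insert_Icc_add_one_left_eq_Icc (by omega), prod_insert (by simp)]
    simp only [add_assoc, Nat.reduceAdd]
  have hB : ∏ k ∈ Icc 2 (j + 2), (Polynomial.X + Polynomial.C (B k)) =
      (∏ k ∈ Icc 2 (j + 1), (Polynomial.X + Polynomial.C (B k))) *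
        (Polynomial.X + Polynomial.C (B (j + 2))) :=
    prod_Icc_succ_top (by omega) _
  simp only [mixedProd, hshift, add_assoc, Nat.reduceAdd] at *
  rw [hA, hB, Polynomial.C_sub]
  ring

theorem prod_triangle_succ {R : Type*} [CommRing R] (n : ℕ) (A B : ℕ → R) :
    ∏ i ∈ Icc 2 (n + 1), ∏ j ∈ Icc i (n + 1), (B i - A j) =
      (∏ j : Fin n, (B (j + 2) - A (j + 2))) *
        ∏ i ∈ Icc 2 n, ∏ j ∈ Icc i n, (B i - A (j + 1)) := by
  have hrow (i) (hi : i ∈ Icc 2 (n + 1)) : ∏ j ∈ Icc i (n + 1), (B i - A j) =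
      (B i - A i) * ∏ j ∈ Icc i n, (B i - A (j + 1)) := by
    rw [← insert_Icc_add_one_left_eq_Icc (mem_Icc.1 hi).2, prod_insert (by simp),
      ← Finset.map_add_right_Icc i n 1, prod_map]
    rfl
  rw [prod_congr rfl hrow, prod_mul_distrib]
  congr 1
  · rw [Fin.prod_univ_eq_prod_range (fun j => B (j + 2) - A (j + 2)),
      ← Finset.Ico_add_one_right_eq_Icc, prod_Ico_eq_prod_range]
    exact prod_congr (by simp) fun j _ => by rw [add_comm]
  · rcases Nat.eq_zero_or_pos n with rfl | hn
    · simp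
    · rw [prod_Icc_succ_top (by omega)]
      simp

theorem det_coeff_mixedProd {R : Type*} [CommRing R] (n : ℕ) (A B : ℕ → R) :
    (Matrix.of fun i j : Fin n => (mixedProd n A B j).coeff i).det =
      (∏ i : Fin n, ∏ _j ∈ Ioi i, (-1 : R)) *
        ∏ i ∈ Icc 2 n, ∏ j ∈ Icc i n, (B i - A j) := by
  induction n generalizing A with
  | zero => simp
  | succ n ih =>
    let N : Matrix (Fin (n + 1)) (Fin (n + 1)) R := Matrix.of fun i =>
      Fin.cons ((mixedProd (n + 1) A B 0).coeff i) fun j : Fin n =>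
        (B (j + 2) - A (j + 2)) * (mixedProd n (fun k => A (k + 1)) B j).coeff i
    have hN : (Matrix.of fun i j : Fin (n + 1) => (mixedProd (n + 1) A B j).coeff i).det =
        N.det := by
      refine Matrix.det_eq_of_forall_col_eq_smul_add_pred (fun _ => 1) (by simp [N]) fun i j => ?_
      simp [N, mixedProd_succ A B j.is_lt, -map_sub]
    have hminor : (N.submatrix (Fin.last n).succAbove (0 : Fin (n + 1)).succAbove).det =
        (∏ j : Fin n, (B (j + 2) - A (j + 2))) * (Matrix.of fun i j : Fin n =>
          (mixedProd n (fun k => A (k + 1)) B j).coeff i).det := by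
      rw [← Matrix.det_mul_row]
      congr 1
      ext i j
      simp [N]
    have hlast (j : Fin n) : N (Fin.last n) j.succ = 0 := by
      have hdeg := natDegree_mixedProd_le (fun k => A (k + 1)) B j.is_lt
      have := j.is_lt
      simp [N, Polynomial.coeff_eq_zero_of_natDegree_lt
        (show (mixedProd n (fun k => A (k + 1)) B j).natDegree < n by omega)]
    rw [hN, Matrix.det_succ_row N (Fin.last n), Fin.sum_univ_succ, hminor, ih,
      prod_triangle_succ, Fin.prod_univ_succ]
    have h0 : N (Fin.last n) 0 = 1 := by simp [N, coeff_mixedProd_zero]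
    simp only [hlast, h0, Fin.prod_Ioi_zero, Fin.prod_Ioi_succ]
    simp only [Fin.val_last, Fin.val_zero, add_zero, mul_one, mul_zero, zero_mul,
      sum_const_zero, prod_const, card_univ, Fintype.card_fin]
    ring

/-- Evaluating polynomials of degree less than `n` at `n` points factors through the
Vandermonde matrix. -/
theorem det_eval_eq_det_vandermonde_mul_det_coeff {R : Type*} [CommRing R] {n : ℕ}
    (v : Fin n → R) (p : Fin n → Polynomial R) (hp : ∀ j, (p j).natDegree < n) :
    (Matrix.of fun i j => (p j).eval (v i)).det =
      (Matrix.vandermonde v).det * (Matrix.of fun i j : Fin n => (p j).coeff i).det := by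
  rw [← Matrix.det_mul]
  congr 1
  ext i j
  simp only [Matrix.of_apply, Matrix.mul_apply, Matrix.vandermonde_apply]
  rw [Polynomial.eval_eq_sum_range' (hp j), ← Fin.sum_univ_eq_sum_range
    (fun k => (p j).coeff k * v i ^ k)]
  exact sum_congr rfl fun k _ => mul_comm _ _


/-- Krattenthaler's determinant lemma (Lemma 2.2 of [Krat, "Advanced Determinant Calculus"]):
with rows/columns indexed by `Fin n` (0-based), the 1-based column index is `(j : ℕ) + 1`,
and the entry is
`(X_i+A_n)⋯(X_i+A_{j+1}) · (X_i+B_j)⋯(X_i+B_2)` (empty products equal 1). -/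
theorem stmt_4 (n : ℕ) (hn : 0 < n) (R : Type*) [CommRing R]
    (X : Fin n → R) (A B : ℕ → R) :
    Matrix.det (Matrix.of fun i j : Fin n =>
        (∏ k ∈ Icc ((j : ℕ) + 2) n, (X i + A k)) *
          ∏ k ∈ Icc 2 ((j : ℕ) + 1), (X i + B k)) =
      (∏ i : Fin n, ∏ j ∈ Ioi i, (X i - X j)) *
        ∏ i ∈ Icc 2 n, ∏ j ∈ Icc i n, (B i - A j) := by
  have hdeg (j : Fin n) : (mixedProd n A B j).natDegree < n := by
    have := natDegree_mixedProd_le A B j.is_lt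
    omega
  have h := det_eval_eq_det_vandermonde_mul_det_coeff X (fun j => mixedProd n A B j) hdeg
  rw [det_coeff_mixedProd, Matrix.det_vandermonde, ← mul_assoc] at h
  simp only [← prod_mul_distrib] at h
  simpa [mixedProd, Polynomial.eval_prod] using h
end

section
/- Let n be a positive integer, R a commutative ring, and X_1,...,X_n, A_2,...,A_n, C elements of R. Then det_{1≤i,j≤n}( (X_i−A_n−C)(X_i−A_{n−1}−C)···(X_i−A_{j+1}−C) · (X_i+A_n)(X_i+A_{n−1})···(X_i+A_{j+1}) ) = ∏_{1≤i<j≤n}(X_j − X_i)(C − X_i − X_j). -/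
open Finset

/-- Reversing the order of `Fin n` in a product over all pairs `i < j`. -/
theorem prod_Ioi_rev {n : ℕ} {M : Type*} [CommMonoid M] (f : Fin n → Fin n → M) :
    ∏ i : Fin n, ∏ j ∈ Ioi i, f j.rev i.rev = ∏ i : Fin n, ∏ j ∈ Ioi i, f i j := by
  have key (g : Fin n → Fin n → M) :
      ∏ i : Fin n, ∏ j ∈ Ioi i, g i j = ∏ i : Fin n, ∏ j : Fin n, if i < j then g i j else 1 := by
    refine prod_congr rfl fun i _ => ?_
    rw [← prod_filter]
    congr 1
    ext j
    simp
  rw [key, key, prod_comm, ← Equiv.prod_comp Fin.revPerm]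
  refine prod_congr rfl fun i _ => ?_
  rw [← Equiv.prod_comp Fin.revPerm]
  simp [Fin.rev_lt_rev]

/-- The Vandermonde determinant in the basis of the products `∏ k ∈ Icc (j + 2) n, (x - c k)`,
whose degrees `n - 1 - j` decrease in `j`. -/
theorem det_prod_Icc_sub {n : ℕ} {R : Type*} [CommRing R] (Y : Fin n → R) (c : ℕ → R) :
    Matrix.det (Matrix.of fun i j : Fin n => ∏ k ∈ Icc ((j : ℕ) + 2) n, (Y i - c k)) =
      ∏ i : Fin n, ∏ j ∈ Ioi i, (Y i - Y j) := by
  nontriviality R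
  let p : Fin n → Polynomial R := fun j =>
    ∏ k ∈ Icc ((j.rev : ℕ) + 2) n, (Polynomial.X - Polynomial.C (c k))
  have h := Matrix.det_eval_matrixOfPolynomials_eq_det_vandermonde (fun i => Y i.rev) p
    (fun j => by
      rw [Polynomial.natDegree_prod_of_monic _ _ fun k _ => Polynomial.monic_X_sub_C (c k)]
      simp only [Polynomial.natDegree_X_sub_C, sum_const, Nat.card_Icc, Fin.val_rev]
      simp only [smul_eq_mul]
      lia)
    (fun j => Polynomial.monic_prod_of_monic _ _ fun k _ => Polynomial.monic_X_sub_C (c k))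
  rw [Matrix.det_vandermonde, prod_Ioi_rev fun i j => Y i - Y j] at h
  rw [h, ← Matrix.det_submatrix_equiv_self Fin.revPerm]
  congr 1
  ext i j
  simp [p, Polynomial.eval_prod]

/-- Determinant lemma (eq. (2.10) of [Krat, "Advanced Determinant Calculus"]):
with rows/columns indexed by `Fin n` (0-based), the 1-based column index is `(j : ℕ) + 1`,
and the entry is
`(X_i−A_n−C)⋯(X_i−A_{j+1}−C) · (X_i+A_n)⋯(X_i+A_{j+1})` (empty products equal 1). -/
theorem stmt_5 (n : ℕ) (hn : 0 < n) (R : Type*) [CommRing R]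
    (X : Fin n → R) (A : ℕ → R) (C : R) :
    Matrix.det (Matrix.of fun i j : Fin n =>
        (∏ k ∈ Icc ((j : ℕ) + 2) n, (X i - A k - C)) *
          ∏ k ∈ Icc ((j : ℕ) + 2) n, (X i + A k)) =
      ∏ i : Fin n, ∏ j ∈ Ioi i, ((X j - X i) * (C - X i - X j)) := by
  have h := det_prod_Icc_sub (fun i => X i * (X i - C)) fun k => A k * (A k + C)
  convert h using 1
  · congr 1
    ext i j
    simp only [Matrix.of_apply, ← prod_mul_distrib]
    exact prod_congr rfl fun k _ => by ring
  · exact prod_congr rfl fun i _ => prod_congr rfl fun j _ => by ring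
end

section
/- Let n be a positive integer, R a commutative ring, X_1,...,X_n, A_2,...,A_n elements of R, and p_0,p_1,...,p_{n−1} polynomials over R with deg p_j ≤ j for j = 0,1,...,n−1. Then det_{1≤i,j≤n}( (X_i+A_n)(X_i+A_{n−1})···(X_i+A_{j+1}) · p_{j−1}(X_i) ) = ∏_{1≤i<j≤n}(X_i − X_j) · ∏_{i=1}^{n} p_{i−1}(−A_i), where for i = 1 the value p_0(−A_1) is the evaluation of p_0 at −A_1 (A_1 may be taken to be an arbitrary element, since p_0 is constant). -/
open Finset

open Polynomial in
/-- Writing `e l = (x + A (l + 2)) ⋯ (x + A n)`, the product of `e j` with a polynomial of degree at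
most `j` is a linear combination of `e 0, …, e j`, with last coefficient `p (-A (j + 1))`. -/
theorem exists_prod_add_mul_eval_eq_sum {R : Type*} [CommRing R] (A : ℕ → R) (n : ℕ) :
    ∀ (j : ℕ) (p : R[X]), j < n → p.natDegree ≤ j →
      ∃ c : ℕ → R, c j = p.eval (-A (j + 1)) ∧
        ∀ x, (∏ k ∈ Icc (j + 2) n, (x + A k)) * p.eval x =
          ∑ l ∈ range (j + 1), (∏ k ∈ Icc (l + 2) n, (x + A k)) * c l := by
  intro j
  induction j with
  | zero =>
    intro p _ hp
    refine ⟨fun _ => p.eval (-A 1), rfl, fun x => ?_⟩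
    rw [eq_C_of_natDegree_le_zero hp]
    simp
  | succ j ih =>
    intro p hj hp
    nontriviality R
    set a := -A (j + 1 + 1) with ha
    have hr : (p /ₘ (X - C a)).natDegree ≤ j := by
      rw [natDegree_divByMonic p (monic_X_sub_C a), natDegree_X_sub_C]
      omega
    obtain ⟨c, -, hc⟩ := ih (p /ₘ (X - C a)) (by omega) hr
    refine ⟨Function.update c (j + 1) (p.eval a), by simp, fun x => ?_⟩
    have hx : p.eval x = p.eval a + (x - a) * (p /ₘ (X - C a)).eval x := by
      have h := congrArg (eval x) (modByMonic_add_div p (X - C a))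
      simpa [modByMonic_X_sub_C_eq_C_eval] using h.symm
    have hprod : ∏ k ∈ Icc (j + 2) n, (x + A k) =
        (x - a) * ∏ k ∈ Icc (j + 1 + 2) n, (x + A k) := by
      rw [← Finset.mul_prod_Ioc_eq_prod_Icc (by omega), ha, sub_neg_eq_add,
        ← Finset.Icc_add_one_left_eq_Ioc, add_right_comm j 2 1]
    have hsum : ∑ l ∈ range (j + 1), (∏ k ∈ Icc (l + 2) n, (x + A k)) *
          Function.update c (j + 1) (p.eval a) l =
        ∑ l ∈ range (j + 1), (∏ k ∈ Icc (l + 2) n, (x + A k)) * c l := by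
      refine sum_congr rfl fun l hl => ?_
      rw [Function.update_of_ne (mem_range.1 hl).ne]
    rw [sum_range_succ, hsum, ← hc, hx, hprod, Function.update_self]
    ring

/-- The Vandermonde determinant in the basis of the polynomials `(x + A (j + 2)) ⋯ (x + A n)`. -/
theorem det_prod_add_eq_prod_sub {R : Type*} [CommRing R] (n : ℕ) (X : Fin n → R) (A : ℕ → R) :
    Matrix.det (Matrix.of fun i j : Fin n => ∏ k ∈ Icc ((j : ℕ) + 2) n, (X i + A k)) =
      ∏ i : Fin n, ∏ j ∈ Ioi i, (X i - X j) := by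
  nontriviality R
  let e : Fin n → Polynomial R := fun j =>
    ∏ k ∈ Icc ((Fin.rev j : ℕ) + 2) n, (Polynomial.X + Polynomial.C (A k))
  have hmonic : ∀ j, (e j).Monic := fun j =>
    Polynomial.monic_prod_of_monic _ _ fun k _ => Polynomial.monic_X_add_C _
  have hdeg : ∀ j, (e j).natDegree = j := fun j => by
    rw [Polynomial.natDegree_prod_of_monic _ _ fun k _ => Polynomial.monic_X_add_C _]
    simp only [Polynomial.natDegree_X_add_C, sum_const, Nat.card_Icc, Fin.val_rev, smul_eq_mul]
    omega
  have hdet := Matrix.det_eval_matrixOfPolynomials_eq_det_vandermonde (X ∘ Fin.rev) e hdeg hmonic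
  rw [Matrix.det_vandermonde] at hdet
  rw [← Matrix.det_submatrix_equiv_self Fin.revPerm]
  convert hdet.symm using 1
  · congr 1
    ext i j
    simp [e, Polynomial.eval_prod]
  · simp only [prod_sigma']
    refine prod_bij' (fun x _ => ⟨Fin.rev x.2, Fin.rev x.1⟩) (fun x _ => ⟨Fin.rev x.2, Fin.rev x.1⟩)
      ?_ ?_ ?_ ?_ ?_ <;> simp

/-- Determinant lemma (Lemma 5 of [Krat, "Advanced Determinant Calculus"]):
with rows/columns indexed by `Fin n` (0-based), the polynomial in column `j`
(1-based `j+1`) is `p j` with `deg (p j) ≤ j`, and the entry is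
`(X_i+A_n)⋯(X_i+A_{j+2}) · p_j(X_i)` (empty products equal 1). On the right-hand
side, `p_{i-1}(−A_i)` (1-based) becomes `(p i).eval (−A (i+1))` (0-based); for the
first factor `p 0` is constant (its degree is ≤ 0), so the value of `A 1` is irrelevant. -/
theorem stmt_6 (n : ℕ) (hn : 0 < n) (R : Type*) [CommRing R]
    (X : Fin n → R) (A : ℕ → R) (p : Fin n → Polynomial R)
    (hdeg : ∀ j : Fin n, (p j).degree ≤ (j : ℕ)) :
    Matrix.det (Matrix.of fun i j : Fin n =>
        (∏ k ∈ Icc ((j : ℕ) + 2) n, (X i + A k)) * (p j).eval (X i)) =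
      (∏ i : Fin n, ∏ j ∈ Ioi i, (X i - X j)) *
        ∏ i : Fin n, (p i).eval (-A ((i : ℕ) + 1)) := by
  choose c hc hsum using fun j : Fin n => exists_prod_add_mul_eval_eq_sum A n j (p j) j.isLt
    (Polynomial.natDegree_le_of_degree_le (hdeg j))
  let U : Matrix (Fin n) (Fin n) R := Matrix.of fun l j => if l ≤ j then c j l else 0
  have hU : U.det = ∏ i : Fin n, (p i).eval (-A ((i : ℕ) + 1)) := by
    have hupper : U.IsUpperTriangular := fun i j hij => if_neg (not_le.2 hij)
    rw [Matrix.det_of_isUpperTriangular hupper]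
    exact prod_congr rfl fun i _ => by simp [U, hc]
  rw [← det_prod_add_eq_prod_sub n X A, ← hU, ← Matrix.det_mul]
  congr 1
  ext i j
  simp only [Matrix.mul_apply, Matrix.of_apply, U, hsum, mul_ite, mul_zero, Fin.le_def]
  rw [Fin.sum_univ_eq_sum_range (fun l => if l ≤ (j : ℕ) then
    (∏ k ∈ Icc (l + 2) n, (X i + A k)) * c j l else 0) n, ← sum_filter]
  refine sum_congr ?_ fun _ _ => rfl
  ext l
  simp only [mem_range, mem_filter]
  omega
end

section
/- Let n ≥ 2 be an integer, R a commutative ring, and A an n×n matrix over R. Denote by A_{i_1,...,i_k}^{j_1,...,j_k} the submatrix of A obtained by deleting rows i_1,...,i_k and columns j_1,...,j_k. Then det A · det A_{1,n}^{1,n} = det A_1^1 · det A_n^n − det A_1^n · det A_n^1. (Desnanot's identity / the Desnanot–Jacobi condensation identity; for n = 2 the determinant of the empty matrix A_{1,n}^{1,n} equals 1.) -/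
namespace Matrix

variable {m k : Type*} [Fintype m] [DecidableEq m] [Fintype k] [DecidableEq k]
  {R : Type*} [CommRing R]

/-- Jacobi's complementary minor formula, multiplied through by `A.det`. -/
theorem det_mul_det_toBlocks₂₂_adjugate (A : Matrix (m ⊕ k) (m ⊕ k) R) :
    A.det * A.adjugate.toBlocks₂₂.det = A.det ^ Fintype.card k * A.toBlocks₁₁.det := by
  have hprod : A * fromBlocks 1 A.adjugate.toBlocks₁₂ 0 A.adjugate.toBlocks₂₂ =
      fromBlocks A.toBlocks₁₁ 0 A.toBlocks₂₁ (A.det • (1 : Matrix k k R)) := by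
    have hadj := A.mul_adjugate
    rw [← fromBlocks_toBlocks A.adjugate] at hadj
    nth_rw 1 [← fromBlocks_toBlocks A] at hadj
    rw [fromBlocks_multiply, ← fromBlocks_one, fromBlocks_smul, fromBlocks_inj] at hadj
    nth_rw 1 [← fromBlocks_toBlocks A]
    rw [fromBlocks_multiply, hadj.2.1, hadj.2.2.2]
    simp
  have hdet := congrArg det hprod
  rw [det_mul, det_fromBlocks_zero₂₁, det_fromBlocks_zero₁₂, det_one, one_mul, det_smul,
    det_one, mul_one] at hdet
  rw [hdet, mul_comm]

/-- Jacobi's complementary minor formula. -/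
theorem det_toBlocks₂₂_adjugate [Nonempty k] (A : Matrix (m ⊕ k) (m ⊕ k) R) :
    A.adjugate.toBlocks₂₂.det = A.det ^ (Fintype.card k - 1) * A.toBlocks₁₁.det := by
  let X := mvPolynomialX (m ⊕ k) (m ⊕ k) ℤ
  have hX : X.adjugate.toBlocks₂₂.det =
      X.det ^ (Fintype.card k - 1) * X.toBlocks₁₁.det := by
    apply mul_left_cancel₀ (det_mvPolynomialX_ne_zero (m ⊕ k) ℤ)
    rw [det_mul_det_toBlocks₂₂_adjugate, ← mul_assoc, ← pow_succ',
      Nat.sub_add_cancel Fintype.card_pos]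
  let f : MvPolynomial ((m ⊕ k) × (m ⊕ k)) ℤ →+* R :=
    (MvPolynomial.aeval fun p : (m ⊕ k) × (m ⊕ k) => A p.1 p.2).toRingHom
  have hA : f.mapMatrix X = A := mvPolynomialX_mapMatrix_aeval ℤ A
  have h := congrArg f hX
  rw [map_mul, map_pow, f.map_det, f.map_det, f.map_det, hA] at h
  have h₁ : f.mapMatrix X.adjugate.toBlocks₂₂ = A.adjugate.toBlocks₂₂ := by
    rw [← hA, ← f.map_adjugate]
    rfl
  have h₂ : f.mapMatrix X.toBlocks₁₁ = A.toBlocks₁₁ := by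
    rw [← hA]
    rfl
  rwa [h₁, h₂] at h

end Matrix

/-- Separates the interior indices of `Fin (n + 2)` from the first and the last one. -/
noncomputable def Fin.interiorSumEndpoints (n : ℕ) : Fin n ⊕ Fin 2 ≃ Fin (n + 2) :=
  Equiv.ofBijective (Sum.elim (fun i => i.succ.castSucc) ![0, Fin.last (n + 1)]) <| by
    rw [Fintype.bijective_iff_injective_and_card]
    refine ⟨Function.Injective.sumElim ?_ ?_ ?_, by simp⟩
    · exact (Fin.castSucc_injective _).comp (Fin.succ_injective _)
    · intro i j h
      fin_cases i <;> fin_cases j <;> simp_all [Fin.ext_iff]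
    · intro i j
      fin_cases j <;> simp [Fin.ext_iff]
      omega


/-- The Desnanot–Jacobi condensation identity. For an `(n+2) × (n+2)` matrix `A`
(so the size is an arbitrary integer ≥ 2):
`det A · det A_{1,n}^{1,n} = det A_1^1 · det A_n^n − det A_1^n · det A_n^1`,
where deleting the first row corresponds to `Fin.succ`, deleting the last row to
`Fin.castSucc`, and deleting both to `fun k => (k.succ).castSucc`. -/
theorem stmt_8 (n : ℕ) (R : Type*) [CommRing R]
    (A : Matrix (Fin (n + 2)) (Fin (n + 2)) R) :
    A.det * (A.submatrix (fun k : Fin n => Fin.castSucc (Fin.succ k))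
        (fun k : Fin n => Fin.castSucc (Fin.succ k))).det =
      (A.submatrix Fin.succ Fin.succ).det *
          (A.submatrix Fin.castSucc Fin.castSucc).det -
        (A.submatrix Fin.succ Fin.castSucc).det *
          (A.submatrix Fin.castSucc Fin.succ).det := by
  let e := Fin.interiorSumEndpoints n
  have h := Matrix.det_toBlocks₂₂_adjugate (A.submatrix e e)
  have hsign : ((-1 : R) ^ (n + 1)) * (-1) ^ (n + 1) = 1 := by
    rw [← mul_pow]
    simp
  have he₀ : e (Sum.inr 0) = 0 := rfl
  have he₁ : e (Sum.inr 1) = Fin.last (n + 1) := rfl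
  have hM : (A.submatrix e e).toBlocks₁₁ =
      A.submatrix (fun k : Fin n => Fin.castSucc (Fin.succ k))
        (fun k : Fin n => Fin.castSucc (Fin.succ k)) := rfl
  rw [hM, Matrix.det_submatrix_equiv_self, Matrix.adjugate_submatrix_equiv_self,
    Matrix.det_fin_two] at h
  simp only [Matrix.toBlocks₂₂, Matrix.of_apply, Matrix.submatrix_apply, he₀, he₁,
    Matrix.adjugate_fin_succ_eq_det_submatrix, Fin.succAbove_zero, Fin.succAbove_last,
    Fin.val_zero, Fin.val_last, Fintype.card_fin, pow_add _ (n + 1) (n + 1), hsign,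
    zero_add, add_zero, pow_zero, one_mul, Nat.add_one_sub_one, pow_one] at h
  linear_combination -h - (A.submatrix Fin.succ Fin.castSucc).det *
    (A.submatrix Fin.castSucc Fin.succ).det * hsign
end

section
/- Let a, b, n be nonnegative integers. Then, as an identity of rational numbers, det_{1≤i,j≤n}( C(a+b, a−i+j) ) = ∏_{i=1}^{n} ∏_{j=1}^{a} ∏_{k=1}^{b} (i+j+k−1)/(i+j+k−2), where C(m, r) denotes the binomial coefficient, with the convention C(m, r) = 0 whenever r < 0 or r > m. -/
open Finset

open Polynomial in
/-- Lagrange interpolation of a polynomial of degree at most `n` at the nodes `0, …, n`,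
evaluated at a point `x` away from the nodes. -/
theorem eval_eq_prod_mul_sum_nodalWeight {n : ℕ} {p : ℚ[X]} (hp : p.natDegree ≤ n) {x : ℚ}
    (hx : ∀ j ∈ range (n + 1), x ≠ j) :
    p.eval x = (∏ j ∈ range (n + 1), (x - (j : ℚ))) *
      ∑ j ∈ range (n + 1), Lagrange.nodalWeight (range (n + 1)) (fun j : ℕ => (j : ℚ)) j *
        (x - j)⁻¹ * p.eval (j : ℚ) := by
  have hinj : Set.InjOn (fun j : ℕ => (j : ℚ)) (range (n + 1)) := Nat.cast_injective.injOn
  have hdeg : p.degree < #(range (n + 1)) := by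
    rw [card_range]
    exact (degree_le_of_natDegree_le hp).trans_lt (by exact_mod_cast Nat.lt_succ_self n)
  conv_lhs => rw [Lagrange.eq_interpolate hinj hdeg]
  rw [Lagrange.eval_interpolate_not_at_node _ hx, Lagrange.eval_nodal]

theorem nodalWeight_range_last (n : ℕ) :
    Lagrange.nodalWeight (range (n + 1)) (fun j : ℕ => (j : ℚ)) n = (n.factorial : ℚ)⁻¹ := by
  rw [Lagrange.nodalWeight, range_add_one, erase_insert notMem_range_self, prod_inv_distrib,
    ← Nat.descFactorial_self, Nat.descFactorial_eq_prod_range, Nat.cast_prod]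
  congr 1
  refine prod_congr rfl fun j hj => ?_
  rw [Nat.cast_sub (mem_range.1 hj).le]

/-- The binomial coefficient `C(a + b, a - i + j)`, zero when the lower index is negative. -/
def shiftedChoose (a b i j : ℕ) : ℚ :=
  if 0 ≤ (a : ℤ) - i + j then (((a + b).choose ((a : ℤ) - i + j).toNat : ℕ) : ℚ) else 0

theorem shiftedChoose_mul_factorial_mul_factorial {a b n i j : ℕ} (hi : i ≤ n) (hj : j ≤ n) :
    shiftedChoose a b i j * (a + j).factorial * (b + n - j).factorial =
      (a + b).factorial * (a + j).descFactorial i * (b + n - j).descFactorial (n - i) := by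
  unfold shiftedChoose
  split_ifs with h
  · have hij : i ≤ a + j := by omega
    have e : ((a : ℤ) - i + j).toNat = a + j - i := by omega
    rw [e]
    norm_cast
    by_cases hq : j ≤ b + i
    · rw [← Nat.factorial_mul_descFactorial hij,
        ← Nat.factorial_mul_descFactorial (show n - i ≤ b + n - j by omega),
        ← Nat.choose_mul_factorial_mul_factorial (show a + j - i ≤ a + b by omega),
        show a + b - (a + j - i) = b + n - j - (n - i) by omega]
      ring
    · rw [Nat.choose_eq_zero_of_lt (by omega),
        Nat.descFactorial_of_lt (show b + n - j < n - i by omega)]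
      ring
  · rw [Nat.descFactorial_of_lt (show a + j < i by omega)]
    simp

/-- Up to normalisation, the last column of the inverse of the matrix
`shiftedChoose a (b + 1) i j` with `i, j ≤ n`. -/
noncomputable def kernelWeight (a b n j : ℕ) : ℚ :=
  Lagrange.nodalWeight (range (n + 1)) (fun j : ℕ => (j : ℚ)) j *
    (a + j).factorial * (b + n - j).factorial

open Polynomial in
theorem sum_shiftedChoose_mul_kernelWeight {a b n i : ℕ} (hi : i ≤ n) :
    ∑ j ∈ range (n + 1), shiftedChoose a (b + 1) i j * kernelWeight a b n j =
      if i = n then ((a + b + 1 + n).factorial : ℚ) * b.factorial / (b + 1 + n).factorial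
      else 0 := by
  let p : ℚ[X] := (descPochhammer ℚ i).comp (C (a : ℚ) + X) *
    (descPochhammer ℚ (n - i)).comp (C ((b + 1 + n : ℕ) : ℚ) - X)
  have hp : p.natDegree ≤ n := by
    refine natDegree_mul_le.trans ?_
    have h1 : (C (a : ℚ) + X).natDegree ≤ 1 := by compute_degree
    have h2 : (C ((b + 1 + n : ℕ) : ℚ) - X).natDegree ≤ 1 := by compute_degree
    rw [natDegree_comp, natDegree_comp, descPochhammer_natDegree, descPochhammer_natDegree]
    nlinarith [Nat.sub_add_cancel hi]
  have hx : ∀ j ∈ range (n + 1), ((b + 1 + n : ℕ) : ℚ) ≠ j := by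
    intro j hj h
    have := mem_range.1 hj
    have := Nat.cast_injective h
    omega
  have heval : ∀ j ≤ n, p.eval (j : ℚ) =
      (a + j).descFactorial i * (b + 1 + n - j).descFactorial (n - i) := by
    intro j hj
    simp only [p, eval_mul, eval_comp, eval_add, eval_sub, eval_C, eval_X]
    rw [← Nat.cast_add, ← Nat.cast_sub (show j ≤ b + 1 + n by omega),
      descPochhammer_eval_eq_descFactorial, descPochhammer_eval_eq_descFactorial]
  have hprod : (∏ j ∈ range (n + 1), (((b + 1 + n : ℕ) : ℚ) - (j : ℚ))) * b.factorial =
      (b + 1 + n).factorial := by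
    rw [← Nat.factorial_mul_descFactorial (show n + 1 ≤ b + 1 + n by omega),
      show b + 1 + n - (n + 1) = b by omega, Nat.descFactorial_eq_prod_range, Nat.cast_mul,
      Nat.cast_prod, mul_comm]
    congr 1
    refine prod_congr rfl fun j hj => ?_
    rw [Nat.cast_sub (by have := mem_range.1 hj; omega)]
  have hsum : ∑ j ∈ range (n + 1), shiftedChoose a (b + 1) i j * kernelWeight a b n j =
      (a + (b + 1)).factorial * ∑ j ∈ range (n + 1),
        Lagrange.nodalWeight (range (n + 1)) (fun j : ℕ => (j : ℚ)) j *
        (((b + 1 + n : ℕ) : ℚ) - j)⁻¹ * p.eval (j : ℚ) := by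
    rw [mul_sum]
    refine sum_congr rfl fun j hj => ?_
    have hj' : j ≤ n := Nat.lt_succ_iff.1 (mem_range.1 hj)
    have key := shiftedChoose_mul_factorial_mul_factorial (a := a) (b := b + 1) hi hj'
    have hfac : ((b + 1 + n - j).factorial : ℚ) =
        (((b + 1 + n : ℕ) : ℚ) - j) * (b + n - j).factorial := by
      rw [← Nat.cast_sub (show j ≤ b + 1 + n by omega),
        show b + 1 + n - j = (b + n - j) + 1 by omega, Nat.factorial_succ]
      push_cast
      ring
    have hne := sub_ne_zero.2 (hx j hj)
    rw [heval j hj', kernelWeight]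
    rw [hfac] at key
    field_simp
    linear_combination
      Lagrange.nodalWeight (range (n + 1)) (fun j : ℕ => (j : ℚ)) j * key
  have hprod0 : (∏ j ∈ range (n + 1), (((b + 1 + n : ℕ) : ℚ) - (j : ℚ))) ≠ 0 :=
    prod_ne_zero_iff.2 fun j hj => sub_ne_zero.2 (hx j hj)
  have hlag := eval_eq_prod_mul_sum_nodalWeight hp hx
  rw [hsum]
  split_ifs with h
  · have hpx : p.eval ((b + 1 + n : ℕ) : ℚ) = (a + b + 1 + n).descFactorial n := by
      subst h
      simp only [p, eval_mul, eval_comp, eval_add, eval_sub, eval_C, eval_X]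
      rw [← Nat.cast_add, descPochhammer_eval_eq_descFactorial, ← add_assoc, ← add_assoc]
      simp
    have hf := Nat.factorial_mul_descFactorial (show n ≤ a + b + 1 + n by omega)
    rw [show a + b + 1 + n - n = a + (b + 1) by omega] at hf
    rw [← hf, Nat.cast_mul, ← hpx, hlag, ← hprod]
    have := Nat.cast_ne_zero (R := ℚ).2 b.factorial_ne_zero
    field_simp
  · have hpx : p.eval ((b + 1 + n : ℕ) : ℚ) = 0 := by
      simp only [p, eval_mul, eval_comp, eval_sub, eval_C, eval_X, sub_self]
      rw [descPochhammer_ne_zero_eval_zero _ (by omega), mul_zero]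
    rw [hpx] at hlag
    rw [(mul_eq_zero.1 hlag.symm).resolve_left hprod0, mul_zero]

open Matrix in
theorem det_shiftedChoose_succ (a b n : ℕ) :
    (of fun i j : Fin (n + 1) => shiftedChoose a (b + 1) i j).det =
      (of fun i j : Fin n => shiftedChoose a (b + 1) i j).det *
        (((a + b + 1 + n).factorial : ℚ) * n.factorial /
          ((a + n).factorial * (b + 1 + n).factorial)) := by
  set M := of fun i j : Fin (n + 1) => shiftedChoose a (b + 1) i j with hM
  let v : Fin (n + 1) → ℚ := fun j => kernelWeight a b n j
  have hMv : M *ᵥ v = Pi.single (Fin.last n)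
      (((a + b + 1 + n).factorial : ℚ) * b.factorial / (b + 1 + n).factorial) := by
    ext i
    have := sum_shiftedChoose_mul_kernelWeight (a := a) (b := b) (Nat.lt_succ_iff.1 i.2)
    rw [← Fin.sum_univ_eq_sum_range
      (fun j => shiftedChoose a (b + 1) i j * kernelWeight a b n j)] at this
    rw [Pi.single_apply]
    simpa [mulVec, dotProduct, hM, v, Fin.ext_iff] using this
  have hadj : (M.adjugate *ᵥ (M *ᵥ v)) (Fin.last n) = M.det * v (Fin.last n) := by
    rw [mulVec_mulVec, adjugate_mul, smul_mulVec, one_mulVec, Pi.smul_apply, smul_eq_mul]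
  have hsub : M.adjugate (Fin.last n) (Fin.last n) =
      (of fun i j : Fin n => shiftedChoose a (b + 1) i j).det := by
    rw [adjugate_fin_succ_eq_det_submatrix, Even.neg_one_pow ⟨_, rfl⟩, one_mul]
    congr 1
    ext i j
    simp [hM]
  have hv : v (Fin.last n) = (n.factorial : ℚ)⁻¹ * (a + n).factorial * b.factorial := by
    simp [v, kernelWeight, nodalWeight_range_last]
  rw [hMv, mulVec_single, hv] at hadj
  simp only [Pi.smul_apply, col_apply, hsub, MulOpposite.smul_eq_mul_unop,
    MulOpposite.unop_op] at hadj
  have h1 := Nat.cast_ne_zero (R := ℚ).2 b.factorial_ne_zero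
  have h2 := Nat.cast_ne_zero (R := ℚ).2 n.factorial_ne_zero
  have h3 := Nat.cast_ne_zero (R := ℚ).2 (a + n).factorial_ne_zero
  have h4 := Nat.cast_ne_zero (R := ℚ).2 (b + 1 + n).factorial_ne_zero
  field_simp at hadj ⊢
  linear_combination -hadj

theorem prod_Icc_shift_div {x : ℚ} (hx : 0 < x) (b : ℕ) :
    ∏ k ∈ Icc 1 b, (x + k) / (x + k - 1) = (x + b) / x := by
  induction b with
  | zero => simp [hx.ne']
  | succ b ih =>
    rw [prod_Icc_succ_top (by omega), ih]
    have : x + b ≠ 0 := by positivity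
    push_cast
    rw [show x + (b + 1 : ℚ) - 1 = x + b by ring]
    field_simp

theorem prod_Icc_prod_Icc_shift_div (a b n : ℕ) :
    ∏ j ∈ Icc 1 a, ∏ k ∈ Icc 1 b,
        (((n + 1 : ℕ) : ℚ) + j + k - 1) / (((n + 1 : ℕ) : ℚ) + j + k - 2) =
      ((a + b + n).factorial : ℚ) * n.factorial / ((a + n).factorial * (b + n).factorial) := by
  induction a with
  | zero =>
    have h1 := Nat.cast_ne_zero (R := ℚ).2 n.factorial_ne_zero
    have h2 := Nat.cast_ne_zero (R := ℚ).2 (b + n).factorial_ne_zero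
    simp only [zero_lt_one, Icc_eq_empty_of_lt, prod_empty, zero_add]
    field_simp
  | succ a ih =>
    rw [prod_Icc_succ_top (by omega), ih]
    have hx : (0 : ℚ) < (n + a + 1 : ℕ) := by positivity
    have h := prod_Icc_shift_div hx b
    have hk : ∏ k ∈ Icc 1 b, (((n + 1 : ℕ) : ℚ) + (a + 1 : ℕ) + k - 1) /
        (((n + 1 : ℕ) : ℚ) + (a + 1 : ℕ) + k - 2) = ((n + a + 1 : ℕ) + b : ℚ) / (n + a + 1 : ℕ) := by
      rw [← h]
      refine prod_congr rfl fun k _ => ?_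
      push_cast
      congr 1 <;> ring
    rw [hk, show a + 1 + b + n = a + b + n + 1 by ring, show a + 1 + n = a + n + 1 by ring,
      Nat.factorial_succ, Nat.factorial_succ]
    have h1 := Nat.cast_ne_zero (R := ℚ).2 (a + n).factorial_ne_zero
    have h2 := Nat.cast_ne_zero (R := ℚ).2 (b + n).factorial_ne_zero
    have h3 : (a : ℚ) + n + 1 ≠ 0 := by positivity
    have h4 : (n : ℚ) + a + 1 ≠ 0 := by positivity
    push_cast
    field_simp
    ring

theorem det_shiftedChoose_zero (a n : ℕ) :
    (Matrix.of fun i j : Fin n => shiftedChoose a 0 i j).det = 1 := by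
  rw [Matrix.det_of_isLowerTriangular]
  · simp [shiftedChoose]
  · intro i j hij
    have hij' : (i : ℕ) < j := hij
    rw [Matrix.of_apply, shiftedChoose, if_pos (by omega), Nat.choose_eq_zero_of_lt (by omega),
      Nat.cast_zero]

/-- MacMahon's box formula determinant:
`det_{1≤i,j≤n}(C(a+b, a−i+j)) = ∏_{i=1}^n ∏_{j=1}^a ∏_{k=1}^b (i+j+k−1)/(i+j+k−2)`.
Rows/columns are indexed by `Fin n` (0-based), so the 1-based `a − i + j` becomes
`(a : ℤ) − i + j`; the binomial coefficient vanishes for a negative lower index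
(and `Nat.choose` already vanishes when the lower index exceeds `a + b`). -/
theorem stmt_9 (a b n : ℕ) :
    Matrix.det (Matrix.of fun i j : Fin n =>
        if 0 ≤ (a : ℤ) - (i : ℕ) + (j : ℕ) then
          (((a + b).choose ((a : ℤ) - (i : ℕ) + (j : ℕ)).toNat : ℕ) : ℚ)
        else 0) =
      ∏ i ∈ Icc 1 n, ∏ j ∈ Icc 1 a, ∏ k ∈ Icc 1 b,
        ((i : ℚ) + j + k - 1) / ((i : ℚ) + j + k - 2) := by
  change (Matrix.of fun i j : Fin n => shiftedChoose a b i j).det = _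
  cases b with
  | zero => simp [det_shiftedChoose_zero]
  | succ b =>
    induction n with
    | zero => simp
    | succ n ih =>
      rw [prod_Icc_succ_top (by omega), ← ih, prod_Icc_prod_Icc_shift_div,
        det_shiftedChoose_succ, ← add_assoc]
end

section
/- Let n be a positive integer, let L_1,...,L_n be nonnegative integers, and let A, B be elements of a field of characteristic zero. Then det_{1≤i,j≤n}( C(B·L_i + A, L_i + j) ) = (∏_{1≤i<j≤n}(L_i − L_j) / ∏_{i=1}^{n}(L_i+n)!) · ∏_{i=1}^{n} ( (B·L_i+A)(B·L_i+A−1)···((B−1)·L_i+A) ) · ∏_{i=1}^{n} (A−B·i+1)_{i−1}, where C(z, k) := z(z−1)···(z−k+1)/k! is the generalized binomial coefficient for z in the field and k a nonnegative integer, and (x)_k := x(x+1)···(x+k−1) is the ascending Pochhammer symbol with (x)_0 := 1. -/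
open Finset

theorem det_eval_mul_det_vandermonde {R : Type*} [CommRing R] {n : ℕ}
    (p : Fin n → Polynomial R) (hp : ∀ j, (p j).natDegree < n) (v w : Fin n → R) :
    (Matrix.of fun i j => (p j).eval (v i)).det * (Matrix.vandermonde w).det =
      (Matrix.of fun i j => (p j).eval (w i)).det * (Matrix.vandermonde v).det := by
  have key : ∀ u : Fin n → R, (Matrix.of fun i j => (p j).eval (u i)) =
      Matrix.vandermonde u * Matrix.of fun k j : Fin n => (p j).coeff k := by
    intro u
    ext i j
    rw [Matrix.of_apply, Polynomial.eval_eq_sum_range' (hp j), Matrix.mul_apply,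
      ← Fin.sum_univ_eq_sum_range (fun k => (p j).coeff k * u i ^ k)]
    simp [Matrix.vandermonde_apply, mul_comm]
  rw [key, key, Matrix.det_mul, Matrix.det_mul]
  ring

/-- Krattenthaler's determinant lemma, for linear factors sharing a common slope `c`. -/
theorem det_prod_sub_mul_prod_sub {F : Type*} [Field F] {n : ℕ} (a : Fin n → F)
    (ha : Function.Injective a) (b : ℕ → F) (c : F) (v : Fin n → F) :
    (Matrix.of fun i j : Fin n =>
        (∏ k ∈ Ioi j, (a k - v i)) * ∏ s ∈ range (j : ℕ), (b s - c * v i)).det =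
      (∏ i : Fin n, ∏ j ∈ Ioi i, (v j - v i)) *
        ∏ j : Fin n, ∏ s ∈ range (j : ℕ), (b s - c * a j) := by
  let p : Fin n → Polynomial F := fun j =>
    (∏ k ∈ Ioi j, (Polynomial.C (a k) - Polynomial.X)) *
      ∏ s ∈ range (j : ℕ), (Polynomial.C (b s) - Polynomial.C c * Polynomial.X)
  have hp : ∀ j, (p j).natDegree < n := by
    intro j
    have h₁ : (∏ k ∈ Ioi j, (Polynomial.C (a k) - Polynomial.X)).natDegree ≤ n - 1 - j := by
      refine (Polynomial.natDegree_prod_le _ _).trans ?_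
      refine (sum_le_card_nsmul _ _ 1 fun k _ => by compute_degree).trans ?_
      simp
    have h₂ : (∏ s ∈ range (j : ℕ),
        (Polynomial.C (b s) - Polynomial.C c * Polynomial.X)).natDegree ≤ (j : ℕ) := by
      refine (Polynomial.natDegree_prod_le _ _).trans ?_
      refine (sum_le_card_nsmul _ _ 1 fun k _ => by compute_degree).trans ?_
      simp
    have h₃ := Polynomial.natDegree_mul_le_of_le h₁ h₂
    have := j.isLt
    change (_ * _ : Polynomial F).natDegree < n
    omega
  have heval : ∀ u : Fin n → F, (Matrix.of fun i j : Fin n =>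
      (∏ k ∈ Ioi j, (a k - u i)) * ∏ s ∈ range (j : ℕ), (b s - c * u i)) =
        Matrix.of fun i j => (p j).eval (u i) := by
    intro u
    ext i j
    simp [p, Polynomial.eval_prod]
  have htri : (Matrix.of fun i j : Fin n =>
      (∏ k ∈ Ioi j, (a k - a i)) * ∏ s ∈ range (j : ℕ), (b s - c * a i)).det =
      (Matrix.vandermonde a).det * ∏ j : Fin n, ∏ s ∈ range (j : ℕ), (b s - c * a j) := by
    rw [Matrix.det_of_isUpperTriangular, Matrix.det_vandermonde, ← prod_mul_distrib]
    · rfl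
    · intro i j hij
      have hij' : j < i := hij
      exact mul_eq_zero_of_left (prod_eq_zero (mem_Ioi.mpr hij') (sub_self _)) _
  have hdet := det_eval_mul_det_vandermonde p hp v a
  rw [← heval, ← heval, htri] at hdet
  refine mul_right_cancel₀ (Matrix.det_vandermonde_ne_zero_iff.mpr ha) ?_
  rw [hdet, ← Matrix.det_vandermonde]
  ring

theorem factorial_mul_prod_Ioi {n : ℕ} (l : ℕ) (j : Fin n) :
    (l + (j + 1)).factorial * ∏ k ∈ Ioi j, (l + (k : ℕ) + 1) = (l + n).factorial := by
  have hIco : ∀ m, (j : ℕ) + 1 ≤ m →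
      (l + (j + 1)).factorial * ∏ k ∈ Ico ((j : ℕ) + 1) m, (l + k + 1) = (l + m).factorial := by
    intro m hm
    induction m, hm using Nat.le_induction with
    | base => simp
    | succ m hm ih =>
      rw [prod_Ico_succ_top hm, ← mul_assoc, ih, ← add_assoc l m 1, Nat.factorial_succ, mul_comm]
  rw [← hIco n j.isLt]
  congr 1
  have h := prod_map (Ioi j) Fin.valEmbedding fun k => l + k + 1
  rw [Fin.map_valEmbedding_Ioi] at h
  exact h.symm

theorem ascPochhammer_eval_eq_prod_sub {R : Type*} [CommRing R] (m : ℕ) (x : R) :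
    (ascPochhammer R m).eval (x - m) = ∏ s ∈ range m, (x - ((s : R) + 1)) := by
  induction m generalizing x with
  | zero => simp
  | succ m ih =>
    have h := ih (x - 1)
    rw [prod_range_succ', ascPochhammer_succ_eval]
    have hx : x - ((m + 1 : ℕ) : R) = x - 1 - m := by push_cast; ring
    rw [hx, h]
    congr 1
    · refine prod_congr rfl fun s _ => ?_
      push_cast
      ring
    · push_cast
      ring

/-- Determinant evaluation (eq. (3.13) of [Krat, "Advanced Determinant Calculus"]):
`det_{1≤i,j≤n}(C(B·L_i + A, L_i + j))`, where `C(z,k) = z(z−1)⋯(z−k+1)/k!` is the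
generalized binomial coefficient. Rows/columns are indexed by `Fin n` (0-based), so the
1-based column index is `(j : ℕ) + 1`. The factor
`(B·L_i+A)(B·L_i+A−1)⋯((B−1)·L_i+A)` is the descending product of `L_i + 1` consecutive
terms starting at `B·L_i+A`, and `(x)_k` is the ascending Pochhammer symbol
(`ascPochhammer`). -/
theorem stmt_10 (n : ℕ) (hn : 0 < n) (F : Type*) [Field F] [CharZero F]
    (L : Fin n → ℕ) (A B : F) :
    Matrix.det (Matrix.of fun i j : Fin n =>
        (∏ m ∈ Finset.range (L i + ((j : ℕ) + 1)), (B * (L i : F) + A - (m : F))) /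
          ((L i + ((j : ℕ) + 1)).factorial : F)) =
      ((∏ i : Fin n, ∏ j ∈ Ioi i, ((L i : F) - (L j : F))) /
          ∏ i : Fin n, ((L i + n).factorial : F)) *
        (∏ i : Fin n, ∏ k ∈ Finset.range (L i + 1), (B * (L i : F) + A - (k : F))) *
        ∏ i : Fin n,
          (ascPochhammer F (i : ℕ)).eval (A - B * (((i : ℕ) : F) + 1) + 1) := by
  let r : Fin n → F := fun i =>
    (∏ k ∈ range (L i + 1), (B * (L i : F) + A - (k : F))) / ((L i + n).factorial : F)
  let a : Fin n → F := fun k => ((k : ℕ) : F) + 1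
  let b : ℕ → F := fun s => A - ((s : F) + 1)
  let v : Fin n → F := fun i => -(L i : F)
  have ha : Function.Injective a := fun x y hxy => by simpa [a, Fin.val_inj] using hxy
  have hentry : (Matrix.of fun i j : Fin n =>
        (∏ m ∈ range (L i + ((j : ℕ) + 1)), (B * (L i : F) + A - (m : F))) /
          ((L i + ((j : ℕ) + 1)).factorial : F)) =
      Matrix.of fun i j => r i * (Matrix.of fun i j : Fin n =>
        (∏ k ∈ Ioi j, (a k - v i)) * ∏ s ∈ range (j : ℕ), (b s - (B - 1) * v i)) i j := by
    ext i j
    have hfac : ((L i + ((j : ℕ) + 1)).factorial : F) * ∏ k ∈ Ioi j, (a k - v i) =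
        ((L i + n).factorial : F) := by
      rw [← factorial_mul_prod_Ioi (L i) j, Nat.cast_mul, Nat.cast_prod]
      congr 1
      refine prod_congr rfl fun k _ => ?_
      simp only [a, v]
      push_cast
      ring
    have hnum : ∏ m ∈ range (L i + ((j : ℕ) + 1)), (B * (L i : F) + A - (m : F)) =
        (∏ k ∈ range (L i + 1), (B * (L i : F) + A - (k : F))) *
          ∏ s ∈ range (j : ℕ), (b s - (B - 1) * v i) := by
      rw [← add_assoc, add_right_comm, prod_range_add]
      congr 1
      refine prod_congr rfl fun s _ => ?_
      simp only [b, v]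
      push_cast
      ring
    have h₀ : ((L i + ((j : ℕ) + 1)).factorial : F) ≠ 0 :=
      Nat.cast_ne_zero.mpr (Nat.factorial_ne_zero _)
    have h₁ : ((L i + n).factorial : F) ≠ 0 :=
      Nat.cast_ne_zero.mpr (Nat.factorial_ne_zero _)
    simp only [Matrix.of_apply, r]
    rw [hnum, div_mul_eq_mul_div, div_eq_div_iff h₀ h₁, ← hfac]
    ring
  have hpoch : ∀ j : Fin n, ∏ s ∈ range (j : ℕ), (b s - (B - 1) * a j) =
      (ascPochhammer F (j : ℕ)).eval (A - B * (((j : ℕ) : F) + 1) + 1) := by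
    intro j
    have hx : A - B * (((j : ℕ) : F) + 1) + 1 = A - (B - 1) * a j - ((j : ℕ) : F) := by
      simp only [a]
      ring
    rw [hx, ascPochhammer_eval_eq_prod_sub]
    refine prod_congr rfl fun s _ => ?_
    simp only [b]
    ring
  have hv : ∀ i j, v j - v i = (L i : F) - (L j : F) := fun i j => by
    simp only [v]
    ring
  rw [hentry, Matrix.det_mul_column, det_prod_sub_mul_prod_sub a ha]
  simp only [hpoch, hv, r, prod_div_distrib]
  ring
end

section
/- Let n be a nonnegative integer and μ an element of a field of characteristic zero containing the rationals (e.g. μ real). Then det_{0≤i,j≤n−1}( C(μ+i+j, 2i−j) ) = (−1)^{χ(n≡3 mod 4)} · 2^{C(n−1,2)} · ∏_{i=1}^{n−1} ( (μ+i+1)_{⌊(i+1)/2⌋} · (−μ−3n+i+3/2)_{⌊i/2⌋} / (i)_i ), where χ(A) = 1 if A is true and χ(A) = 0 otherwise. -/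
open Finset

/-- Generalized binomial coefficient `C(z, k)` for `z` in a field and `k : ℤ`:
`z(z−1)⋯(z−k+1)/k!` if `k ≥ 0`, and `0` if `k < 0`. -/
noncomputable def genBinom (F : Type*) [Field F] (z : F) (k : ℤ) : F :=
  if 0 ≤ k then (∏ m ∈ Finset.range k.toNat, (z - (m : F))) / (k.toNat.factorial : F)
  else 0

namespace MillsRobbinsRumsey

lemma inv_Gamma (z : ℝ) : (Real.Gamma z)⁻¹ = z * (Real.Gamma (z + 1))⁻¹ := by
  rcases eq_or_ne z 0 with rfl | hz
  · simp [Real.Gamma_zero]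
  · rw [Real.Gamma_add_one hz, mul_inv, ← mul_assoc, mul_inv_cancel₀ hz, one_mul]

lemma inv_Gamma' {z w : ℝ} (h : w = z + 1) : (Real.Gamma z)⁻¹ = z * (Real.Gamma w)⁻¹ := by
  rw [h, inv_Gamma]

lemma Gamma_succ' {z w : ℝ} (hz : 0 < z) (h : w = z + 1) : Real.Gamma w = z * Real.Gamma z := by
  rw [h, Real.Gamma_add_one hz.ne']

lemma inv_Gamma_int_eq_zero {z : ℤ} (hz : z ≤ 0) : (Real.Gamma (z : ℝ))⁻¹ = 0 := by
  obtain ⟨m, rfl⟩ : ∃ m : ℕ, z = -(m : ℤ) := ⟨z.natAbs, by omega⟩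
  simp [Real.Gamma_neg_nat_eq_zero]

/-- Entry `k` of column `j` of the upper triangular matrix (up to column scaling) that brings
the matrix `C(μ+i+k, 2i-k)` to lower triangular form. -/
noncomputable def col (j k : ℕ) (μ : ℝ) : ℝ :=
  (-4) ^ k * Real.Gamma (2 * j - k) * (Real.Gamma k)⁻¹ * (Real.Gamma (2 * μ + 2 * j + k + 2))⁻¹ *
    (Real.Gamma (j - k + 1))⁻¹ * Real.Gamma (μ + k + 1) * Real.Gamma (μ + j + k + 1 / 2)

/-- The binomial coefficient `C(μ+i+k, 2i-k)` in terms of the Gamma function. -/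
noncomputable def binom (i k : ℕ) (μ : ℝ) : ℝ :=
  Real.Gamma (μ + i + k + 1) * (Real.Gamma (2 * i - k + 1))⁻¹ *
    (Real.Gamma (μ - i + 2 * k + 1))⁻¹

/-- The polynomial part of the telescoping certificate. -/
def certPoly (i j k μ : ℝ) : ℝ :=
  (-36 - 28*μ - 6*μ^2 - 88*j - 52*j*μ - 4*j*μ^2 - 48*j^2 - 24*j^2*μ - 52*i - 22*i*μ - 4*i*μ^2
    - 112*i*j - 20*i*j*μ - 48*i*j^2 - 16*i^2 - 4*i^2*μ - 24*i^2*j) +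
  (28 + 19*μ + 4*μ^2 + 26*j + 22*j*μ - 12*j^2 + 39*i + 2*i*μ + 42*i*j + 6*i^2) * k +
  (-2 + 12*j - 12*i) * k^2

/-- The telescoping certificate. -/
noncomputable def cert (i j k : ℕ) (μ : ℝ) : ℝ :=
  certPoly i j k μ * (-4) ^ k * Real.Gamma (μ + i + k + 1) * (Real.Gamma (2 * i - k + 3))⁻¹ *
    (Real.Gamma (μ - i + 2 * k))⁻¹ * Real.Gamma (2 * j - k + 1) * (Real.Gamma (k - 1))⁻¹ *
    (Real.Gamma (2 * μ + 2 * j + k + 3))⁻¹ * (Real.Gamma (j - k + 2))⁻¹ *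
    Real.Gamma (μ + k + 1) * Real.Gamma (μ + j + k + 3 / 2)

def coeffA (i j μ : ℝ) : ℝ := 2 * (2*i+1) * (2*μ+2*j+2*i+5) * (μ+6*j-3*i+2)

def coeffB (i j μ : ℝ) : ℝ :=
  60 + 94*μ + 48*μ^2 + 8*μ^3 + 252*j + 256*j*μ + 64*j*μ^2 + 336*j^2 + 168*j^2*μ + 144*j^3 + 30*i
    + 32*i*μ + 8*i*μ^2 + 96*i*j + 48*i*j*μ + 72*i*j^2

def coeffC (i j μ : ℝ) : ℝ :=
  44 + 60*μ + 27*μ^2 + 4*μ^3 + 68*j + 62*j*μ + 14*j*μ^2 + 24*j^2 + 12*j^2*μ + 24*i + 24*i*μ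
    + 6*i*μ^2 + 46*i*j + 20*i*j*μ + 12*i*j^2 - 11*i^2 - 4*i^2*μ + 6*i^2*j - 6*i^3

lemma col_zero (j : ℕ) (μ : ℝ) : col j 0 μ = 0 := by simp [col, Real.Gamma_zero]

lemma col_of_lt {j k : ℕ} (h : j < k) (μ : ℝ) : col j k μ = 0 := by
  have := inv_Gamma_int_eq_zero (z := (j : ℤ) - k + 1) (by omega)
  push_cast at this
  simp [col, this]

lemma cert_zero (i j : ℕ) (μ : ℝ) : cert i j 0 μ = 0 := by
  have : (Real.Gamma (0 - 1 : ℝ))⁻¹ = 0 := by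
    simpa using inv_Gamma_int_eq_zero (z := -1) (by norm_num)
  rw [cert, Nat.cast_zero, this]
  ring

lemma cert_one (i j : ℕ) (μ : ℝ) : cert i j 1 μ = 0 := by
  simp [cert, Real.Gamma_zero]

lemma telescope_aux {i j k : ℕ} {μ : ℝ} (hk : 1 ≤ k) (hkj : k ≤ j) (hμ : (i : ℝ) < μ) :
    coeffA i j μ * (binom (i + 1) k μ * col (j + 1) k μ) +
      coeffB i j μ * (binom i k (μ + 1) * col j k (μ + 1)) +
      coeffC i j μ * (binom i k μ * col (j + 1) k μ) = cert i j (k + 1) μ - cert i j k μ := by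
  have hk' : (1 : ℝ) ≤ k := by exact_mod_cast hk
  have hkj' : (k : ℝ) ≤ j := by exact_mod_cast hkj
  have hi : (0 : ℝ) ≤ i := Nat.cast_nonneg i
  simp only [binom, col, cert, pow_succ, Nat.cast_add, Nat.cast_one]
  generalize (i : ℝ) = i at *
  generalize (j : ℝ) = j at *
  generalize (k : ℝ) = κ at *
  rw [Gamma_succ' (z := μ + i + κ + 1) (w := μ + (i + 1) + κ + 1) (by linarith) (by ring),
    Gamma_succ' (z := μ + i + κ + 1) (w := μ + 1 + i + κ + 1) (by linarith) (by ring),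
    Gamma_succ' (z := μ + i + κ + 1) (w := μ + i + (κ + 1) + 1) (by linarith) (by ring),
    inv_Gamma' (z := 2 * i - κ + 1) (w := 2 * i - κ + 2) (by ring),
    inv_Gamma' (z := 2 * i - κ + 2) (w := 2 * i - κ + 3) (by ring),
    inv_Gamma' (z := 2 * i - (κ + 1) + 3) (w := 2 * i - κ + 3) (by ring),
    show 2 * (i + 1) - κ + 1 = 2 * i - κ + 3 by ring,
    show μ - (i + 1) + 2 * κ + 1 = μ - i + 2 * κ by ring,
    show μ + 1 - i + 2 * κ + 1 = μ - i + 2 * κ + 2 by ring,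
    show μ - i + 2 * (κ + 1) = μ - i + 2 * κ + 2 by ring,
    inv_Gamma' (z := μ - i + 2 * κ) (w := μ - i + 2 * κ + 1) (by ring),
    inv_Gamma' (z := μ - i + 2 * κ + 1) (w := μ - i + 2 * κ + 2) (by ring),
    Gamma_succ' (z := 2 * j - κ + 1) (w := 2 * (j + 1) - κ) (by linarith) (by ring),
    Gamma_succ' (z := 2 * j - κ) (w := 2 * j - κ + 1) (by linarith) (by ring),
    show 2 * j - (κ + 1) + 1 = 2 * j - κ by ring,
    show κ + 1 - 1 = κ by ring,
    inv_Gamma' (z := κ - 1) (w := κ) (by ring),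
    inv_Gamma' (z := 2 * μ + 2 * j + κ + 3) (w := 2 * μ + 2 * j + κ + 4) (by ring),
    show 2 * μ + 2 * (j + 1) + κ + 2 = 2 * μ + 2 * j + κ + 4 by ring,
    show 2 * (μ + 1) + 2 * j + κ + 2 = 2 * μ + 2 * j + κ + 4 by ring,
    show 2 * μ + 2 * j + (κ + 1) + 3 = 2 * μ + 2 * j + κ + 4 by ring,
    show j + 1 - κ + 1 = j - κ + 2 by ring,
    show j - (κ + 1) + 2 = j - κ + 1 by ring,
    inv_Gamma' (z := j - κ + 1) (w := j - κ + 2) (by ring),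
    Gamma_succ' (z := μ + κ + 1) (w := μ + 1 + κ + 1) (by linarith) (by ring),
    Gamma_succ' (z := μ + κ + 1) (w := μ + (κ + 1) + 1) (by linarith) (by ring),
    show μ + (j + 1) + κ + 1 / 2 = μ + j + κ + 3 / 2 by ring,
    show μ + 1 + j + κ + 1 / 2 = μ + j + κ + 3 / 2 by ring,
    Gamma_succ' (z := μ + j + κ + 3 / 2) (w := μ + j + (κ + 1) + 3 / 2) (by linarith) (by ring)]
  generalize Real.Gamma (μ + i + κ + 1) = g1
  generalize (Real.Gamma (2 * i - κ + 3))⁻¹ = g2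
  generalize (Real.Gamma (μ - i + 2 * κ + 2))⁻¹ = g3
  generalize Real.Gamma (2 * j - κ) = g4
  generalize (Real.Gamma κ)⁻¹ = g5
  generalize (Real.Gamma (2 * μ + 2 * j + κ + 4))⁻¹ = g6
  generalize (Real.Gamma (j - κ + 2))⁻¹ = g7
  generalize Real.Gamma (μ + κ + 1) = g8
  generalize Real.Gamma (μ + j + κ + 3 / 2) = g9
  generalize (-4 : ℝ) ^ k = g0
  rw [← sub_eq_zero]
  trans (g0 * g1 * g2 * g3 * g4 * g5 * g6 * g7 * g8 * g9) * 0
  · rw [← show coeffA i j μ * ((μ+i+κ+1)*(μ-i+2*κ)*(μ-i+2*κ+1)*(2*j-κ)*(2*j-κ+1)) +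
      coeffB i j μ * ((μ+i+κ+1)*(2*i-κ+1)*(2*i-κ+2)*(j-κ+1)*(μ+κ+1)) +
      coeffC i j μ * ((2*i-κ+1)*(2*i-κ+2)*(μ-i+2*κ+1)*(2*j-κ)*(2*j-κ+1)) -
      ((-4*(μ+i+κ+1)*(2*i-κ+2)*(j-κ+1)*(μ+κ+1)*(μ+j+κ+3/2)) * certPoly i j (κ+1) μ -
        ((μ-i+2*κ)*(μ-i+2*κ+1)*(2*j-κ)*(κ-1)*(2*μ+2*j+κ+3)) * certPoly i j κ μ) = 0 by
      simp only [coeffA, coeffB, coeffC, certPoly]; ring]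
    generalize coeffA i j μ = a
    generalize coeffB i j μ = b
    generalize coeffC i j μ = c
    generalize certPoly i j (κ+1) μ = x
    generalize certPoly i j κ μ = y
    ring
  · ring

lemma telescope_last {i j : ℕ} {μ : ℝ} (hj : 1 ≤ j) (hμ : (i : ℝ) < μ) :
    coeffA i j μ * (binom (i + 1) (j + 1) μ * col (j + 1) (j + 1) μ) +
      coeffC i j μ * (binom i (j + 1) μ * col (j + 1) (j + 1) μ) = - cert i j (j + 1) μ := by
  have hj' : (1 : ℝ) ≤ j := by exact_mod_cast hj
  have hi : (0 : ℝ) ≤ i := Nat.cast_nonneg i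
  simp only [binom, col, cert, pow_succ, Nat.cast_add, Nat.cast_one]
  generalize (i : ℝ) = i at *
  generalize hκ : (-4 : ℝ) ^ j = g0
  generalize (j : ℝ) = j at *
  rw [show μ + (i + 1) + (j + 1) + 1 = μ + i + j + 3 by ring,
    show μ + i + (j + 1) + 1 = μ + i + j + 2 by ring,
    Gamma_succ' (z := μ + i + j + 2) (w := μ + i + j + 3) (by linarith) (by ring),
    inv_Gamma' (z := 2 * i - (j + 1) + 1) (w := 2 * i - j + 1) (by ring),
    inv_Gamma' (z := 2 * i - j + 1) (w := 2 * i - j + 2) (by ring),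
    show 2 * (i + 1) - (j + 1) + 1 = 2 * i - j + 2 by ring,
    show 2 * i - (j + 1) + 3 = 2 * i - j + 2 by ring,
    inv_Gamma' (z := μ - i + 2 * (j + 1)) (w := μ - i + 2 * j + 3) (by ring),
    show μ - (i + 1) + 2 * (j + 1) + 1 = μ - i + 2 * (j + 1) by ring,
    inv_Gamma' (z := μ - i + 2 * (j + 1)) (w := μ - i + 2 * j + 3) (by ring),
    show μ - i + 2 * (j + 1) + 1 = μ - i + 2 * j + 3 by ring,
    Gamma_succ' (z := 2 * j - (j + 1) + 1) (w := 2 * (j + 1) - (j + 1)) (by linarith) (by ring),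
    show j + 1 - 1 = j by ring,
    inv_Gamma' (z := j) (w := j + 1) (by ring),
    inv_Gamma' (z := 2 * μ + 2 * j + (j + 1) + 3) (w := 2 * μ + 3 * j + 5) (by ring),
    show 2 * μ + 2 * (j + 1) + (j + 1) + 2 = 2 * μ + 3 * j + 5 by ring,
    show j + 1 - (j + 1) + 1 = 1 by ring,
    show j - (j + 1) + 2 = 1 by ring,
    show μ + (j + 1) + (j + 1) + 1 / 2 = μ + 2 * j + 5 / 2 by ring,
    show μ + j + (j + 1) + 3 / 2 = μ + 2 * j + 5 / 2 by ring]
  generalize Real.Gamma (μ + i + j + 2) = g1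
  generalize (Real.Gamma (2 * i - j + 2))⁻¹ = g2
  generalize (Real.Gamma (μ - i + 2 * j + 3))⁻¹ = g3
  generalize Real.Gamma (2 * j - (j + 1) + 1) = g4
  generalize (Real.Gamma (j + 1))⁻¹ = g5
  generalize (Real.Gamma (2 * μ + 3 * j + 5))⁻¹ = g6
  generalize (Real.Gamma 1)⁻¹ = g7
  generalize Real.Gamma (μ + (j + 1) + 1) = g8
  generalize Real.Gamma (μ + 2 * j + 5 / 2) = g9
  simp only [coeffA, coeffC, certPoly]
  ring

/-- The inner product of row `i` of the matrix with column `j` of the triangular matrix. -/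
noncomputable def rowDotCol (i j : ℕ) (μ : ℝ) : ℝ :=
  ∑ k ∈ range (j + 1), binom i k μ * col j k μ

lemma rowDotCol_recurrence {i j : ℕ} {μ : ℝ} (hj : 1 ≤ j) (hμ : (i : ℝ) < μ) :
    coeffA i j μ * rowDotCol (i + 1) (j + 1) μ + coeffB i j μ * rowDotCol i j (μ + 1) +
      coeffC i j μ * rowDotCol i (j + 1) μ = 0 := by
  have h : ∀ k ∈ range (j + 1), coeffA i j μ * (binom (i + 1) k μ * col (j + 1) k μ) +
      coeffB i j μ * (binom i k (μ + 1) * col j k (μ + 1)) +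
      coeffC i j μ * (binom i k μ * col (j + 1) k μ) = cert i j (k + 1) μ - cert i j k μ := by
    intro k hk
    rcases Nat.eq_zero_or_pos k with rfl | hk0
    · simp [col_zero, cert_zero, cert_one]
    · exact telescope_aux hk0 (by simpa [Nat.lt_succ_iff] using hk) hμ
  have h2 := Finset.sum_congr rfl h
  rw [Finset.sum_range_sub (fun k => cert i j k μ), cert_zero, Finset.sum_add_distrib, Finset.sum_add_distrib,
    ← Finset.mul_sum, ← Finset.mul_sum, ← Finset.mul_sum] at h2
  rw [rowDotCol, rowDotCol, rowDotCol, Finset.sum_range_succ _ (j + 1), Finset.sum_range_succ _ (j + 1)]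
  linear_combination h2 + telescope_last hj hμ

lemma rowDotCol_zero_left (j : ℕ) (μ : ℝ) : rowDotCol 0 j μ = 0 := by
  refine Finset.sum_eq_zero fun k _ => ?_
  rcases Nat.eq_zero_or_pos k with rfl | hk
  · simp [col_zero]
  · have := inv_Gamma_int_eq_zero (z := 0 - (k : ℤ) + 1) (by omega)
    push_cast at this
    rw [binom, Nat.cast_zero, mul_zero, this]
    ring

lemma coeffA_pos {i j : ℕ} (hij : i ≤ j) {μ : ℝ} (hμ : 0 < μ) : 0 < coeffA i j μ := by
  have h : (i : ℝ) ≤ j := by exact_mod_cast hij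
  have : (0 : ℝ) < μ + 6 * j - 3 * i + 2 := by
    have : (0 : ℝ) ≤ i := Nat.cast_nonneg i
    linarith
  unfold coeffA
  positivity

lemma rowDotCol_eq_zero {i j : ℕ} (hij : i < j) {μ : ℝ} (hμ : (i : ℝ) < μ) : rowDotCol i j μ = 0 := by
  induction i generalizing j μ with
  | zero => exact rowDotCol_zero_left j μ
  | succ i ih =>
    obtain ⟨j, rfl⟩ : ∃ l, j = l + 1 := ⟨j - 1, by omega⟩
    have hi : (0 : ℝ) ≤ i := Nat.cast_nonneg i
    push_cast at hμ
    have h := rowDotCol_recurrence (i := i) (j := j) (μ := μ) (by omega) (by linarith)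
    rw [ih (by omega) (by linarith), ih (by omega) (by linarith), mul_zero, mul_zero, add_zero,
      add_zero] at h
    exact (mul_eq_zero.1 h).resolve_left (coeffA_pos (by omega) (by linarith)).ne'

lemma rowDotCol_diag_succ {j : ℕ} (hj : 1 ≤ j) {μ : ℝ} (hμ : (j : ℝ) < μ) :
    coeffA j j μ * rowDotCol (j + 1) (j + 1) μ + coeffB j j μ * rowDotCol j j (μ + 1) = 0 := by
  have h := rowDotCol_recurrence (i := j) hj hμ
  rwa [rowDotCol_eq_zero (Nat.lt_succ_self j) hμ, mul_zero, add_zero] at h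

/-- The ratio of consecutive determinants. -/
noncomputable def detRatio (j : ℕ) (μ : ℝ) : ℝ :=
  2 ^ (j - 1) * Real.Gamma (μ + j + 1 + ((j + 1) / 2 : ℕ)) / Real.Gamma (μ + j + 1) *
    (Real.Gamma j / Real.Gamma (2 * j)) *
    (Real.Gamma (μ + 3 * j + 1 / 2) / Real.Gamma (μ + 2 * j + 3 / 2)) *
    (Real.Gamma (μ + 2 * j + 1 / 2 - ((j - 1) / 2 : ℕ)) / Real.Gamma (μ + 2 * j + 1 / 2))

lemma detRatio_succ {j : ℕ} (hj : 1 ≤ j) {μ : ℝ} (hμ : 0 < μ) :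
    detRatio (j + 1) μ = (2*μ+6*j+5) * (2*μ+6*j+3) * (2*μ+3*j+4) /
      (4 * (2*j+1) * (2*μ+4*j+5) * (μ+2*j+3/2)) * detRatio j (μ + 1) := by
  have hj' : (1 : ℝ) ≤ j := by exact_mod_cast hj
  have key : Real.Gamma (μ + (j + 1 : ℕ) + 1 + ((j + 1 + 1) / 2 : ℕ)) *
      Real.Gamma (μ + 2 * (j + 1 : ℕ) + 1 / 2 - ((j + 1 - 1) / 2 : ℕ)) =
      (μ + 3 * j / 2 + 2) * (Real.Gamma (μ + 1 + j + 1 + ((j + 1) / 2 : ℕ)) *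
      Real.Gamma (μ + 1 + 2 * j + 1 / 2 - ((j - 1) / 2 : ℕ))) := by
    rcases Nat.even_or_odd' j with ⟨a, rfl | rfl⟩
    · obtain ⟨a, rfl⟩ : ∃ b, a = b + 1 := ⟨a - 1, by omega⟩
      rw [show (2 * (a + 1) + 1 + 1) / 2 = a + 2 by omega, show (2 * (a + 1) + 1) / 2 = a + 1 by omega,
        show (2 * (a + 1) + 1 - 1) / 2 = a + 1 by omega, show (2 * (a + 1) - 1) / 2 = a by omega]
      push_cast
      rw [Gamma_succ' (z := μ + 1 + 2 * (a + 1) + 1 + (a + 1))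
        (w := μ + (2 * (a + 1) + 1) + 1 + (a + 2)) (by positivity) (by ring),
        show μ + 2 * (2 * ((a : ℝ) + 1) + 1) + 1 / 2 - (a + 1) =
          μ + 1 + 2 * (2 * (a + 1)) + 1 / 2 - a by ring]
      ring
    · rw [show (2 * a + 1 + 1 + 1) / 2 = a + 1 by omega, show (2 * a + 1 + 1) / 2 = a + 1 by omega,
        show (2 * a + 1 + 1 - 1) / 2 = a by omega, show (2 * a + 1 - 1) / 2 = a by omega]
      push_cast
      rw [Gamma_succ' (z := μ + 1 + 2 * (2 * a + 1) + 1 / 2 - a)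
        (w := μ + 2 * (2 * a + 1 + 1) + 1 / 2 - a) (by nlinarith [(Nat.cast_nonneg a : (0:ℝ) ≤ a)]) (by ring),
        show μ + (2 * (a : ℝ) + 1 + 1) + 1 + (a + 1) = μ + 1 + (2 * a + 1) + 1 + (a + 1) by ring]
      ring
  have e1 : detRatio (j + 1) μ = 2 ^ j *
      (Real.Gamma (μ + (j + 1 : ℕ) + 1 + ((j + 1 + 1) / 2 : ℕ)) *
      Real.Gamma (μ + 2 * (j + 1 : ℕ) + 1 / 2 - ((j + 1 - 1) / 2 : ℕ))) /
      Real.Gamma (μ + j + 2) * (Real.Gamma (j + 1) / Real.Gamma (2 * j + 2)) *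
      (Real.Gamma (μ + 3 * j + 7 / 2) / Real.Gamma (μ + 2 * j + 7 / 2)) /
      Real.Gamma (μ + 2 * j + 5 / 2) := by
    rw [detRatio]
    generalize Real.Gamma (μ + (j + 1 : ℕ) + 1 + ((j + 1 + 1) / 2 : ℕ)) = x
    generalize Real.Gamma (μ + 2 * (j + 1 : ℕ) + 1 / 2 - ((j + 1 - 1) / 2 : ℕ)) = y
    push_cast
    rw [show μ + (j + 1 : ℝ) + 1 = μ + j + 2 by ring, show 2 * (j + 1 : ℝ) = 2 * j + 2 by ring,
      show μ + 3 * (j + 1 : ℝ) + 1 / 2 = μ + 3 * j + 7 / 2 by ring,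
      show μ + (2 * j + 2 : ℝ) + 3 / 2 = μ + 2 * j + 7 / 2 by ring,
      show μ + (2 * j + 2 : ℝ) + 1 / 2 = μ + 2 * j + 5 / 2 by ring]
    ring
  have e2 : detRatio j (μ + 1) = 2 ^ (j - 1) *
      (Real.Gamma (μ + 1 + j + 1 + ((j + 1) / 2 : ℕ)) *
      Real.Gamma (μ + 1 + 2 * j + 1 / 2 - ((j - 1) / 2 : ℕ))) /
      Real.Gamma (μ + j + 2) * (Real.Gamma j / Real.Gamma (2 * j)) *
      (Real.Gamma (μ + 3 * j + 3 / 2) / Real.Gamma (μ + 2 * j + 5 / 2)) /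
      Real.Gamma (μ + 2 * j + 3 / 2) := by
    rw [detRatio]
    generalize Real.Gamma (μ + 1 + j + 1 + ((j + 1) / 2 : ℕ)) = x
    generalize Real.Gamma (μ + 1 + 2 * j + 1 / 2 - ((j - 1) / 2 : ℕ)) = y
    rw [show μ + 1 + j + 1 = μ + j + 2 by ring,
      show μ + 1 + 3 * j + 1 / 2 = μ + 3 * j + 3 / 2 by ring,
      show μ + 1 + 2 * j + 3 / 2 = μ + 2 * j + 5 / 2 by ring,
      show μ + 1 + 2 * j + 1 / 2 = μ + 2 * j + 3 / 2 by ring]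
    ring
  rw [e1, e2, key, Gamma_succ' (z := j) (w := j + 1) (by positivity) rfl,
    Gamma_succ' (z := 2 * j + 1) (w := 2 * j + 2) (by positivity) (by ring),
    Gamma_succ' (z := 2 * j) (w := 2 * j + 1) (by positivity) (by ring),
    Gamma_succ' (z := μ + 3 * j + 5 / 2) (w := μ + 3 * j + 7 / 2) (by positivity) (by ring),
    Gamma_succ' (z := μ + 3 * j + 3 / 2) (w := μ + 3 * j + 5 / 2) (by positivity) (by ring),
    Gamma_succ' (z := μ + 2 * j + 5 / 2) (w := μ + 2 * j + 7 / 2) (by positivity) (by ring),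
    Gamma_succ' (z := μ + 2 * j + 3 / 2) (w := μ + 2 * j + 5 / 2) (by positivity) (by ring)]
  have p1 : Real.Gamma (μ + 2 * j + 3 / 2) ≠ 0 := (Real.Gamma_pos_of_pos (by positivity)).ne'
  have p2 : Real.Gamma (2 * j) ≠ 0 := (Real.Gamma_pos_of_pos (by positivity)).ne'
  have p3 : Real.Gamma (μ + j + 2) ≠ 0 := (Real.Gamma_pos_of_pos (by positivity)).ne'
  obtain ⟨l, rfl⟩ : ∃ l, j = l + 1 := ⟨j - 1, by omega⟩
  rw [Nat.add_sub_cancel, pow_succ]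
  generalize Real.Gamma (μ + 1 + (l + 1 : ℕ) + 1 + ((l + 1 + 1) / 2 : ℕ)) = x
  generalize Real.Gamma (μ + 1 + 2 * (l + 1 : ℕ) + 1 / 2 - (l / 2 : ℕ)) = y
  generalize hJ : ((l + 1 : ℕ) : ℝ) = J at *
  generalize Real.Gamma (μ + 2 * J + 3 / 2) = g1 at *
  generalize Real.Gamma (2 * J) = g2 at *
  generalize Real.Gamma (μ + J + 2) = g3 at *
  generalize Real.Gamma J = g4 at *
  generalize Real.Gamma (μ + 3 * J + 3 / 2) = g5 at *
  have q0 : J ≠ 0 := by positivity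
  have q1 : 2 * J + 1 ≠ 0 := by positivity
  have q2 : 2 * μ + 4 * J + 5 ≠ 0 := by positivity
  have q3 : μ + 2 * J + 3 / 2 ≠ 0 := by positivity
  have q5 : μ + 2 * J + 5 / 2 ≠ 0 := by positivity
  rw [show 2 * μ + 4 * J + 5 = 2 * (μ + 2 * J + 5 / 2) by ring]
  generalize hA : μ + 2 * J + 3 / 2 = A at *
  generalize hB : μ + 2 * J + 5 / 2 = B at *
  field_simp
  ring

lemma col_diag {j : ℕ} (hj : 1 ≤ j) (μ : ℝ) : col j j μ =
    (-4) ^ j * (Real.Gamma (2 * μ + 3 * j + 2))⁻¹ * Real.Gamma (μ + j + 1) *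
      Real.Gamma (μ + 2 * j + 1 / 2) := by
  have h : Real.Gamma (j : ℝ) ≠ 0 := (Real.Gamma_pos_of_pos (by exact_mod_cast hj)).ne'
  rw [col, show (2 * j - j : ℝ) = j by ring, show (j - j + 1 : ℝ) = 1 by ring,
    show 2 * μ + 2 * j + j + 2 = 2 * μ + 3 * j + 2 by ring,
    show μ + j + j + 1 / 2 = μ + 2 * j + 1 / 2 by ring, Real.Gamma_one]
  field_simp

lemma col_diag_ne_zero {j : ℕ} (hj : 1 ≤ j) {μ : ℝ} (hμ : 0 < μ) : col j j μ ≠ 0 := by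
  rw [col_diag hj]
  have p1 := Real.Gamma_pos_of_pos (s := 2 * μ + 3 * j + 2) (by positivity)
  have p2 := Real.Gamma_pos_of_pos (s := μ + j + 1) (by positivity)
  have p3 := Real.Gamma_pos_of_pos (s := μ + 2 * j + 1 / 2) (by positivity)
  have p4 : ((-4 : ℝ) ^ j) ≠ 0 := by positivity
  positivity

lemma col_diag_succ {j : ℕ} (hj : 1 ≤ j) {μ : ℝ} (hμ : 0 < μ) :
    col j j (μ + 1) * (-4 * (μ + 2 * j + 3 / 2)) =
      (2 * μ + 3 * j + 4) * col (j + 1) (j + 1) μ := by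
  rw [col_diag hj, col_diag (by omega)]
  push_cast
  rw [show 2 * (μ + 1) + 3 * j + 2 = 2 * μ + 3 * j + 4 by ring,
    inv_Gamma' (z := 2 * μ + 3 * j + 4) (w := 2 * μ + 3 * (j + 1) + 2) (by ring),
    show μ + 1 + j + 1 = μ + (j + 1) + 1 by ring,
    Gamma_succ' (z := μ + 1 + 2 * j + 1 / 2) (w := μ + 2 * (j + 1) + 1 / 2) (by positivity) (by ring)]
  ring

lemma coeffB_diag (j μ : ℝ) : coeffB j j μ =
    2 * (μ + 3 * j + 2) * (2 * μ + 6 * j + 5) * (2 * μ + 6 * j + 3) := by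
  unfold coeffB
  ring

lemma rowDotCol_one {μ : ℝ} (hμ : 0 < μ) : rowDotCol 1 1 μ = (μ + 2) * col 1 1 μ := by
  have h : binom 1 1 μ = μ + 2 := by
    have p : Real.Gamma (μ + 2) ≠ 0 := (Real.Gamma_pos_of_pos (by positivity)).ne'
    simp only [binom, Nat.cast_one]
    rw [Gamma_succ' (z := μ + 2) (w := μ + 1 + 1 + 1) (by positivity) (by ring),
      show μ - 1 + 2 * 1 + 1 = μ + 2 by ring, show (2 * 1 - 1 + 1 : ℝ) = 2 by norm_num,
      Real.Gamma_two]
    field_simp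
  simp [rowDotCol, Finset.sum_range_succ, col_zero, h]

lemma detRatio_one {μ : ℝ} (hμ : 0 < μ) : detRatio 1 μ = μ + 2 := by
  have p1 : Real.Gamma (μ + 2) ≠ 0 := (Real.Gamma_pos_of_pos (by positivity)).ne'
  have p2 : Real.Gamma (μ + 7 / 2) ≠ 0 := (Real.Gamma_pos_of_pos (by positivity)).ne'
  have p3 : Real.Gamma (μ + 5 / 2) ≠ 0 := (Real.Gamma_pos_of_pos (by positivity)).ne'
  simp only [detRatio]
  norm_num
  rw [Gamma_succ' (z := μ + 2) (w := μ + 1 + 1 + 1) (by positivity) (by ring),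
    show μ + 3 + 1 / 2 = μ + 7 / 2 by ring, show μ + 2 + 3 / 2 = μ + 7 / 2 by ring,
    show μ + 1 + 1 = μ + 2 by ring, show μ + 2 + 1 / 2 = μ + 5 / 2 by ring]
  field_simp

lemma rowDotCol_diag {j : ℕ} (hj : 1 ≤ j) {μ : ℝ} (hμ0 : 0 < μ) (hμ : (j : ℝ) < μ + 1) :
    rowDotCol j j μ = detRatio j μ * col j j μ := by
  induction j, hj using Nat.le_induction generalizing μ with
  | base => rw [rowDotCol_one hμ0, detRatio_one hμ0]
  | succ j hj ih =>
    push_cast at hμ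
    have h := rowDotCol_diag_succ hj (μ := μ) (by linarith)
    rw [ih (by linarith) (by linarith), coeffB_diag] at h
    have h2 := col_diag_succ hj hμ0
    have hA := (coeffA_pos (le_refl j) hμ0).ne'
    refine mul_left_cancel₀ hA ?_
    rw [detRatio_succ hj hμ0]
    have h3 : col j j (μ + 1) =
        (2 * μ + 3 * j + 4) * col (j + 1) (j + 1) μ / (-4 * (μ + 2 * j + 3 / 2)) := by
      rw [← h2, mul_div_cancel_right₀]
      have : 0 < μ + 2 * j + 3 / 2 := by positivity
      intro h0
      linarith
    rw [h3] at h
    rw [eq_neg_of_add_eq_zero_left h, coeffA]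
    have q1 : (2 * j + 1 : ℝ) ≠ 0 := by positivity
    have q2 : 2 * μ + 4 * j + 5 ≠ 0 := by positivity
    have q3 : μ + 2 * j + 3 / 2 ≠ 0 := by positivity
    rw [show 2 * μ + 2 * j + 2 * j + 5 = 2 * μ + 4 * j + 5 by ring,
      show μ + 6 * j - 3 * j + 2 = μ + 3 * j + 2 by ring]
    generalize hX : μ + 2 * j + 3 / 2 = X at *
    generalize hY : 2 * μ + 4 * j + 5 = Y at *
    field_simp

lemma prod_range_sub_eq_Gamma {z : ℝ} (r : ℕ) (h : 0 < z - r + 1) :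
    ∏ m ∈ range r, (z - m) = Real.Gamma (z + 1) * (Real.Gamma (z - r + 1))⁻¹ := by
  induction r with
  | zero =>
    have : Real.Gamma (z + 1) ≠ 0 := (Real.Gamma_pos_of_pos (by simpa using h)).ne'
    simp [this]
  | succ r ih =>
    push_cast at h ⊢
    rw [prod_range_succ, ih (by linarith),
      inv_Gamma' (z := z - (r + 1) + 1) (w := z - r + 1) (by ring)]
    ring

lemma genBinom_eq_Gamma {z : ℝ} {r : ℤ} (h : 0 < z - r + 1) :
    genBinom ℝ z r = Real.Gamma (z + 1) * (Real.Gamma (r + 1))⁻¹ * (Real.Gamma (z - r + 1))⁻¹ := by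
  rw [genBinom]
  split_ifs with hr
  · lift r to ℕ using hr
    simp only [Int.toNat_natCast, Int.cast_natCast] at h ⊢
    rw [prod_range_sub_eq_Gamma r h, Real.Gamma_nat_eq_factorial]
    ring
  · have := inv_Gamma_int_eq_zero (z := r + 1) (by omega)
    push_cast at this
    rw [this]
    ring

lemma genBinom_eq_binom {i k : ℕ} {μ : ℝ} (hμ : (i : ℝ) < μ) :
    genBinom ℝ (μ + i + k) (2 * (i : ℤ) - k) = binom i k μ := by
  have hk : (0 : ℝ) ≤ k := Nat.cast_nonneg k
  rw [genBinom_eq_Gamma (by push_cast; linarith), binom]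
  push_cast
  rw [show μ + i + k - (2 * i - k) + 1 = μ - i + 2 * k + 1 by ring]

/-- The matrix of generalized binomial coefficients. -/
noncomputable def binomMatrix (F : Type*) [Field F] (n : ℕ) (μ : F) : Matrix (Fin n) (Fin n) F :=
  Matrix.of fun i j : Fin n =>
    genBinom F (μ + ((i : ℕ) : F) + ((j : ℕ) : F)) (2 * (((i : ℕ) : ℤ)) - ((j : ℕ) : ℤ))

/-- The upper triangular matrix with columns `col`, except for the column `0`. -/
noncomputable def colMatrix (n : ℕ) (μ : ℝ) : Matrix (Fin n) (Fin n) ℝ :=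
  Matrix.of fun k j : Fin n =>
    if (j : ℕ) = 0 then (if (k : ℕ) = 0 then 1 else 0) else col j k μ

lemma binomMatrix_mul_colMatrix {n : ℕ} {μ : ℝ} (hμ : (n : ℝ) < μ) (i j : Fin n)
    (hj : (j : ℕ) ≠ 0) : (binomMatrix ℝ n μ * colMatrix n μ) i j = rowDotCol i j μ := by
  have hi : ((i : ℕ) : ℝ) < μ := lt_trans (by exact_mod_cast i.2) hμ
  rw [Matrix.mul_apply, rowDotCol]
  simp only [binomMatrix, colMatrix, Matrix.of_apply, if_neg hj, genBinom_eq_binom hi]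
  rw [Fin.sum_univ_eq_sum_range (fun k => binom i k μ * col j k μ)]
  refine (Finset.sum_subset (by simp) fun k _ hk => ?_).symm
  rw [col_of_lt (by simpa using hk), mul_zero]

lemma binomMatrix_mul_colMatrix_zero (n : ℕ) (μ : ℝ) :
    (binomMatrix ℝ (n + 1) μ * colMatrix (n + 1) μ) 0 0 = 1 := by
  rw [Matrix.mul_apply, Fin.sum_univ_succ]
  simp [binomMatrix, colMatrix, genBinom]

lemma det_binomMatrix_real {n : ℕ} {μ : ℝ} (hμ : ((n + 1 : ℕ) : ℝ) < μ) :
    (binomMatrix ℝ (n + 1) μ).det = ∏ j ∈ range n, detRatio (j + 1) μ := by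
  have hμ0 : 0 < μ := lt_of_le_of_lt (Nat.cast_nonneg _) hμ
  have hU : (colMatrix (n + 1) μ).det = ∏ j ∈ range n, col (j + 1) (j + 1) μ := by
    rw [Matrix.det_of_isUpperTriangular, Fin.prod_univ_succ,
      ← Fin.prod_univ_eq_prod_range (fun j => col (j + 1) (j + 1) μ)]
    · simp [colMatrix]
    · intro k j hkj
      have h : (j : ℕ) < k := hkj
      simp only [colMatrix, Matrix.of_apply, if_neg (by omega : ¬ (k : ℕ) = 0), col_of_lt h, ite_self]
  have hL : (binomMatrix ℝ (n + 1) μ * colMatrix (n + 1) μ).det =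
      ∏ j ∈ range n, (detRatio (j + 1) μ * col (j + 1) (j + 1) μ) := by
    rw [Matrix.det_of_isLowerTriangular, Fin.prod_univ_succ, binomMatrix_mul_colMatrix_zero, one_mul,
      ← Fin.prod_univ_eq_prod_range (fun j => detRatio (j + 1) μ * col (j + 1) (j + 1) μ)]
    · refine Finset.prod_congr rfl fun j _ => ?_
      have hj : ((j : ℕ) : ℝ) < n := by exact_mod_cast j.2
      rw [binomMatrix_mul_colMatrix hμ _ _ (by simp), Fin.val_succ, rowDotCol_diag (by omega) hμ0]
      push_cast at hμ ⊢
      linarith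
    · intro i j hij
      have h : (i : ℕ) < j := hij
      rw [binomMatrix_mul_colMatrix hμ _ _ (by omega), rowDotCol_eq_zero h]
      exact lt_trans (by exact_mod_cast i.2) hμ
  rw [Matrix.det_mul, hU, Finset.prod_mul_distrib] at hL
  refine mul_right_cancel₀ (Finset.prod_ne_zero_iff.2 fun j _ => ?_) hL
  exact col_diag_ne_zero (by omega) hμ0

lemma ascPochhammer_eval_eq_Gamma {x : ℝ} (hx : 0 < x) (k : ℕ) :
    (ascPochhammer ℝ k).eval x = Real.Gamma (x + k) / Real.Gamma x := by
  induction k with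
  | zero => simp [(Real.Gamma_pos_of_pos hx).ne']
  | succ k ih =>
    rw [ascPochhammer_succ_eval, ih,
      Gamma_succ' (z := x + k) (w := x + (k + 1 : ℕ)) (by positivity) (by push_cast; ring)]
    ring

lemma ascPochhammer_eval_neg_eq_Gamma {x y : ℝ} {k : ℕ} (hy : y = -x) (hx : 0 < x - k + 1) :
    (ascPochhammer ℝ k).eval y =
      (-1) ^ k * (Real.Gamma (x + 1) * (Real.Gamma (x - k + 1))⁻¹) := by
  have h : (ascPochhammer ℝ k).eval (-x) = (-1) ^ k * ∏ m ∈ range k, (x - m) := by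
    clear hx
    induction k with
    | zero => simp
    | succ k ih =>
      rw [ascPochhammer_succ_eval, ih, prod_range_succ]
      ring
  rw [hy, h, prod_range_sub_eq_Gamma k hx]

lemma prod_ascPochhammer_shift {R : Type*} [CommRing R] (m : ℕ) (y : R) :
    (∏ i ∈ Icc 1 (m + 1), (ascPochhammer R (i / 2)).eval (y + i)) *
        (ascPochhammer R (m / 2)).eval (y + m + 3) =
      (∏ i ∈ Icc 1 m, (ascPochhammer R (i / 2)).eval (y + 3 + i)) *
        (ascPochhammer R m).eval (y + 2) := by
  induction m with
  | zero => simp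
  | succ m ih =>
    have h : (ascPochhammer R (m / 2 + 1)).eval (y + m + 2) =
        (y + m + 2) * (ascPochhammer R (m / 2)).eval (y + m + 3) := by
      rw [ascPochhammer_succ_left, Polynomial.eval_mul, Polynomial.eval_X, Polynomial.eval_comp]
      simp only [Polynomial.eval_add, Polynomial.eval_X, Polynomial.eval_one]
      rw [show y + m + 2 + 1 = y + m + 3 by ring]
    rw [prod_Icc_succ_top (by omega : 1 ≤ m + 1 + 1), 
      prod_Icc_succ_top (by omega : 1 ≤ m + 1)
        (fun i : ℕ => (ascPochhammer R (i / 2)).eval (y + 3 + i)),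
      show (m + 1 + 1) / 2 = m / 2 + 1 by omega, ascPochhammer_succ_eval m]
    push_cast
    rw [show y + (m + 1 + 1 : R) = y + m + 2 by ring, h,
      show y + (m + 1 : R) + 3 = y + 3 + (m + 1) by ring]
    linear_combination (y + m + 2) * (ascPochhammer R ((m + 1) / 2)).eval (y + 3 + (m + 1)) * ih

/-- The product side of the determinant evaluation. -/
noncomputable def prodSide (F : Type*) [Field F] (n : ℕ) (μ : F) : F :=
  (if n % 4 = 3 then (-1 : F) else 1) * 2 ^ ((n - 1).choose 2) *
    ∏ i ∈ Icc 1 (n - 1),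
      ((ascPochhammer F ((i + 1) / 2)).eval (μ + (i : F) + 1) *
          (ascPochhammer F (i / 2)).eval (-μ - 3 * (n : F) + (i : F) + 3 / 2)) /
        (ascPochhammer F i).eval (i : F)

lemma sign_succ (m : ℕ) : (if (m + 1 + 1) % 4 = 3 then (-1 : ℝ) else 1) * (-1) ^ m =
    (if (m + 1) % 4 = 3 then (-1 : ℝ) else 1) * (-1) ^ (m / 2) := by
  obtain ⟨q, r, hr, rfl⟩ : ∃ q r, r < 4 ∧ m = 4 * q + r :=
    ⟨m / 4, m % 4, Nat.mod_lt _ (by norm_num), by omega⟩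
  have h : (4 * q + r) / 2 = 2 * q + r / 2 := by omega
  rw [h, pow_add, pow_add, pow_mul, pow_mul,
    show (4 * q + r + 1 + 1) % 4 = (r + 2) % 4 by omega,
    show (4 * q + r + 1) % 4 = (r + 1) % 4 by omega]
  interval_cases r <;> norm_num

lemma prodSide_succ_eq {F : Type*} [Field F] (m : ℕ) (μ : F) :
    prodSide F (m + 1) μ = (if (m + 1) % 4 = 3 then (-1 : F) else 1) * 2 ^ (m.choose 2) *
      ((∏ i ∈ Icc 1 m, (ascPochhammer F ((i + 1) / 2)).eval (μ + i + 1)) *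
        (∏ i ∈ Icc 1 m, (ascPochhammer F (i / 2)).eval (-μ - 3 * ((m : F) + 1) + 3 / 2 + i)) /
        ∏ i ∈ Icc 1 m, (ascPochhammer F i).eval (i : F)) := by
  rw [prodSide, ← prod_mul_distrib, ← prod_div_distrib, Nat.add_sub_cancel, Nat.cast_succ]
  simp only [add_right_comm _ _ (3 / 2 : F)]

lemma prodSide_succ (m : ℕ) {μ : ℝ} (hμ : 0 < μ) :
    prodSide ℝ (m + 1 + 1) μ = prodSide ℝ (m + 1) μ * detRatio (m + 1) μ := by
  have hm : ((m / 2 : ℕ) : ℝ) ≤ m := by exact_mod_cast Nat.div_le_self m 2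
  have hm0 : (0 : ℝ) ≤ m := Nat.cast_nonneg m
  have key := prod_ascPochhammer_shift m (-μ - 3 * ((m + 1 : ℕ) + 1 : ℝ) + 3 / 2)
  rw [ascPochhammer_eval_neg_eq_Gamma (x := μ + 2 * m + 3 / 2) (by push_cast; ring) (by linarith),
    ascPochhammer_eval_neg_eq_Gamma (x := μ + 3 * m + 5 / 2) (by push_cast; ring) (by linarith),
    show -μ - 3 * ((m + 1 : ℕ) + 1 : ℝ) + 3 / 2 + 3 = -μ - 3 * ((m : ℝ) + 1) + 3 / 2 by
      push_cast; ring] at key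
  have hs := sign_succ m
  have hs2 : ((-1 : ℝ) ^ (m / 2)) * (-1) ^ (m / 2) = 1 := by
    rw [← mul_pow]; norm_num
  have hD : detRatio (m + 1) μ = 2 ^ m * (Real.Gamma (μ + (m + 1 : ℕ) + 1 + ((m + 1 + 1) / 2 : ℕ)) /
      Real.Gamma (μ + (m + 1 : ℕ) + 1)) *
      (Real.Gamma (m + 1 : ℕ) / Real.Gamma ((m + 1 : ℕ) + (m + 1 : ℕ))) *
      (Real.Gamma (μ + 3 * m + 5 / 2 + 1) / Real.Gamma (μ + 3 * m + 5 / 2 - m + 1)) *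
      (Real.Gamma (μ + 2 * m + 3 / 2 - (m / 2 : ℕ) + 1) / Real.Gamma (μ + 2 * m + 3 / 2 + 1)) := by
    rw [detRatio, Nat.add_sub_cancel, mul_div_assoc,
      show μ + 3 * (m + 1 : ℕ) + 1 / 2 = μ + 3 * m + 5 / 2 + 1 by push_cast; ring,
      show μ + 2 * (m + 1 : ℕ) + 3 / 2 = μ + 3 * m + 5 / 2 - m + 1 by push_cast; ring,
      show μ + 2 * (m + 1 : ℕ) + 1 / 2 - (m / 2 : ℕ) = μ + 2 * m + 3 / 2 - (m / 2 : ℕ) + 1 by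
        push_cast; ring,
      show μ + 2 * (m + 1 : ℕ) + 1 / 2 = μ + 2 * m + 3 / 2 + 1 by push_cast; ring, two_mul]
  have p1 := (Real.Gamma_pos_of_pos (s := μ + 2 * m + 3 / 2 + 1) (by positivity)).ne'
  have p2 := (Real.Gamma_pos_of_pos (s := μ + 2 * m + 3 / 2 - (m / 2 : ℕ) + 1) (by linarith)).ne'
  have p3 := (Real.Gamma_pos_of_pos (s := (m + 1 : ℕ)) (by positivity)).ne'
  have p4 := (Real.Gamma_pos_of_pos (s := (m + 1 : ℕ) + (m + 1 : ℕ)) (by positivity)).ne'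
  rw [prodSide_succ_eq, prodSide_succ_eq, hD,
    prod_Icc_succ_top (by omega)
      (fun i : ℕ => (ascPochhammer ℝ ((i + 1) / 2)).eval (μ + i + 1)),
    prod_Icc_succ_top (by omega) (fun i : ℕ => (ascPochhammer ℝ i).eval (i : ℝ)),
    ascPochhammer_eval_eq_Gamma (x := μ + (m + 1 : ℕ) + 1) (by positivity),
    ascPochhammer_eval_eq_Gamma (x := (m + 1 : ℕ)) (by positivity),
    Nat.choose_succ_succ', Nat.choose_one_right, pow_add]
  generalize ∏ i ∈ Icc 1 (m + 1), (ascPochhammer ℝ (i / 2)).eval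
    (-μ - 3 * ((m + 1 : ℕ) + 1 : ℝ) + 3 / 2 + i) = G' at *
  generalize ∏ i ∈ Icc 1 m, (ascPochhammer ℝ (i / 2)).eval
    (-μ - 3 * ((m : ℝ) + 1) + 3 / 2 + i) = G at *
  generalize ∏ i ∈ Icc 1 m, (ascPochhammer ℝ ((i + 1) / 2)).eval (μ + i + 1) = P at *
  generalize ∏ i ∈ Icc 1 m, (ascPochhammer ℝ i).eval (i : ℝ) = Q at *
  generalize (if (m + 1 + 1) % 4 = 3 then (-1 : ℝ) else 1) = s' at *
  generalize (if (m + 1) % 4 = 3 then (-1 : ℝ) else 1) = s at *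
  generalize (-1 : ℝ) ^ (m / 2) = t at *
  generalize (-1 : ℝ) ^ m = u at *
  generalize Real.Gamma (μ + 2 * m + 3 / 2 + 1) = g1 at *
  generalize Real.Gamma (μ + 2 * m + 3 / 2 - (m / 2 : ℕ) + 1) = g2 at *
  generalize Real.Gamma (m + 1 : ℕ) = g3 at *
  generalize Real.Gamma ((m + 1 : ℕ) + (m + 1 : ℕ)) = g4 at *
  generalize Real.Gamma (μ + (m + 1 : ℕ) + 1 + ((m + 1 + 1) / 2 : ℕ)) /
    Real.Gamma (μ + (m + 1 : ℕ) + 1) = r at *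
  rw [← div_eq_mul_inv (Real.Gamma _) (Real.Gamma (μ + 3 * m + 5 / 2 - m + 1))] at key
  generalize Real.Gamma (μ + 3 * m + 5 / 2 + 1) / Real.Gamma (μ + 3 * m + 5 / 2 - m + 1) = v at *
  have hG : G' = G * u * t * v * (g2 / g1) := by
    calc G' = G' * (t * t) * (g1 * g2⁻¹) * (g2 / g1) := by rw [hs2]; field_simp
      _ = (G' * (t * (g1 * g2⁻¹))) * t * (g2 / g1) := by ring
      _ = _ := by rw [key]; ring
  rw [hG]
  calc _ = s' * u * t * (2 ^ m * 2 ^ m.choose 2 * P * r * G * v * (g2 / g1) / (Q * (g4 / g3))) := by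
        ring
    _ = s * (t * t) * (2 ^ m * 2 ^ m.choose 2 * P * r * G * v * (g2 / g1) / (Q * (g4 / g3))) := by
        rw [hs]; ring
    _ = _ := by rw [hs2, div_mul_eq_div_div _ Q, div_div_eq_mul_div]; ring

lemma prodSide_real (m : ℕ) {μ : ℝ} (hμ : 0 < μ) :
    prodSide ℝ (m + 1) μ = ∏ j ∈ range m, detRatio (j + 1) μ := by
  induction m with
  | zero => simp [prodSide]
  | succ m ih => rw [prodSide_succ m hμ, ih, prod_range_succ]

lemma det_binomMatrix_eq_prodSide_real {n : ℕ} {μ : ℝ} (hμ : (n : ℝ) < μ) :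
    (binomMatrix ℝ n μ).det = prodSide ℝ n μ := by
  cases n with
  | zero => simp [prodSide]
  | succ n =>
    rw [det_binomMatrix_real hμ, prodSide_real n (lt_of_le_of_lt (Nat.cast_nonneg _) hμ)]

section Transfer

open Polynomial

/-- The polynomial in `μ` whose values are `genBinom F (μ + a) r`. -/
noncomputable def genBinomPoly (a : ℕ) (r : ℤ) : ℚ[X] :=
  if 0 ≤ r then (∏ m ∈ range r.toNat, (X + (a : ℚ[X]) - (m : ℚ[X]))) *
    C ((r.toNat.factorial : ℚ)⁻¹) else 0

/-- The polynomial in `μ` whose values are `prodSide F n μ`. -/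
noncomputable def prodSidePoly (n : ℕ) : ℚ[X] :=
  (if n % 4 = 3 then (-1 : ℚ[X]) else 1) * 2 ^ ((n - 1).choose 2) *
    ∏ i ∈ Icc 1 (n - 1),
      ((ascPochhammer ℚ[X] ((i + 1) / 2)).eval (X + (i : ℚ[X]) + 1) *
          (ascPochhammer ℚ[X] (i / 2)).eval (-X - 3 * (n : ℚ[X]) + (i : ℚ[X]) + C (3 / 2))) *
        C (((ascPochhammer ℚ i).eval (i : ℚ))⁻¹)

lemma map_ascPochhammer_eval {R S : Type*} [CommRing R] [CommRing S] (f : R →+* S) (k : ℕ) (x : R) :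
    f ((ascPochhammer R k).eval x) = (ascPochhammer S k).eval (f x) := by
  rw [← ascPochhammer_map f, Polynomial.eval_map, Polynomial.eval₂_at_apply]

variable {F : Type*} [Field F] [CharZero F]

lemma aeval_genBinomPoly (a : ℕ) (r : ℤ) (μ : F) :
    aeval μ (genBinomPoly a r) = genBinom F (μ + a) r := by
  by_cases hr : 0 ≤ r <;> simp [genBinom, genBinomPoly, hr, div_eq_mul_inv]

lemma aeval_prodSidePoly (n : ℕ) (μ : F) : aeval μ (prodSidePoly n) = prodSide F n μ := by
  have h1 (k : ℕ) (p : ℚ[X]) : aeval μ ((ascPochhammer ℚ[X] k).eval p) =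
      (ascPochhammer F k).eval (aeval μ p) := map_ascPochhammer_eval (aeval μ).toRingHom k p
  have h2 (i : ℕ) : algebraMap ℚ F ((ascPochhammer ℚ i).eval (i : ℚ)) =
      (ascPochhammer F i).eval (i : F) := by
    rw [map_ascPochhammer_eval, map_natCast]
  have h3 : aeval μ (if n % 4 = 3 then (-1 : ℚ[X]) else 1) = if n % 4 = 3 then (-1 : F) else 1 := by
    split_ifs <;> simp
  simp only [prodSidePoly, prodSide, map_mul, map_prod, h1, aeval_C, map_inv₀, h2, h3, div_eq_mul_inv]
  simp [map_ofNat (aeval μ : ℚ[X] →ₐ[ℚ] F)]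

lemma aeval_det_genBinomPoly (n : ℕ) (μ : F) :
    aeval μ (Matrix.det (Matrix.of fun i j : Fin n => genBinomPoly (i + j) (2 * (i : ℕ) - (j : ℕ)))) =
      (binomMatrix F n μ).det := by
  rw [AlgHom.map_det]
  congr 1
  ext i j
  simp [aeval_genBinomPoly, binomMatrix, add_assoc]

lemma det_genBinomPoly (n : ℕ) :
    Matrix.det (Matrix.of fun i j : Fin n => genBinomPoly (i + j) (2 * (i : ℕ) - (j : ℕ))) =
      prodSidePoly n := by
  refine eq_of_infinite_eval_eq _ _ ((Set.infinite_range_of_injective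
    (f := fun m : ℕ => ((n + 1 + m : ℕ) : ℚ)) fun a b h => by simpa using h).mono ?_)
  rintro _ ⟨m, rfl⟩
  apply (algebraMap ℚ ℝ).injective
  rw [← aeval_algebraMap_apply_eq_algebraMap_eval, ← aeval_algebraMap_apply_eq_algebraMap_eval,
    aeval_det_genBinomPoly, aeval_prodSidePoly, map_natCast]
  exact det_binomMatrix_eq_prodSide_real (by exact_mod_cast (by omega : n < n + 1 + m))

lemma det_binomMatrix (n : ℕ) (μ : F) : (binomMatrix F n μ).det = prodSide F n μ := by
  rw [← aeval_det_genBinomPoly, det_genBinomPoly, aeval_prodSidePoly]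

end Transfer

end MillsRobbinsRumsey

/-- The Mills–Robbins–Rumsey determinant evaluation:
`det_{0≤i,j≤n−1}(C(μ+i+j, 2i−j))`, where `(a)_k` is the ascending Pochhammer symbol
(`ascPochhammer`), `χ(n ≡ 3 mod 4)` gives the sign, and `⌊·⌋` denotes the floor
(realized by natural division). -/
theorem stmt_12 (n : ℕ) (F : Type*) [Field F] [CharZero F] (μ : F) :
    Matrix.det (Matrix.of fun i j : Fin n =>
        genBinom F (μ + ((i : ℕ) : F) + ((j : ℕ) : F))
          (2 * (((i : ℕ) : ℤ)) - ((j : ℕ) : ℤ))) =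
      (if n % 4 = 3 then (-1 : F) else 1) * 2 ^ ((n - 1).choose 2) *
        ∏ i ∈ Icc 1 (n - 1),
          ((ascPochhammer F ((i + 1) / 2)).eval (μ + (i : F) + 1) *
              (ascPochhammer F (i / 2)).eval (-μ - 3 * (n : F) + (i : F) + 3 / 2)) /
            (ascPochhammer F i).eval (i : F) := by
  exact MillsRobbinsRumsey.det_binomMatrix n μ
end

section
/- Let n be a nonnegative integer and μ an element of a field of characteristic zero containing the rationals (e.g. μ real). Then det_{0≤i,j≤n−1}( C(μ+i+j, 2i−j) + 2·C(μ+i+j+2, 2i−j+1) ) = 2^n · ∏_{i=1}^{n} ( (μ+i)_{⌊i/2⌋} · (μ+3n−⌊(3i−1)/2⌋+1/2)_{⌊(i+1)/2⌋} / (2i−1)!! ), where (2i−1)!! = 1·3·5···(2i−1) is the double factorial. -/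
open Finset

section

variable {F : Type*} [Field F]

theorem genBinom_of_neg (a : F) {k : ℤ} (hk : k < 0) : genBinom F a k = 0 := by
  rw [genBinom, if_neg (not_le.2 hk)]

theorem genBinom_natCast (a : F) (p : ℕ) :
    genBinom F a p = (∏ m ∈ range p, (a - m)) / p.factorial := by
  simp [genBinom]

/-- The entries of the row-reduced matrix. -/
noncomputable def rowEntry (μ : F) (i k : ℕ) : F :=
  2 * genBinom F (μ + i + k + 1 / 2) (2 * i + 1 - k) +
    4 * genBinom F (μ + i + k + 1 / 2) (2 * i - k)

/-- The ratio of consecutive entries in a column of the triangularizing matrix. -/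
noncomputable def colRatio (l : F) (m k : ℕ) : F :=
  -((m - k) * (l + 2 * k + 2) * (l + 3 * k + 5) * (l + 2 * m + 2 * k + 3)) /
    ((k + 1) * (2 * m - k) * (l + 3 * k + 2) * (l + 2 * m + k + 3))

/-- The entries of the triangularizing matrix. -/
noncomputable def colEntry (l : F) (m k : ℕ) : F := ∏ q ∈ range k, colRatio l m q

theorem colEntry_succ (l : F) (m k : ℕ) :
    colEntry l m (k + 1) = colEntry l m k * colRatio l m k := prod_range_succ _ _

theorem colEntry_eq_zero (l : F) {m k : ℕ} (h : m < k) : colEntry l m k = 0 :=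
  prod_eq_zero (mem_range.2 h) (by simp [colRatio])

/-- The quotient of successive sums `∑ k, rowEntry μ i k * colEntry (2 * μ) m k`. -/
noncomputable def sumRatio (l : F) (i m : ℕ) : F :=
  -(2 * (i - m) * (l + 2 * m + 4) * (l + 2 * i + 4 * m + 5) * (l + 2 * i + 4 * m + 7)) /
    ((2 * m + 1) * (l + 2 * i + 2 * m + 5) * (l - 2 * i + 4 * m + 3) * (l - 2 * i + 4 * m + 5))

/-- The rational certificate of the telescoping. -/
noncomputable def certificate (l : F) (i m k : ℕ) : F :=
  (2 * i + 1 - k) * (l + 2 * m + 4) * (l + 2 * i + 2 * k + 5) * (l + 4 * m + 5) *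
    (l + 2 * k + 2) * (l + 2 * m + 2 * k + 3) * (l + 2 * i + 2 * k + 3) /
    ((2 * m + 1) * (l - 2 * i + 4 * m + 3) * (l - 2 * i + 4 * m + 5) * (l + 2 * m + k + 4) *
      (l + 2 * i + 2 * m + 5) * (l + 3 * k + 2) * (l + 2 * m + k + 3))

theorem prod_range_two_mul {M : Type*} [CommMonoid M] (f : ℕ → M) (n : ℕ) :
    ∏ j ∈ range (2 * n), f j = (∏ m ∈ range n, f (2 * m)) * ∏ m ∈ range n, f (2 * m + 1) := by
  induction n with
  | zero => simp
  | succ n ih =>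
    rw [mul_add, mul_one, prod_range_succ, prod_range_succ, ih, prod_range_succ, prod_range_succ]
    simp only [mul_left_comm, mul_assoc, mul_comm]

theorem factorial_two_mul_cast (n : ℕ) :
    ((2 * n).factorial : F) = 2 ^ n * n.factorial * ∏ m ∈ range n, (2 * m + 1 : F) := by
  induction n with
  | zero => simp
  | succ n ih =>
    rw [mul_add, mul_one, Nat.factorial_succ, Nat.factorial_succ, Nat.factorial_succ,
      prod_range_succ]
    push_cast
    rw [ih]
    ring

theorem prod_range_sub_cast (n : ℕ) : (∏ m ∈ range n, (n - m : F)) = n.factorial := by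
  rw [← prod_range_reflect, ← prod_range_add_one_eq_factorial]
  push_cast
  refine prod_congr rfl fun j hj => ?_
  have : j + 1 ≤ n := mem_range.1 hj
  rw [Nat.sub_sub, add_comm 1 j, Nat.cast_sub this]
  push_cast
  ring

theorem ascPochhammer_eval_eq_prod (a : F) (k : ℕ) :
    (ascPochhammer F k).eval a = ∏ j ∈ range k, (a + j) := by
  induction k with
  | zero => simp
  | succ k ih => rw [ascPochhammer_succ_eval, ih, prod_range_succ]

/-- The second Pochhammer factor of the product, with the index shifted to start at `0`. -/
noncomputable def factorB (μ : F) (n j : ℕ) : F :=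
  (ascPochhammer F ((j + 2) / 2)).eval (μ + 3 * n - ((3 * j + 2) / 2 : ℕ) + 1 / 2)

theorem prod_const_mul_add (a : F) (n : ℕ) :
    ∏ k ∈ range n, (2 * a + 2 * k) = 2 ^ n * ∏ k ∈ range n, (a + k) := by
  simp_rw [← mul_add, prod_mul_distrib, prod_const, card_range]

/-- The product side of the determinant evaluation. -/
noncomputable def productSide (n : ℕ) (μ : F) : F :=
  2 ^ n * (∏ j ∈ range n, (ascPochhammer F ((j + 1) / 2)).eval (μ + j + 1)) *
    (∏ j ∈ range n, factorB μ n j) / ∏ j ∈ range n, ∏ m ∈ range (j + 1), (2 * m + 1 : F)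

theorem prod_Icc_eq_productSide (n : ℕ) (μ : F) :
    2 ^ n *
        ∏ i ∈ Icc 1 n,
          ((ascPochhammer F (i / 2)).eval (μ + (i : F)) *
              (ascPochhammer F ((i + 1) / 2)).eval
                (μ + 3 * (n : F) - (((3 * i - 1) / 2 : ℕ) : F) + 1 / 2)) /
            ((2 * i - 1).doubleFactorial : F) = productSide n μ := by
  have hI : Icc 1 n = Ico 1 (n + 1) := by ext; simp
  rw [hI, prod_Ico_eq_prod_range, productSide, mul_assoc, mul_div_assoc, ← prod_mul_distrib,
    ← prod_div_distrib, Nat.add_sub_cancel]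
  congr 1
  refine prod_congr rfl fun j _ => ?_
  have h1 : 2 * (1 + j) - 1 = 2 * j + 1 := by omega
  have h2 : 3 * (1 + j) - 1 = 3 * j + 2 := by omega
  have h3 : 1 + j + 1 = j + 2 := by omega
  have h4 : μ + ((1 + j : ℕ) : F) = μ + j + 1 := by push_cast; ring
  have h5 : ((2 * j + 1).doubleFactorial : F) = ∏ m ∈ range (j + 1), (2 * m + 1 : F) := by
    rw [Nat.doubleFactorial_eq_prod_odd, prod_range_succ']
    push_cast
    simp
  rw [h1, h2, h3, h4, h5, factorB, add_comm 1 j]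

theorem exists_polynomial_genBinom (c : F) (k : ℤ) :
    ∃ p : Polynomial F, ∀ μ : F, genBinom F (μ + c) k = p.eval μ := by
  refine ⟨if 0 ≤ k then (∏ m ∈ range k.toNat, (Polynomial.X + Polynomial.C (c - m))) *
    Polynomial.C ((k.toNat.factorial : F)⁻¹) else 0, fun μ => ?_⟩
  unfold genBinom
  split_ifs
  · simp only [Polynomial.eval_mul, Polynomial.eval_prod, Polynomial.eval_add,
      Polynomial.eval_X, Polynomial.eval_C, div_eq_mul_inv, add_sub_assoc]
  · simp

theorem exists_polynomial_det (n : ℕ) : ∃ p : Polynomial F, ∀ μ : F,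
    Matrix.det (Matrix.of fun i j : Fin n =>
        genBinom F (μ + ((i : ℕ) : F) + ((j : ℕ) : F))
            (2 * ((i : ℕ) : ℤ) - ((j : ℕ) : ℤ)) +
          2 * genBinom F (μ + ((i : ℕ) : F) + ((j : ℕ) : F) + 2)
            (2 * ((i : ℕ) : ℤ) - ((j : ℕ) : ℤ) + 1)) = p.eval μ := by
  choose g hg using exists_polynomial_genBinom (F := F)
  refine ⟨Matrix.det (Matrix.of fun i j : Fin n =>
    g ((i : ℕ) + (j : ℕ)) (2 * ((i : ℕ) : ℤ) - ((j : ℕ) : ℤ)) +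
      2 * g ((i : ℕ) + (j : ℕ) + 2) (2 * ((i : ℕ) : ℤ) - ((j : ℕ) : ℤ) + 1)), fun μ => ?_⟩
  rw [← Polynomial.coe_evalRingHom, RingHom.map_det]
  congr 1
  ext i j
  simp [← hg, add_assoc]

theorem exists_polynomial_productSide (n : ℕ) :
    ∃ p : Polynomial F, ∀ μ : F, productSide n μ = p.eval μ := by
  refine ⟨2 ^ n * (∏ j ∈ range n, (ascPochhammer F ((j + 1) / 2)).comp
      (Polynomial.X + Polynomial.C (j + 1 : F))) *
    (∏ j ∈ range n, (ascPochhammer F ((j + 2) / 2)).comp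
      (Polynomial.X + Polynomial.C (3 * n - ((3 * j + 2) / 2 : ℕ) + 1 / 2 : F))) *
    Polynomial.C ((∏ j ∈ range n, ∏ m ∈ range (j + 1), (2 * m + 1 : F))⁻¹), fun μ => ?_⟩
  simp only [productSide, factorB, Polynomial.eval_mul, Polynomial.eval_prod, Polynomial.eval_comp,
    Polynomial.eval_add, Polynomial.eval_X, Polynomial.eval_C, Polynomial.eval_pow,
    Polynomial.eval_ofNat, div_eq_mul_inv, add_sub_assoc, add_assoc]

end

section

variable {F : Type*} [Field F] [CharZero F]

open PowerSeries in
theorem coeff_binomialSeries_eq_genBinom (a : F) (k : ℕ) :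
    coeff k (binomialSeries F a) = genBinom F a k := by
  rw [binomialSeries_coeff, Ring.choose_eq_smul, genBinom]
  have h : ((descPochhammer ℤ k).smeval a : F) = ∏ m ∈ range k, (a - (m : F)) := by
    rw [← descPochhammer_eval_eq_prod_range, ← descPochhammer_map (algebraMap ℤ F), Polynomial.eval_map,
      ← Polynomial.eval₂_smulOneHom_eq_smeval]
    congr 1
    exact Subsingleton.elim _ _
  simp [h, div_eq_inv_mul]

open PowerSeries in
theorem coeff_X_pow_mul_binomialSeries (a : F) (k p : ℕ) :
    coeff p (X ^ k * binomialSeries F a) = genBinom F a (p - k) := by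
  rw [coeff_X_pow_mul']
  split_ifs with h
  · rw [coeff_binomialSeries_eq_genBinom, Nat.cast_sub h]
  · rw [genBinom_of_neg]; omega

open PowerSeries in
theorem coeff_eq_entry (μ : F) (i k : ℕ) :
    coeff (2 * i + 1) (binomialSeries F (μ + i) * ((X * (1 + X)) ^ k * (1 + 2 * X) * (X + 2))) =
      genBinom F (μ + i + k) (2 * i - k) + 2 * genBinom F (μ + i + k + 2) (2 * i - k + 1) := by
  have h : binomialSeries F (μ + i) * ((X * (1 + X)) ^ k * (1 + 2 * X) * (X + 2)) =
      X ^ (k + 1) * binomialSeries F (μ + i + k) +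
        C (2 : F) * (X ^ k * binomialSeries F (μ + i + k + 2)) := by
    have h2 : (binomialSeries F (2 : F)) = (1 + X) ^ 2 := by
      simpa using binomialSeries_nat (R := F) (A := F) 2
    rw [binomialSeries_add (A := F) _ (2 : F), binomialSeries_add _ (k : F), binomialSeries_nat, h2]
    have : (C (2 : F) : PowerSeries F) = 2 := map_ofNat C 2
    rw [this, mul_pow]; ring
  rw [h, map_add, coeff_C_mul, coeff_X_pow_mul_binomialSeries, coeff_X_pow_mul_binomialSeries]
  push_cast
  congr 2
  · ring
  · congr 1; ring

open PowerSeries in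
theorem coeff_eq_entry' (μ : F) (i k : ℕ) :
    coeff (2 * i + 1) (binomialSeries F (μ + i) * ((X * (1 + X)) ^ k * (1 + 2 * X) *
        (2 * binomialSeries F (1 / 2 : F)))) =
      2 * genBinom F (μ + i + k + 1 / 2) (2 * i + 1 - k) +
        4 * genBinom F (μ + i + k + 1 / 2) (2 * i - k) := by
  have h : binomialSeries F (μ + i) * ((X * (1 + X)) ^ k * (1 + 2 * X) *
        (2 * binomialSeries F (1 / 2 : F))) =
      C (2 : F) * (X ^ k * binomialSeries F (μ + i + k + 1 / 2)) +
        C (4 : F) * (X ^ (k + 1) * binomialSeries F (μ + i + k + 1 / 2)) := by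
    rw [binomialSeries_add (A := F) _ (1 / 2 : F), binomialSeries_add _ (k : F), binomialSeries_nat]
    have : (C (2 : F) : PowerSeries F) = 2 := map_ofNat C 2
    have h4 : (C (4 : F) : PowerSeries F) = 4 := map_ofNat C 4
    rw [this, h4, mul_pow]; ring
  rw [h, map_add, coeff_C_mul, coeff_C_mul, coeff_X_pow_mul_binomialSeries,
    coeff_X_pow_mul_binomialSeries]
  push_cast
  congr 3
  ring

theorem exists_polynomial_sqrt (N : ℕ) : ∃ φ g : Polynomial F, φ.coeff 0 = 1 ∧
    φ ^ 2 * (4 + Polynomial.X) - 4 = Polynomial.X ^ (N + 1) * g := by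
  induction N with
  | zero => exact ⟨1, 1, by simp, by simp⟩
  | succ N ih =>
    obtain ⟨φ, g, h0, h⟩ := ih
    set c : F := - g.coeff 0 / 8 with hc
    obtain ⟨g', hg'⟩ : Polynomial.X ∣ g + 2 * Polynomial.C c * φ * (4 + Polynomial.X) +
        Polynomial.C c ^ 2 * Polynomial.X ^ (N + 1) * (4 + Polynomial.X) := by
      rw [Polynomial.X_dvd_iff]
      simp only [Polynomial.coeff_zero_eq_eval_zero] at *
      simp [h0, hc]
      ring
    refine ⟨φ + Polynomial.C c * Polynomial.X ^ (N + 1), g', by simp [h0], ?_⟩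
    linear_combination h + Polynomial.X ^ (N + 1) * hg'

open PowerSeries in
theorem coeff_mul_aeval (μ : F) (i : ℕ) (W : PowerSeries F) (φ : Polynomial F) :
    coeff (2 * i + 1) (binomialSeries F (μ + i) * (W *
      Polynomial.aeval (X ^ 2 * binomialSeries F (-1 : F)) φ)) =
    ∑ l ∈ range (i + 1), φ.coeff (i - l) * coeff (2 * l + 1) (binomialSeries F (μ + l) * W) := by
  induction φ using Polynomial.induction_on' with
  | add p q hp hq =>
    simp only [map_add, mul_add, hp, hq, Polynomial.coeff_add, add_mul, sum_add_distrib]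
  | monomial n c =>
    have hpow : ∀ (a : F) (n : ℕ), binomialSeries F (a + n) * binomialSeries F (-1 : F) ^ n =
        binomialSeries F a := by
      intro a n
      induction n with
      | zero => simp
      | succ n ih =>
        rw [pow_succ, Nat.cast_succ, ← add_assoc, binomialSeries_add (A := F) (a + n)]
        have : binomialSeries F (1 : F) * binomialSeries F (-1 : F) = 1 := by
          rw [← binomialSeries_add]; simp
        linear_combination ih + binomialSeries F (a + n) * binomialSeries F (-1 : F) ^ n * this
    rw [Polynomial.aeval_monomial]
    have hl : binomialSeries F (μ + i) * (W * ((algebraMap F (PowerSeries F)) c *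
        (X ^ 2 * binomialSeries F (-1 : F)) ^ n)) =
        X ^ (2 * n) * (C c * (binomialSeries F (μ + i) * binomialSeries F (-1 : F) ^ n * W)) := by
      rw [PowerSeries.algebraMap_apply]
      simp only [Algebra.algebraMap_self, RingHom.id_apply]
      ring
    rw [hl, coeff_X_pow_mul']
    by_cases hn : n ≤ i
    · rw [if_pos (by omega), sum_eq_single_of_mem (i - n) (by simp)]
      · have e1 : i - (i - n) = n := by omega
        have e2 : 2 * i + 1 - 2 * n = 2 * (i - n) + 1 := by omega
        have e3 : μ + (i : F) = μ + ((i - n : ℕ) : F) + n := by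
          rw [Nat.cast_sub hn]; ring
        rw [e1, e2, coeff_C_mul, Polynomial.coeff_monomial, if_pos rfl, e3, hpow]
      · intro l hl hne
        rw [Polynomial.coeff_monomial, if_neg, zero_mul]
        simp at hl; omega
    · rw [if_neg (by omega)]
      symm
      apply sum_eq_zero
      intro l hl
      rw [Polynomial.coeff_monomial, if_neg, zero_mul]
      omega

open PowerSeries in
theorem X_pow_dvd_aeval_sub (N : ℕ) (φ g : Polynomial F) (h0 : φ.coeff 0 = 1)
    (h : φ ^ 2 * (4 + Polynomial.X) - 4 = Polynomial.X ^ (N + 1) * g) :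
    X ^ (2 * N + 2) ∣ (X + 2) * Polynomial.aeval (X ^ 2 * binomialSeries F (-1 : F)) φ -
      2 * binomialSeries F (1 / 2 : F) := by
  set u := X ^ 2 * binomialSeries F (-1 : F) with hu
  set ψ := Polynomial.aeval u φ with hψ
  set b := binomialSeries F (1 / 2 : F) with hb
  have hb2 : b ^ 2 = 1 + X := by
    rw [hb, sq, ← binomialSeries_add]
    have := binomialSeries_nat (R := F) (A := F) 1
    norm_num at this ⊢
    exact this
  have hu2 : binomialSeries F (-1 : F) * (1 + X) = 1 := by
    have h1 := binomialSeries_nat (R := F) (A := F) 1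
    rw [pow_one] at h1
    rw [← h1, ← binomialSeries_add]; simp
  have h' := congrArg (Polynomial.aeval u) h
  simp only [map_sub, map_mul, map_pow, map_add, Polynomial.aeval_X, map_ofNat, ← hψ] at h'
  have key : ((X + 2) * ψ - 2 * b) * ((X + 2) * ψ + 2 * b) =
      X ^ (2 * N + 2) * (binomialSeries F (-1 : F) ^ (N + 1) * (1 + X) * Polynomial.aeval u g) := by
    have : u ^ (N + 1) = X ^ (2 * N + 2) * binomialSeries F (-1 : F) ^ (N + 1) := by
      rw [hu]; ring
    rw [this] at h'
    linear_combination (1 + X) * h' - 4 * hb2 - ψ ^ 2 * X ^ 2 * hu2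
  have hunit : IsUnit ((X + 2) * ψ + 2 * b) := by
    rw [isUnit_iff_constantCoeff]
    have hc : constantCoeff ψ = 1 := by
      have : Polynomial.X ∣ φ - 1 := by
        rw [Polynomial.X_dvd_iff]; simp [h0]
      obtain ⟨q, hq⟩ := this
      have hq' := congrArg (fun p => constantCoeff (Polynomial.aeval u p)) hq
      simp only [map_sub, map_mul, Polynomial.aeval_X, ← hψ, map_one] at hq'
      rw [hu] at hq'
      simp at hq'
      exact sub_eq_zero.1 hq'
    have h2 : constantCoeff (2 : PowerSeries F) = 2 := map_ofNat _ 2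
    simp only [map_add, map_mul, hc, hb, h2, constantCoeff_X, binomialSeries_constantCoeff]
    norm_num
  have := Dvd.intro _ key.symm
  exact (hunit.dvd_mul_right).1 this

theorem det_entry_eq_det_rowEntry (n : ℕ) (μ : F) :
    Matrix.det (Matrix.of fun i k : Fin n =>
      genBinom F (μ + ((i : ℕ) : F) + ((k : ℕ) : F)) (2 * ((i : ℕ) : ℤ) - ((k : ℕ) : ℤ)) +
        2 * genBinom F (μ + ((i : ℕ) : F) + ((k : ℕ) : F) + 2)
          (2 * ((i : ℕ) : ℤ) - ((k : ℕ) : ℤ) + 1)) =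
    Matrix.det (Matrix.of fun i k : Fin n => rowEntry μ i k) := by
  obtain ⟨φ, g, h0, hφ⟩ := exists_polynomial_sqrt (F := F) n
  obtain ⟨r, hr⟩ := X_pow_dvd_aeval_sub n φ g h0 hφ
  set T : Matrix (Fin n) (Fin n) F :=
    Matrix.of fun i l => if (l : ℕ) ≤ i then φ.coeff (i - l) else 0 with hT
  have hdet : T.det = 1 := by
    rw [Matrix.det_of_isLowerTriangular]
    · simp [hT, h0]
    · intro i j hij
      have : ¬ j ≤ i := not_le.2 hij
      simp [hT, this]
  have hmul : ∀ A B : Matrix (Fin n) (Fin n) F, T * A = B → A.det = B.det := by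
    intro A B h
    rw [← h, Matrix.det_mul, hdet, one_mul]
  apply hmul
  ext i k
  rw [Matrix.mul_apply]
  simp only [hT, Matrix.of_apply]
  rw [rowEntry, ← coeff_eq_entry']
  simp_rw [← coeff_eq_entry]
  set W : PowerSeries F := (PowerSeries.X * (1 + PowerSeries.X)) ^ (k : ℕ) *
    (1 + 2 * PowerSeries.X) with hW
  have e : PowerSeries.coeff (2 * (i : ℕ) + 1)
      (PowerSeries.binomialSeries F (μ + ((i : ℕ) : F)) *
        (W * (2 * PowerSeries.binomialSeries F (1 / 2 : F)))) =
      PowerSeries.coeff (2 * (i : ℕ) + 1)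
      (PowerSeries.binomialSeries F (μ + ((i : ℕ) : F)) * (W * (PowerSeries.X + 2) *
      Polynomial.aeval (PowerSeries.X ^ 2 * PowerSeries.binomialSeries F (-1 : F)) φ)) := by
    rw [← sub_eq_zero, ← map_sub]
    have : ∀ b c d : PowerSeries F, b * (W * (2 * c)) - b * (W * (PowerSeries.X + 2) * d) =
        - (b * W * ((PowerSeries.X + 2) * d - 2 * c)) := by intros; ring
    rw [this, hr, mul_left_comm, map_neg, PowerSeries.coeff_X_pow_mul', if_neg, neg_zero]
    have := i.2
    omega
  rw [e, coeff_mul_aeval, Fin.sum_univ_eq_sum_range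
    (fun l => (if l ≤ (i : ℕ) then φ.coeff (i - l) else 0) *
      PowerSeries.coeff (2 * l + 1) (PowerSeries.binomialSeries F (μ + (l : F)) *
        (W * (PowerSeries.X + 2)))) n]
  symm
  apply sum_subset_zero_on_sdiff
  · intro l hl
    have := i.2
    simp at hl ⊢; omega
  · intro l hl
    simp at hl
    rw [if_neg (by omega), zero_mul]
  · intro l hl
    simp at hl
    rw [if_pos (by omega)]

theorem rowEntry_eq (μ : F) (i k p : ℕ) (h : k + p = 2 * i) :
    rowEntry μ i k = (2 * μ + 6 * i + 5) *
      (∏ m ∈ range p, (μ + i + k + 1 / 2 - m)) / (p + 1).factorial := by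
  have h1 : (2 * i + 1 - k : ℤ) = (p + 1 : ℕ) := by omega
  have h2 : (2 * i - k : ℤ) = p := by omega
  have h3 : (p : F) = 2 * i - k := by
    rw [eq_sub_iff_add_eq, add_comm]; exact_mod_cast h
  have : (p.factorial : F) ≠ 0 := by exact_mod_cast p.factorial_ne_zero
  have hp : (p + 1 : F) ≠ 0 := by exact_mod_cast p.succ_ne_zero
  rw [rowEntry, h1, h2, genBinom_natCast, genBinom_natCast, prod_range_succ, Nat.factorial_succ]
  push_cast
  field_simp
  rw [h3]
  ring

theorem rowEntry_zero_right (μ : F) (i : ℕ) :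
    rowEntry μ i 0 = (2 * μ + 6 * i + 5) *
      (∏ m ∈ range (2 * i), (μ + i + 1 / 2 - m)) / (2 * i + 1).factorial := by
  simpa using rowEntry_eq μ i 0 (2 * i) (by simp)

theorem rowEntry_succ (μ : F) (i k : ℕ) :
    (2 * μ - 2 * i + 4 * k + 3) * (2 * μ - 2 * i + 4 * k + 5) * rowEntry μ i (k + 1) =
      2 * (2 * i + 1 - k) * (2 * μ + 2 * i + 2 * k + 3) * rowEntry μ i k := by
  rcases lt_trichotomy k (2 * i) with h | h | h
  · obtain ⟨p, hp⟩ : ∃ p, k + (p + 1) = 2 * i := ⟨2 * i - k - 1, by omega⟩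
    rw [rowEntry_eq μ i k (p + 1) hp, rowEntry_eq μ i (k + 1) p (by omega)]
    have h3 : (p : F) = 2 * i - k - 1 := by
      have : ((k + (p + 1) : ℕ) : F) = 2 * i := by exact_mod_cast congrArg (Nat.cast (R := F)) hp
      push_cast at this
      linear_combination this
    have hprod : (μ + i + k + 1 / 2 + 1 - p) * (μ + i + k + 1 / 2 - p) *
        ∏ m ∈ range p, (μ + i + (k + 1 : ℕ) + 1 / 2 - m) =
        (μ + i + k + 1 / 2 + 1) * ∏ m ∈ range (p + 1), (μ + i + k + 1 / 2 - m) := by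
      have e : (μ + i + k + 1 / 2 + 1 - p) * ∏ m ∈ range p, (μ + i + (k + 1 : ℕ) + 1 / 2 - m) =
          (μ + i + k + 1 / 2 + 1) * ∏ m ∈ range p, (μ + i + k + 1 / 2 - m) := by
        have := prod_range_succ (fun m : ℕ => μ + i + k + 1 / 2 + 1 - (m : F)) p
        rw [prod_range_succ'] at this
        push_cast at this ⊢
        have e1 : ∀ m : ℕ, μ + i + (k + 1) + 1 / 2 - (m : F) = μ + i + k + 1 / 2 + 1 - m := by
          intro m; ring
        have e2 : ∀ m : ℕ, μ + i + k + 1 / 2 + 1 - ((m : F) + 1) = μ + i + k + 1 / 2 - m := by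
          intro m; ring
        simp only [e1, e2] at this ⊢
        linear_combination -this
      rw [prod_range_succ]
      linear_combination (μ + i + k + 1 / 2 - p) * e
    have hp1 : ((p + 1).factorial : F) ≠ 0 := by exact_mod_cast (p + 1).factorial_ne_zero
    have hp : (p + 1 + 1 : F) ≠ 0 := by exact_mod_cast (p + 1).succ_ne_zero
    rw [Nat.factorial_succ (p + 1)]
    generalize ∏ m ∈ range p, (μ + i + (k + 1 : ℕ) + 1 / 2 - (m : F)) = P' at hprod ⊢
    generalize ∏ m ∈ range (p + 1), (μ + i + k + 1 / 2 - (m : F)) = P at hprod ⊢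
    push_cast
    field_simp
    rw [h3] at hprod ⊢
    linear_combination 4 * (2 * (i : F) - k + 1) * (2 * μ + 6 * i + 5) * hprod
  · subst h
    have h1 : rowEntry μ i (2 * i + 1) = 2 := by
      have h1 : (2 * i + 1 - (2 * i + 1 : ℕ) : ℤ) = (0 : ℕ) := by push_cast; ring
      rw [rowEntry, h1, genBinom_natCast, genBinom_of_neg]
      · simp
      · push_cast; omega
    rw [h1, rowEntry_eq μ i (2 * i) 0 rfl]
    push_cast
    simp
    ring
  · have h1 : rowEntry μ i (k + 1) = 0 := by
      rw [rowEntry, genBinom_of_neg _ (by push_cast; omega), genBinom_of_neg _ (by push_cast; omega)]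
      simp
    rw [h1]
    rcases Nat.lt_or_ge (2 * i + 1) k with h | h
    · have h1 : rowEntry μ i k = 0 := by
        rw [rowEntry, genBinom_of_neg _ (by omega), genBinom_of_neg _ (by omega)]
        simp
      rw [h1]; ring
    · have : k = 2 * i + 1 := by omega
      subst this
      push_cast; ring

theorem colEntry_succ_left (l : F) (hl : ∀ z : ℤ, l + z ≠ 0) (m k : ℕ) (h : k ≤ m) :
    colEntry l (m + 1) k = colEntry l m k * ((2 * m + 2 - k) * (2 * m + 1 - k) *
      (l + 2 * m + 2 * k + 3) * (l + 2 * m + 4) / (2 * (2 * m + 1) * (m + 1 - k) *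
      (l + 2 * m + k + 3) * (l + 2 * m + k + 4))) := by
  induction k with
  | zero =>
    have h1 : l + 2 * m + 3 ≠ 0 := by simpa [add_assoc] using hl (2 * m + 3)
    have h2 : l + 2 * m + 4 ≠ 0 := by simpa [add_assoc] using hl (2 * m + 4)
    have h3 : (2 * m + 1 : F) ≠ 0 := by exact_mod_cast (2 * m).succ_ne_zero
    have h4 : (m + 1 : F) ≠ 0 := by exact_mod_cast m.succ_ne_zero
    simp [colEntry]
    field_simp
  | succ k ih =>
    obtain ⟨d, rfl⟩ : ∃ d, m = k + 1 + d := ⟨m - (k + 1), by omega⟩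
    rw [colEntry_succ, ih (by omega), colEntry_succ]
    have h1 := hl (2 * (k + 1 + d) + k + 3)
    have h2 := hl (2 * (k + 1 + d) + k + 4)
    have h3 := hl (2 * (k + 1 + d) + k + 5)
    have h4 := hl (3 * k + 2)
    have h8 := hl (2 * (k + 1 + d) + 2 * k + 3)
    have h5 : (2 * (k + 1 + d) + 1 : F) ≠ 0 := by exact_mod_cast (2 * (k + 1 + d)).succ_ne_zero
    have h6 : (d + 1 : F) ≠ 0 := by exact_mod_cast d.succ_ne_zero
    have h7 : (d + 1 + 1 : F) ≠ 0 := by exact_mod_cast (d + 1).succ_ne_zero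
    have h9 : (k + 2 * d + 2 : F) ≠ 0 := by exact_mod_cast (k + 2 * d + 1).succ_ne_zero
    have h10 : (k + 2 * d + 3 : F) ≠ 0 := by exact_mod_cast (k + 2 * d + 2).succ_ne_zero
    have h11 : (k + 2 * d + 4 : F) ≠ 0 := by exact_mod_cast (k + 2 * d + 3).succ_ne_zero
    have h12 : (k + 1 : F) ≠ 0 := by exact_mod_cast k.succ_ne_zero
    push_cast at h1 h2 h3 h4 h8
    simp only [colRatio]
    push_cast
    rw [mul_right_comm, mul_assoc, mul_assoc (colEntry _ _ _)]
    congr 1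
    have e1 : ((k : F) + 1 + d - k) = d + 1 := by ring
    have e2 : ((k : F) + 1 + d + 1 - k) = d + 1 + 1 := by ring
    have e3 : ((k : F) + 1 + d + 1 - (k + 1)) = d + 1 := by ring
    have e4 : (2 * ((k : F) + 1 + d) - k) = k + 2 * d + 2 := by ring
    have e5 : (2 * ((k : F) + 1 + d + 1) - k) = k + 2 * d + 4 := by ring
    have e6 : (2 * ((k : F) + 1 + d) + 2 - k) = k + 2 * d + 4 := by ring
    have e7 : (2 * ((k : F) + 1 + d) + 1 - k) = k + 2 * d + 3 := by ring
    have e8 : (2 * ((k : F) + 1 + d) + 2 - (k + 1)) = k + 2 * d + 3 := by ring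
    have e9 : (2 * ((k : F) + 1 + d) + 1 - (k + 1)) = k + 2 * d + 2 := by ring
    have e10 : l + 2 * (↑k + 1 + ↑d + 1) + ↑k + 3 = l + (2 * (k + 1 + d) + k + 5) := by ring
    have e11 : l + 2 * (↑k + 1 + ↑d) + (↑k + 1) + 3 = l + (2 * (k + 1 + d) + k + 4) := by ring
    have e12 : l + 2 * (↑k + 1 + ↑d) + (↑k + 1) + 4 = l + (2 * (k + 1 + d) + k + 5) := by ring
    have e13 : l + 2 * (↑k + 1 + ↑d) + ↑k + 3 = l + (2 * (k + 1 + d) + k + 3) := by ring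
    have e14 : l + 2 * (↑k + 1 + ↑d) + ↑k + 4 = l + (2 * (k + 1 + d) + k + 4) := by ring
    have e15 : l + 3 * (k : F) + 2 = l + (3 * k + 2) := by ring
    rw [e1, e2, e3, e4, e5, e6, e7, e8, e9, e10, e11, e12, e13, e14, e15]
    clear ih h
    generalize l + (2 * ((k : F) + 1 + d) + k + 3) = x1 at *
    generalize l + (2 * ((k : F) + 1 + d) + k + 4) = x2 at *
    generalize l + (2 * ((k : F) + 1 + d) + k + 5) = x3 at *
    generalize l + (3 * (k : F) + 2) = x4 at *
    have e16 : l + 2 * ((k : F) + 1 + d + 1) + 2 * k + 3 =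
        l + 2 * (k + 1 + d) + 2 * (k + 1) + 3 := by ring
    rw [e16]
    rw [← add_assoc, ← add_assoc] at h8
    generalize l + 2 * ((k : F) + 1 + d) + 2 * (k + 1) + 3 = y1 at *
    generalize l + 2 * ((k : F) + 1 + d) + 2 * k + 3 = y2 at *
    generalize l + 2 * ((k : F) + 1 + d) + 4 = y3 at *
    generalize l + 3 * (k : F) + 5 = y4 at *
    generalize l + 2 * (k : F) + 2 = y5 at *
    generalize 2 * ((k : F) + 1 + d) + 1 = z1 at *
    generalize (d : F) + 1 + 1 = z2 at *
    generalize (d : F) + 1 = z3 at *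
    generalize (k : F) + 2 * d + 2 = z4 at *
    generalize (k : F) + 2 * d + 3 = z5 at *
    generalize (k : F) + 2 * d + 4 = z6 at *
    generalize (k : F) + 1 = z7 at *
    clear e1 e2 e3 e4 e5 e6 e7 e8 e9 e10 e11 e12 e13 e14 e15 e16 hl
    field_simp

set_option maxHeartbeats 1000000 in
theorem sum_range_telescope (μ : F) (hl : ∀ z : ℤ, 2 * μ + z ≠ 0) (i m k : ℕ) (hk : k ≤ m) :
    ∑ q ∈ range (k + 1), rowEntry μ i q *
      (colEntry (2 * μ) (m + 1) q - sumRatio (2 * μ) i m * colEntry (2 * μ) m q) =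
    certificate (2 * μ) i m k * (rowEntry μ i k * colEntry (2 * μ) m k) := by
  have hw := rowEntry_succ μ i
  generalize 2 * μ = l at *
  have a1 : (2 * m + 1 : F) ≠ 0 := by exact_mod_cast (2 * m).succ_ne_zero
  have a2 : l - 2 * i + 4 * m + 3 ≠ 0 := by
    convert hl (- 2 * i + 4 * m + 3) using 1; push_cast; ring
  have a3 : l - 2 * i + 4 * m + 5 ≠ 0 := by
    convert hl (- 2 * i + 4 * m + 5) using 1; push_cast; ring
  have a4 : l + 2 * i + 2 * m + 5 ≠ 0 := by
    convert hl (2 * i + 2 * m + 5) using 1; push_cast; ring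
  induction k with
  | zero =>
    have b1 : l + 2 * m + 3 ≠ 0 := by
      convert hl (2 * m + 3) using 1; push_cast; ring
    have b2 : l + 2 * m + 4 ≠ 0 := by
      convert hl (2 * m + 4) using 1; push_cast; ring
    have b3 : l + 2 ≠ 0 := by
      simpa using hl 2
    simp only [colEntry, sumRatio, certificate, zero_add, sum_range_one, range_zero, prod_empty,
      Nat.cast_zero, mul_zero, add_zero, sub_zero, mul_one]
    have e : l - 2 * i + 4 * m + 5 = l - 2 * i + 4 * m + 3 + 2 := by ring
    rw [e] at a3 ⊢
    generalize hA : l - 2 * i + 4 * m + 3 = A at *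
    field_simp
    subst hA
    ring
  | succ k ih =>
    rw [sum_range_succ, ih (by omega), colEntry_succ_left l hl m _ hk]
    obtain ⟨d, rfl⟩ : ∃ d, m = k + 1 + d := ⟨m - (k + 1), by omega⟩
    have b1 : l + 3 * k + 2 ≠ 0 := by
      convert hl (3 * k + 2) using 1; push_cast; ring
    have b2 : l + 3 * k + 5 ≠ 0 := by
      convert hl (3 * k + 5) using 1; push_cast; ring
    have b3 : l + 2 * (k + 1 + d) + k + 3 ≠ 0 := by
      convert hl (2 * (k + 1 + d) + k + 3) using 1; push_cast; ring
    have b4 : l + 2 * (k + 1 + d) + k + 4 ≠ 0 := by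
      convert hl (2 * (k + 1 + d) + k + 4) using 1; push_cast; ring
    have b5 : l + 2 * (k + 1 + d) + k + 5 ≠ 0 := by
      convert hl (2 * (k + 1 + d) + k + 5) using 1; push_cast; ring
    have b6 : l - 2 * i + 4 * k + 3 ≠ 0 := by
      convert hl (- 2 * i + 4 * k + 3) using 1; push_cast; ring
    have b7 : l - 2 * i + 4 * k + 5 ≠ 0 := by
      convert hl (- 2 * i + 4 * k + 5) using 1; push_cast; ring
    have c1 : (d + 1 : F) ≠ 0 := by exact_mod_cast d.succ_ne_zero
    have c2 : (k + 1 : F) ≠ 0 := by exact_mod_cast k.succ_ne_zero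
    have c3 : (k + 2 * d + 2 : F) ≠ 0 := by exact_mod_cast (k + 2 * d + 1).succ_ne_zero
    have hw' : rowEntry μ i (k + 1) = 2 * (2 * i + 1 - k) * (l + 2 * i + 2 * k + 3) *
        rowEntry μ i k / ((l - 2 * i + 4 * k + 3) * (l - 2 * i + 4 * k + 5)) := by
      rw [eq_div_iff (mul_ne_zero b6 b7), mul_comm, hw]
    have hG : certificate l i (k + 1 + d) k * (rowEntry μ i k * colEntry l (k + 1 + d) k) =
        -((k + 1) * (2 * ((k + 1 + d : ℕ) : F) - k) * (l - 2 * i + 4 * k + 3) *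
          (l - 2 * i + 4 * k + 5) * (l + 2 * (k + 1 + d : ℕ) + 4) * (l + 2 * i + 2 * k + 5) *
          (l + 4 * (k + 1 + d : ℕ) + 5)) / (2 * (2 * (k + 1 + d : ℕ) + 1) * (d + 1) *
          (l + 3 * k + 5) * (l - 2 * i + 4 * (k + 1 + d : ℕ) + 3) *
          (l - 2 * i + 4 * (k + 1 + d : ℕ) + 5) * (l + 2 * (k + 1 + d : ℕ) + k + 4) *
          (l + 2 * i + 2 * (k + 1 + d : ℕ) + 5)) *
        (rowEntry μ i (k + 1) * colEntry l (k + 1 + d) (k + 1)) := by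
      rw [hw', colEntry_succ]
      generalize rowEntry μ i k = W
      generalize colEntry l (k + 1 + d) k = V
      simp only [certificate, colRatio]
      push_cast at *
      have e1 : ((k : F) + 1 + d - k) = d + 1 := by ring
      have e4 : (2 * ((k : F) + 1 + d) - k) = k + 2 * d + 2 := by ring
      rw [e1, e4]
      generalize l - 2 * i + 4 * ((k : F) + 1 + d) + 3 = x1 at *
      generalize l - 2 * i + 4 * ((k : F) + 1 + d) + 5 = x2 at *
      generalize l + 2 * ((k : F) + 1 + d) + k + 4 = x3 at *
      generalize l + 2 * i + 2 * ((k : F) + 1 + d) + 5 = x4 at *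
      generalize l + 2 * ((k : F) + 1 + d) + k + 3 = x5 at *
      generalize l + 2 * ((k : F) + 1 + d) + 2 * k + 3 = x6 at *
      generalize l + 2 * ((k : F) + 1 + d) + 4 = x7 at *
      generalize l + 4 * ((k : F) + 1 + d) + 5 = x8 at *
      generalize 2 * ((k : F) + 1 + d) + 1 = x9 at *
      generalize l + 3 * (k : F) + 2 = y1 at *
      generalize l + 3 * (k : F) + 5 = y2 at *
      generalize l - 2 * i + 4 * (k : F) + 3 = y3 at *
      generalize l - 2 * i + 4 * (k : F) + 5 = y4 at *
      generalize l + 2 * i + 2 * (k : F) + 3 = y5 at *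
      generalize l + 2 * i + 2 * (k : F) + 5 = y6 at *
      generalize l + 2 * (k : F) + 2 = y7 at *
      generalize (d : F) + 1 = z1 at *
      generalize (k : F) + 1 = z2 at *
      generalize (k : F) + 2 * d + 2 = z3 at *
      generalize 2 * (i : F) + 1 - k = z4 at *
      clear e1 e4 hw' ih hl hw
      field_simp
    rw [hG]
    generalize rowEntry μ i (k + 1) = W
    generalize colEntry l (k + 1 + d) (k + 1) = V
    simp only [certificate, sumRatio]
    push_cast at *
    have e1 : ((k : F) + 1 + d + 1 - (k + 1)) = d + 1 := by ring
    have e2 : l + 3 * (↑k + 1) + 2 = l + 3 * k + 5 := by ring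
    have e3 : l + 2 * (↑k + 1 + ↑d) + (↑k + 1) + 3 = l + 2 * (k + 1 + d) + k + 4 := by ring
    have e4 : l + 2 * (↑k + 1 + ↑d) + (↑k + 1) + 4 = l + 2 * (k + 1 + d) + k + 5 := by ring
    rw [e1, e2, e3, e4]
    have H : -((k + 1) * (k + 2 * d + 2) * (l - 2 * i + 4 * k + 3) *
        (l - 2 * i + 4 * k + 5) * (l + 2 * i + 2 * k + 5) * (l + 4 * ((k : F) + 1 + d) + 5)) *
        (l + 2 * (k + 1 + d) + k + 5) +
        (k + 2 * d + 3) * (k + 2 * d + 2) * (l + 2 * (k + 1 + d) + 2 * (k + 1) + 3) *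
        (l + 3 * k + 5) * (l - 2 * i + 4 * (k + 1 + d) + 3) * (l - 2 * i + 4 * (k + 1 + d) + 5) *
        (l + 2 * i + 2 * (k + 1 + d) + 5) +
        2 * (i - (k + 1 + d)) * (l + 2 * i + 4 * (k + 1 + d) + 5) *
        (l + 2 * i + 4 * (k + 1 + d) + 7) * 2 * (d + 1) * (l + 3 * k + 5) *
        (l + 2 * (k + 1 + d) + k + 4) * (l + 2 * (k + 1 + d) + k + 5) =
        (2 * i - k) * (l + 2 * i + 2 * k + 7) * (l + 4 * (k + 1 + d) + 5) *
        (l + 2 * k + 4) * (l + 2 * (k + 1 + d) + 2 * k + 5) * (l + 2 * i + 2 * k + 5) *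
        2 * (d + 1) := by ring
    clear hG hw' ih hw hl
    generalize l - 2 * i + 4 * ((k : F) + 1 + d) + 3 = x1 at *
    generalize l - 2 * i + 4 * ((k : F) + 1 + d) + 5 = x2 at *
    generalize l + 2 * ((k : F) + 1 + d) + k + 4 = x3 at *
    generalize l + 2 * ((k : F) + 1 + d) + k + 5 = x4 at *
    generalize l + 2 * i + 2 * ((k : F) + 1 + d) + 5 = x5 at *
    generalize l + 2 * ((k : F) + 1 + d) + 4 = y1 at *
    generalize l + 3 * (k : F) + 5 = y2 at *
    generalize hz : 2 * ((k : F) + 1 + d) + 1 = z1 at *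
    generalize (d : F) + 1 = z2 at *
    field_simp
    subst hz
    linear_combination y1 * W * V * H

theorem rowEntry_mul_colEntry_self (μ : F) (hl : ∀ z : ℤ, 2 * μ + z ≠ 0) (i m : ℕ) :
    rowEntry μ i (m + 1) * colEntry (2 * μ) (m + 1) (m + 1) =
      -(certificate (2 * μ) i m m * (rowEntry μ i m * colEntry (2 * μ) m m)) := by
  have hw := rowEntry_succ μ i m
  rw [colEntry_succ, colEntry_succ_left _ hl m m le_rfl]
  generalize 2 * μ = l at *
  have a1 : (2 * m + 1 : F) ≠ 0 := by exact_mod_cast (2 * m).succ_ne_zero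
  have a2 : l - 2 * i + 4 * m + 3 ≠ 0 := by
    convert hl (- 2 * i + 4 * m + 3) using 1; push_cast; ring
  have a3 : l - 2 * i + 4 * m + 5 ≠ 0 := by
    convert hl (- 2 * i + 4 * m + 5) using 1; push_cast; ring
  have a4 : l + 2 * i + 2 * m + 5 ≠ 0 := by
    convert hl (2 * i + 2 * m + 5) using 1; push_cast; ring
  have b1 : l + 3 * m + 2 ≠ 0 := by
    convert hl (3 * m + 2) using 1; push_cast; ring
  have b2 : l + 3 * m + 3 ≠ 0 := by
    convert hl (3 * m + 3) using 1; push_cast; ring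
  have b3 : l + 3 * m + 4 ≠ 0 := by
    convert hl (3 * m + 4) using 1; push_cast; ring
  have b4 : l + 3 * m + 5 ≠ 0 := by
    convert hl (3 * m + 5) using 1; push_cast; ring
  have c1 : (m + 1 : F) ≠ 0 := by exact_mod_cast m.succ_ne_zero
  have c2 : (m + 2 : F) ≠ 0 := by exact_mod_cast (m + 1).succ_ne_zero
  have hw' : rowEntry μ i (m + 1) = 2 * (2 * i + 1 - m) * (l + 2 * i + 2 * m + 3) *
      rowEntry μ i m / ((l - 2 * i + 4 * m + 3) * (l - 2 * i + 4 * m + 5)) := by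
    rw [eq_div_iff (mul_ne_zero a2 a3), mul_comm, hw]
  rw [hw']
  generalize rowEntry μ i m = W
  generalize colEntry l m m = V
  simp only [certificate, colRatio]
  push_cast
  have e1 : l + 2 * (m : F) + m + 3 = l + 3 * m + 3 := by ring
  have e2 : l + 2 * (m : F) + m + 4 = l + 3 * m + 4 := by ring
  have e3 : l + 2 * ((m : F) + 1) + m + 3 = l + 3 * m + 5 := by ring
  have e4 : 2 * (m : F) + 2 - m = m + 2 := by ring
  have e5 : 2 * ((m : F) + 1) - m = m + 2 := by ring
  have e6 : 2 * (m : F) + 1 - m = m + 1 := by ring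
  have e7 : (m : F) + 1 - m = 1 := by ring
  have e8 : l + 2 * ((m : F) + 1) + 2 * m + 3 = l + 4 * m + 5 := by ring
  rw [e1, e2, e3, e4, e5, e6, e7, e8]
  clear e1 e2 e3 e4 e5 e6 e7 e8 hw hw' hl
  generalize l - 2 * i + 4 * (m : F) + 3 = x1 at *
  generalize l - 2 * i + 4 * (m : F) + 5 = x2 at *
  generalize l + 2 * i + 2 * (m : F) + 5 = x3 at *
  generalize l + 2 * i + 2 * (m : F) + 3 = x4 at *
  generalize l + 3 * (m : F) + 2 = y1 at *
  generalize l + 3 * (m : F) + 3 = y2 at *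
  generalize l + 3 * (m : F) + 4 = y3 at *
  generalize l + 3 * (m : F) + 5 = y4 at *
  generalize 2 * (m : F) + 1 = z1 at *
  generalize (m : F) + 1 = z2 at *
  generalize (m : F) + 2 = z3 at *
  field_simp

theorem sum_rowEntry_mul_colEntry_succ (μ : F) (hl : ∀ z : ℤ, 2 * μ + z ≠ 0) (i m : ℕ) :
    ∑ k ∈ range (m + 2), rowEntry μ i k * colEntry (2 * μ) (m + 1) k =
      sumRatio (2 * μ) i m * ∑ k ∈ range (m + 1), rowEntry μ i k * colEntry (2 * μ) m k := by
  have h := sum_range_telescope μ hl i m m le_rfl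
  have h2 := rowEntry_mul_colEntry_self μ hl i m
  simp_rw [mul_sub, sum_sub_distrib] at h
  rw [sum_range_succ, h2, mul_sum]
  simp_rw [mul_left_comm (sumRatio _ _ _)]
  linear_combination h

theorem sum_rowEntry_mul_colEntry (μ : F) (hl : ∀ z : ℤ, 2 * μ + z ≠ 0) (i m : ℕ) :
    ∑ k ∈ range (m + 1), rowEntry μ i k * colEntry (2 * μ) m k =
      rowEntry μ i 0 * ∏ p ∈ range m, sumRatio (2 * μ) i p := by
  induction m with
  | zero => simp [colEntry]
  | succ m ih => rw [sum_rowEntry_mul_colEntry_succ μ hl, ih, prod_range_succ]; ring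

theorem det_rowEntry_mul_prod (μ : F) (hl : ∀ z : ℤ, 2 * μ + z ≠ 0) (n : ℕ) :
    Matrix.det (Matrix.of fun i k : Fin n => rowEntry μ i k) *
        ∏ m ∈ range n, colEntry (2 * μ) m m =
      ∏ m ∈ range n, (rowEntry μ m 0 * ∏ p ∈ range m, sumRatio (2 * μ) m p) := by
  set V : Matrix (Fin n) (Fin n) F := Matrix.of fun k m => colEntry (2 * μ) m k with hV
  have hdet : V.det = ∏ m ∈ range n, colEntry (2 * μ) m m := by
    rw [Matrix.det_of_isUpperTriangular, ← Fin.prod_univ_eq_prod_range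
      (fun m => colEntry (2 * μ) m m)]
    · simp [hV]
    · intro i j hij
      exact colEntry_eq_zero _ hij
  have hmul : ∀ i m : Fin n, ((Matrix.of fun i k : Fin n => rowEntry μ i k) * V) i m =
      rowEntry μ i 0 * ∏ p ∈ range (m : ℕ), sumRatio (2 * μ) i p := by
    intro i m
    rw [Matrix.mul_apply, ← sum_rowEntry_mul_colEntry μ hl]
    simp only [hV, Matrix.of_apply]
    rw [Fin.sum_univ_eq_sum_range (fun k => rowEntry μ i k * colEntry (2 * μ) m k) n]
    symm
    apply sum_subset
    · intro k hk
      have := m.2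
      simp at hk ⊢; omega
    · intro k _ hk
      rw [colEntry_eq_zero, mul_zero]
      simp at hk; omega
  rw [← hdet, ← Matrix.det_mul, Matrix.det_of_isLowerTriangular, ← Fin.prod_univ_eq_prod_range
      (fun m => rowEntry μ m 0 * ∏ p ∈ range m, sumRatio (2 * μ) m p)]
  · simp [hmul]
  · intro i j hij
    have : (i : ℕ) < j := hij
    rw [hmul, prod_eq_zero (mem_range.2 this), mul_zero]
    simp [sumRatio]

theorem colEntry_ne_zero (l : F) (hl : ∀ z : ℤ, l + z ≠ 0) (m k : ℕ) (h : k ≤ m) :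
    colEntry l m k ≠ 0 := by
  refine prod_ne_zero_iff.2 fun q hq => ?_
  obtain ⟨d, rfl⟩ : ∃ d, m = q + 1 + d := ⟨m - (q + 1), by simp at hq; omega⟩
  have h1 : l + 2 * q + 2 ≠ 0 := by convert hl (2 * q + 2) using 1; push_cast; ring
  have h2 : l + 3 * q + 5 ≠ 0 := by convert hl (3 * q + 5) using 1; push_cast; ring
  have h3 : l + 2 * (q + 1 + d) + 2 * q + 3 ≠ 0 := by
    convert hl (2 * (q + 1 + d) + 2 * q + 3) using 1; push_cast; ring
  have h4 : l + 3 * q + 2 ≠ 0 := by convert hl (3 * q + 2) using 1; push_cast; ring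
  have h5 : l + 2 * (q + 1 + d) + q + 3 ≠ 0 := by
    convert hl (2 * (q + 1 + d) + q + 3) using 1; push_cast; ring
  have h6 : (q + 1 : F) ≠ 0 := by exact_mod_cast q.succ_ne_zero
  have h7 : (q + 1 + d - q : F) ≠ 0 := by
    convert (Nat.cast_ne_zero (R := F)).2 d.succ_ne_zero using 1; push_cast; ring
  have h8 : (2 * (q + 1 + d) - q : F) ≠ 0 := by
    convert (Nat.cast_ne_zero (R := F)).2 (q + 2 * d + 1).succ_ne_zero using 1; push_cast; ring
  simp only [colRatio]
  push_cast
  simp [*]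

theorem prod_odd_ne_zero (n : ℕ) : (∏ m ∈ range n, (2 * m + 1 : F)) ≠ 0 :=
  prod_ne_zero_iff.2 fun m _ => by exact_mod_cast (2 * m).succ_ne_zero

theorem prod_range_two_mul_sub_cast (n : ℕ) :
    (∏ m ∈ range n, (2 * n - m : F)) = 2 ^ n * ∏ m ∈ range n, (2 * m + 1 : F) := by
  have h0 : (n.factorial : F) ≠ 0 := by exact_mod_cast n.factorial_ne_zero
  have h := prod_range_sub_cast (F := F) (n + n)
  rw [prod_range_add, ← two_mul, factorial_two_mul_cast] at h
  have h2 : (∏ x ∈ range n, ((2 * n : ℕ) - (n + x : ℕ) : F)) = n.factorial := by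
    rw [← prod_range_sub_cast]
    refine prod_congr rfl fun j _ => ?_
    push_cast; ring
  rw [h2] at h
  apply mul_right_cancel₀ h0
  push_cast at h
  rw [h]
  ring

theorem rowEntry_zero_mul_prod_sumRatio (μ : F) (hl : ∀ z : ℤ, 2 * μ + z ≠ 0) (n : ℕ) :
    (rowEntry μ n 0 * ∏ p ∈ range n, sumRatio (2 * μ) n p) *
      ((-4) ^ n * (∏ m ∈ range (n + 1), (2 * m + 1 : F)) * ∏ m ∈ range n, (2 * m + 1 : F)) =
      (∏ m ∈ range n, (2 * μ + 2 * m + 4)) * ∏ m ∈ range (n + 1), (2 * μ + 4 * n + 5 + 2 * m) := by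
  have h0 : (n.factorial : F) ≠ 0 := by exact_mod_cast n.factorial_ne_zero
  have hO := prod_odd_ne_zero (F := F) n
  have h1 : (2 * n + 1 : F) ≠ 0 := by exact_mod_cast (2 * n).succ_ne_zero
  have hd : ∏ m ∈ range (2 * n), (2 * μ - 2 * n + 3 + 2 * m) =
      4 ^ n * ∏ m ∈ range (2 * n), (μ + n + 1 / 2 - m) := by
    rw [show (4 : F) ^ n = 2 ^ (2 * n) by rw [pow_mul]; norm_num, ← prod_range_reflect]
    conv_rhs => rw [← card_range (2 * n), ← prod_const, card_range, ← prod_mul_distrib]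
    refine prod_congr rfl fun j hj => ?_
    have : j + 1 ≤ 2 * n := mem_range.1 hj
    rw [Nat.sub_sub, add_comm 1 j, Nat.cast_sub this]
    push_cast
    ring
  have hd0 : ∏ m ∈ range (2 * n), (2 * μ - 2 * n + 3 + 2 * m) ≠ 0 :=
    prod_ne_zero_iff.2 fun m _ => by
      convert hl (- 2 * n + 3 + 2 * m) using 1; push_cast; ring
  have he : (∏ m ∈ range n, (2 * μ + 2 * n + 4 * m + 5)) *
      ∏ m ∈ range n, (2 * μ + 2 * n + 4 * m + 7) =
      (∏ m ∈ range n, (2 * μ + 2 * n + 2 * m + 5)) * ∏ m ∈ range n, (2 * μ + 4 * n + 5 + 2 * m) := by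
    have e1 := prod_range_two_mul (fun j : ℕ => 2 * μ + 2 * n + 2 * j + 5) n
    rw [two_mul n, prod_range_add] at e1
    convert e1.symm using 2 <;> refine prod_congr rfl fun j _ => ?_ <;> push_cast <;> ring
  have he0 : ∏ m ∈ range n, (2 * μ + 2 * n + 2 * m + 5) ≠ 0 :=
    prod_ne_zero_iff.2 fun m _ => by
      convert hl (2 * n + 2 * m + 5) using 1; push_cast; ring
  have hd' : (∏ m ∈ range n, (2 * μ - 2 * n + 4 * m + 3)) *
      ∏ m ∈ range n, (2 * μ - 2 * n + 4 * m + 5) =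
      ∏ m ∈ range (2 * n), (2 * μ - 2 * n + 3 + 2 * m) := by
    rw [prod_range_two_mul]
    congr 1 <;> refine prod_congr rfl fun j _ => ?_ <;> push_cast <;> ring
  have hs : ∏ p ∈ range n, sumRatio (2 * μ) n p =
      (-2) ^ n * n.factorial * (∏ m ∈ range n, (2 * μ + 2 * m + 4)) *
        (∏ m ∈ range n, (2 * μ + 4 * n + 5 + 2 * m)) /
        ((∏ m ∈ range n, (2 * m + 1 : F)) * ∏ m ∈ range (2 * n), (2 * μ - 2 * n + 3 + 2 * m)) := by
    have : ∀ p : ℕ, sumRatio (2 * μ) n p = (-2) * (n - p) * (2 * μ + 2 * p + 4) *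
        ((2 * μ + 2 * n + 4 * p + 5) * (2 * μ + 2 * n + 4 * p + 7)) /
        ((2 * p + 1) * (2 * μ + 2 * n + 2 * p + 5) * ((2 * μ - 2 * n + 4 * p + 3) *
        (2 * μ - 2 * n + 4 * p + 5))) := by
      intro p
      rw [sumRatio]
      congr 1 <;> ring
    simp_rw [this, prod_div_distrib, prod_mul_distrib]
    rw [prod_const, card_range, prod_range_sub_cast, he, hd', div_eq_div_iff]
    · ring
    · exact mul_ne_zero (mul_ne_zero hO he0) hd0
    · exact mul_ne_zero hO hd0
  rw [hs, rowEntry_zero_right, Nat.factorial_succ]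
  push_cast
  rw [factorial_two_mul_cast, hd, prod_range_succ, prod_range_succ]
  rw [hd] at hd0
  have h4 : (-4 : F) ^ n * (-2) ^ n = 4 ^ n * 2 ^ n := by
    rw [← mul_pow, ← mul_pow]; norm_num
  have e : 2 * μ + 4 * n + 5 + 2 * n = 2 * μ + 6 * n + 5 := by ring
  rw [e]
  have hp : ∏ m ∈ range (2 * n), (μ + n + 1 / 2 - m) ≠ 0 := right_ne_zero_of_mul hd0
  clear hd hd0 hd' hs he he0 e
  generalize ∏ m ∈ range (2 * n), (μ + n + 1 / 2 - m) = A at *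
  generalize ∏ m ∈ range n, (2 * m + 1 : F) = B at *
  generalize ∏ m ∈ range n, (2 * μ + 2 * m + 4) = C at *
  generalize ∏ m ∈ range n, (2 * μ + 4 * n + 5 + 2 * m) = D at *
  generalize (n.factorial : F) = f at *
  have h2 : (2 : F) ^ n ≠ 0 := pow_ne_zero _ (by norm_num)
  have h44 : (4 : F) ^ n ≠ 0 := pow_ne_zero _ (by norm_num)
  rw [div_mul_div_comm, div_mul_eq_mul_div, div_eq_iff]
  · linear_combination (2 * μ + 6 * n + 5) * A * f * C * D * ((2 * n + 1) * B * B) * h4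
  · simp [*]

theorem colEntry_self_mul (l : F) (hl : ∀ z : ℤ, l + z ≠ 0) (n : ℕ) :
    colEntry l n n * ((-2) ^ n * (∏ m ∈ range n, (2 * m + 1 : F)) *
        ∏ k ∈ range n, (l + 2 * n + 2 + k)) =
      (∏ m ∈ range n, (l + 2 * m + 4)) * ∏ k ∈ range n, (l + 2 * n + 3 + 2 * k) := by
  have h0 : (n.factorial : F) ≠ 0 := by exact_mod_cast n.factorial_ne_zero
  have hO := prod_odd_ne_zero (F := F) n
  have h2 : (2 : F) ^ n ≠ 0 := pow_ne_zero _ (by norm_num)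
  have c1 : l + 2 ≠ 0 := by simpa using hl 2
  have c2 : l + 3 * n + 2 ≠ 0 := by convert hl (3 * n + 2) using 1; push_cast; ring
  have r1 : (l + 2) * ∏ k ∈ range n, (l + 3 * k + 5) =
      (∏ k ∈ range n, (l + 3 * k + 2)) * (l + 3 * n + 2) := by
    rw [← prod_range_succ (fun k : ℕ => l + 3 * k + 2), prod_range_succ', mul_comm]
    congr 1
    · refine prod_congr rfl fun j _ => ?_
      push_cast; ring
    · simp
  have r2 : (l + 2) * ∏ k ∈ range n, (l + 2 * k + 4) =
      (∏ k ∈ range n, (l + 2 * k + 2)) * (l + 2 * n + 2) := by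
    rw [← prod_range_succ (fun k : ℕ => l + 2 * k + 2), prod_range_succ', mul_comm]
    congr 1
    · refine prod_congr rfl fun j _ => ?_
      push_cast; ring
    · simp
  have r3 : (l + 2 * n + 2) * ∏ k ∈ range n, (l + 2 * n + k + 3) =
      (∏ k ∈ range n, (l + 2 * n + 2 + k)) * (l + 3 * n + 2) := by
    have : l + 3 * n + 2 = l + 2 * n + 2 + n := by ring
    rw [this, ← prod_range_succ (fun k : ℕ => l + 2 * n + 2 + k), prod_range_succ', mul_comm]
    congr 1
    · refine prod_congr rfl fun j _ => ?_
      push_cast; ring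
    · simp
  have n1 : ∏ k ∈ range n, (l + 3 * k + 2) ≠ 0 :=
    prod_ne_zero_iff.2 fun m _ => by convert hl (3 * m + 2) using 1; push_cast; ring
  have n2 : ∏ k ∈ range n, (l + 2 * n + k + 3) ≠ 0 :=
    prod_ne_zero_iff.2 fun m _ => by convert hl (2 * n + m + 3) using 1; push_cast; ring
  have hs : colEntry l n n = (-1) ^ n * (∏ k ∈ range n, (l + 2 * k + 2)) *
      (∏ k ∈ range n, (l + 3 * k + 5)) * (∏ k ∈ range n, (l + 2 * n + 3 + 2 * k)) /
      (2 ^ n * (∏ m ∈ range n, (2 * m + 1 : F)) * (∏ k ∈ range n, (l + 3 * k + 2)) *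
        ∏ k ∈ range n, (l + 2 * n + k + 3)) := by
    have : ∀ k : ℕ, colRatio l n k = (-1) * (n - k) * (l + 2 * k + 2) * (l + 3 * k + 5) *
        (l + 2 * n + 3 + 2 * k) /
        ((k + 1) * (2 * n - k) * (l + 3 * k + 2) * (l + 2 * n + k + 3)) := by
      intro k
      rw [colRatio]
      congr 1; ring
    have hf : (∏ k ∈ range n, (k + 1 : F)) = n.factorial := by
      exact_mod_cast congrArg (Nat.cast (R := F)) (prod_range_add_one_eq_factorial n)
    simp_rw [colEntry, this, prod_div_distrib, prod_mul_distrib]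
    rw [prod_const, card_range, prod_range_sub_cast, prod_range_two_mul_sub_cast, hf,
      div_eq_div_iff]
    · ring
    · simp [*]
    · simp [*]
  rw [hs]
  have h4 : (-1 : F) ^ n * (-2) ^ n = 2 ^ n := by
    rw [← mul_pow]; norm_num
  clear hs hl
  generalize ∏ m ∈ range n, (2 * m + 1 : F) = B at *
  generalize ∏ k ∈ range n, (l + 3 * k + 2) = C at *
  generalize ∏ k ∈ range n, (l + 3 * k + 5) = D at *
  generalize ∏ k ∈ range n, (l + 2 * k + 2) = E at *
  generalize ∏ k ∈ range n, (l + 2 * k + 4) = G at *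
  generalize ∏ k ∈ range n, (l + 2 * n + k + 3) = H at *
  generalize ∏ k ∈ range n, (l + 2 * n + 2 + k) = I at *
  generalize ∏ k ∈ range n, (l + 2 * n + 3 + 2 * k) = J at *
  rw [div_mul_eq_mul_div, div_eq_iff (by simp [*])]
  have key : E * D * I = G * C * H := by
    apply mul_left_cancel₀ (mul_ne_zero c1 c2)
    linear_combination E * I * (l + 3 * n + 2) * r1 - (l + 3 * n + 2) * C * H * r2 -
      E * C * (l + 3 * n + 2) * r3
  linear_combination E * D * J * B * I * h4 + 2 ^ n * B * J * key

theorem factorB_ne_zero (μ : F) (hl : ∀ z : ℤ, 2 * μ + z ≠ 0) (n j : ℕ) : factorB μ n j ≠ 0 := by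
  rw [factorB, ascPochhammer_eval_eq_prod]
  refine prod_ne_zero_iff.2 fun k _ h => ?_
  generalize (3 * j + 2) / 2 = e at h
  apply hl (6 * n - 2 * e + 1 + 2 * k)
  push_cast at h ⊢
  linear_combination 2 * h

theorem factorB_add_two (μ : F) (n j : ℕ) :
    factorB μ (n + 1) (j + 2) = factorB μ n j * (μ + 3 * n + 1 / 2 - j) := by
  have h1 : (j + 2 + 2) / 2 = (j + 2) / 2 + 1 := by omega
  have h2 : (3 * (j + 2) + 2) / 2 = (3 * j + 2) / 2 + 3 := by omega
  have h4 : (((3 * j + 2) / 2 : ℕ) : F) = ((j + 2) / 2 : ℕ) + j := by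
    rw [show (3 * j + 2) / 2 = (j + 2) / 2 + j by omega, Nat.cast_add]
  rw [factorB, factorB, h1, h2]
  have h5 : μ + 3 * ((n + 1 : ℕ) : F) - (((3 * j + 2) / 2 + 3 : ℕ) : F) + 1 / 2 =
      μ + 3 * n - ((3 * j + 2) / 2 : ℕ) + 1 / 2 := by
    push_cast; ring
  rw [h5, ascPochhammer_succ_eval, h4]
  congr 1
  ring

theorem prod_factorB_succ_mul (μ : F) (n : ℕ) :
    (∏ j ∈ range (n + 2), factorB μ (n + 2) j) * factorB μ (n + 1) n * 2 ^ (n + 2) =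
      (∏ j ∈ range (n + 1), factorB μ (n + 1) j) *
        ∏ j ∈ range (n + 2), (2 * μ + 4 * (n + 1 : ℕ) + 5 + 2 * j) := by
  have h : 2 ^ (n + 2) * ((∏ j ∈ range n, (μ + 3 * ((n + 1 : ℕ) : F) + 1 / 2 - j)) *
      (μ + 3 * n + 9 / 2) * (μ + 3 * n + 11 / 2)) =
      ∏ j ∈ range (n + 2), (2 * μ + 4 * (n + 1 : ℕ) + 5 + 2 * j) := by
    have h' : (∏ j ∈ range n, (μ + 3 * ((n + 1 : ℕ) : F) + 1 / 2 - j)) *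
        (μ + 3 * n + 9 / 2) * (μ + 3 * n + 11 / 2) =
        ∏ j ∈ range (n + 2), (μ + 3 * n + 11 / 2 - j) := by
      rw [prod_range_succ', prod_range_succ']
      congr 1
      · congr 1
        · refine prod_congr rfl fun j _ => ?_
          push_cast; ring
        · push_cast; ring
      · simp
    rw [h', ← prod_range_reflect]
    conv_lhs => rw [← card_range (n + 2), ← prod_const, card_range, ← prod_mul_distrib]
    refine prod_congr rfl fun j hj => ?_
    have : j + 1 ≤ n + 2 := mem_range.1 hj
    rw [Nat.sub_sub, add_comm 1 j, Nat.cast_sub this]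
    push_cast
    ring
  rw [← h, prod_range_succ' _ (n + 1), prod_range_succ' _ n, prod_range_succ _ n]
  have h0 : factorB μ (n + 2) 0 = μ + 3 * n + 11 / 2 := by
    simp [factorB]; ring
  have h1 : factorB μ (n + 2) (0 + 1) = μ + 3 * n + 9 / 2 := by
    simp [factorB]; ring
  rw [h0, h1]
  simp_rw [add_assoc, one_add_one_eq_two, show n + 2 = n + 1 + 1 from rfl,
    factorB_add_two, prod_mul_distrib]
  ring_nf

theorem prod_range_two_mul_add (a : F) (h : ℕ) :
    ∏ k ∈ range (2 * h), (2 * a + k) =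
      4 ^ h * (∏ k ∈ range h, (a + k)) * ∏ k ∈ range h, (a + 1 / 2 + k) := by
  rw [prod_range_two_mul, show (4 : F) ^ h = 2 ^ h * 2 ^ h by rw [← mul_pow]; norm_num]
  conv_rhs => rw [mul_assoc, mul_mul_mul_comm, ← card_range h, ← prod_const, card_range,
    ← prod_mul_distrib, ← prod_mul_distrib]
  congr 1 <;> refine prod_congr rfl fun j _ => ?_ <;> push_cast <;> ring

theorem ascPochhammer_eval_mul_prod (μ : F) (n : ℕ) :
    (ascPochhammer F ((n + 2) / 2)).eval (μ + (n + 1 : ℕ) + 1) *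
        ∏ k ∈ range (n + 1), (2 * μ + 2 * (n + 1 : ℕ) + 3 + 2 * k) =
      (∏ k ∈ range (n + 1), (2 * μ + 2 * (n + 1 : ℕ) + 2 + k)) * factorB μ (n + 1) n := by
  have e1 : 2 * μ + 2 * (n + 1 : ℕ) + 3 = 2 * (μ + n + 5 / 2) := by push_cast; ring
  have e2 : 2 * μ + 2 * (n + 1 : ℕ) + 2 = 2 * (μ + n + 2) := by push_cast; ring
  rw [factorB, ascPochhammer_eval_eq_prod, ascPochhammer_eval_eq_prod, e1, e2, prod_const_mul_add]
  obtain ⟨h, rfl | rfl⟩ := n.even_or_odd'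
  · have d1 : (2 * h + 2) / 2 = h + 1 := by omega
    have d2 : (3 * (2 * h) + 2) / 2 = 3 * h + 1 := by omega
    rw [d1, d2, prod_range_succ (fun k : ℕ => 2 * (μ + (2 * h : ℕ) + 2) + (k : F)),
      prod_range_two_mul_add]
    have s1 : 2 * h + 1 = h + (h + 1) := by omega
    conv_lhs => rw [s1, prod_range_add (fun k : ℕ => μ + (2 * h : ℕ) + 5 / 2 + (k : F)), ← s1]
    have q1 : ∀ k : ℕ, μ + (2 * h : ℕ) + 5 / 2 + (h + k : ℕ) =
      μ + 3 * (2 * h + 1 : ℕ) - (3 * h + 1 : ℕ) + 1 / 2 + k := by intro k; push_cast; ring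
    have q2 : ∀ k : ℕ, μ + (2 * h : ℕ) + 2 + 1 / 2 + k = μ + (2 * h : ℕ) + 5 / 2 + k := by
      intro k; ring
    have q3 : μ + (2 * h + 1 : ℕ) + 1 = μ + (2 * h : ℕ) + 2 := by push_cast; ring
    simp_rw [q1, q2, q3]
    rw [prod_range_succ (fun k : ℕ => μ + (2 * h : ℕ) + 2 + k)]
    rw [pow_succ, pow_mul]
    push_cast
    ring
  · have d1 : (2 * h + 1 + 2) / 2 = h + 1 := by omega
    have d2 : (3 * (2 * h + 1) + 2) / 2 = 3 * h + 2 := by omega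
    have s0 : 2 * h + 1 + 1 = 2 * (h + 1) := by omega
    have s1 : 2 * (h + 1) = (h + 1) + (h + 1) := by omega
    rw [d1, d2, s0, prod_range_two_mul_add]
    conv_lhs => rw [s1, prod_range_add (fun k : ℕ => μ + (2 * h + 1 : ℕ) + 5 / 2 + (k : F)), ← s1]
    have q1 : ∀ k : ℕ, μ + (2 * h + 1 : ℕ) + 5 / 2 + (h + 1 + k : ℕ) =
      μ + 3 * (2 * (h + 1) : ℕ) - (3 * h + 2 : ℕ) + 1 / 2 + k := by intro k; push_cast; ring
    have q2 : ∀ k : ℕ, μ + (2 * h + 1 : ℕ) + 2 + 1 / 2 + k = μ + (2 * h + 1 : ℕ) + 5 / 2 + k := by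
      intro k; ring
    have q3 : μ + (2 * (h + 1) : ℕ) + 1 = μ + (2 * h + 1 : ℕ) + 2 := by push_cast; ring
    simp_rw [q1, q2, q3]
    rw [pow_mul]
    norm_num
    ring

theorem exists_factorB_step (μ : F) (hl : ∀ z : ℤ, 2 * μ + z ≠ 0) (n : ℕ) : ∃ E : F, E ≠ 0 ∧
    (ascPochhammer F ((n + 1) / 2)).eval (μ + n + 1) *
        ∏ k ∈ range n, (2 * μ + 2 * n + 3 + 2 * k) =
      (∏ k ∈ range n, (2 * μ + 2 * n + 2 + k)) * E ∧
    (∏ j ∈ range (n + 1), factorB μ (n + 1) j) * E * 2 ^ (n + 1) =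
      (∏ j ∈ range n, factorB μ n j) * ∏ j ∈ range (n + 1), (2 * μ + 4 * n + 5 + 2 * j) := by
  cases n with
  | zero => exact ⟨1, one_ne_zero, by simp, by simp [factorB]; ring⟩
  | succ n =>
    exact ⟨factorB μ (n + 1) n, factorB_ne_zero μ hl _ _, ascPochhammer_eval_mul_prod μ n,
      prod_factorB_succ_mul μ n⟩

theorem productSide_succ (μ : F) (hl : ∀ z : ℤ, 2 * μ + z ≠ 0) (n : ℕ) :
    productSide (n + 1) μ * colEntry (2 * μ) n n =
      productSide n μ * (rowEntry μ n 0 * ∏ p ∈ range n, sumRatio (2 * μ) n p) := by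
  obtain ⟨E, hE, h3, h4⟩ := exists_factorB_step μ hl n
  have h1 := rowEntry_zero_mul_prod_sumRatio μ hl n
  have h2 := colEntry_self_mul (2 * μ) hl n
  have hX : ∏ m ∈ range n, (2 * μ + 2 * m + 4) ≠ 0 :=
    prod_ne_zero_iff.2 fun m _ => by convert hl (2 * m + 4) using 1; push_cast; ring
  have hZ : ∏ k ∈ range n, (2 * μ + 2 * n + 3 + 2 * k) ≠ 0 :=
    prod_ne_zero_iff.2 fun m _ => by convert hl (2 * n + 3 + 2 * m) using 1; push_cast; ring
  have hQ : ∏ k ∈ range n, (2 * μ + 2 * n + 2 + k) ≠ 0 :=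
    prod_ne_zero_iff.2 fun m _ => by convert hl (2 * n + 2 + m) using 1; push_cast; ring
  have hO := prod_odd_ne_zero (F := F) n
  have hO' := prod_odd_ne_zero (F := F) (n + 1)
  have hP : ∏ j ∈ range n, ∏ m ∈ range (j + 1), (2 * m + 1 : F) ≠ 0 :=
    prod_ne_zero_iff.2 fun j _ => prod_odd_ne_zero (j + 1)
  have hp : (2 : F) ^ n ≠ 0 := pow_ne_zero _ two_ne_zero
  have hs : (-2 : F) ^ n ≠ 0 := pow_ne_zero _ (by norm_num)
  have h44 : (-4 : F) ^ n = 2 ^ n * (-2) ^ n := by rw [← mul_pow]; norm_num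
  rw [productSide, productSide, prod_range_succ
    (fun j => (ascPochhammer F ((j + 1) / 2)).eval (μ + j + 1)),
    prod_range_succ (fun j => ∏ m ∈ range (j + 1), (2 * m + 1 : F))]
  rw [h44] at h1
  rw [pow_succ] at h4 ⊢
  generalize rowEntry μ n 0 * ∏ p ∈ range n, sumRatio (2 * μ) n p = S at *
  generalize colEntry (2 * μ) n n = v at *
  generalize (ascPochhammer F ((n + 1) / 2)).eval (μ + n + 1) = A at *
  generalize ∏ j ∈ range n, (ascPochhammer F ((j + 1) / 2)).eval (μ + j + 1) = A' at *
  generalize ∏ j ∈ range (n + 1), factorB μ (n + 1) j = B' at *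
  generalize ∏ j ∈ range n, factorB μ n j = B at *
  generalize ∏ j ∈ range n, ∏ m ∈ range (j + 1), (2 * m + 1 : F) = P at *
  generalize ∏ m ∈ range (n + 1), (2 * m + 1 : F) = O' at *
  generalize ∏ m ∈ range n, (2 * m + 1 : F) = O at *
  generalize ∏ j ∈ range (n + 1), (2 * μ + 4 * n + 5 + 2 * j) = Y at *
  generalize ∏ m ∈ range n, (2 * μ + 2 * m + 4) = X at *
  generalize ∏ k ∈ range n, (2 * μ + 2 * n + 3 + 2 * k) = Z at *
  generalize ∏ k ∈ range n, (2 * μ + 2 * n + 2 + k) = Q at *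
  generalize (2 : F) ^ n = p at *
  generalize (-2 : F) ^ n = s at *
  have key : 2 * A * B' * v = B * S * O' := by
    have : E * p * s * O * Q * Z ≠ 0 := by simp [*]
    apply mul_left_cancel₀ this
    linear_combination A * Z * v * s * O * Q * h4 + B * Y * v * s * O * Q * h3 +
      B * Y * Q * E * h2 - B * E * Q * Z * h1
  rw [div_mul_eq_mul_div, div_mul_eq_mul_div, div_eq_div_iff (mul_ne_zero hP hO') hP]
  linear_combination p * A' * P * key

theorem det_rowEntry_eq_productSide (μ : F) (hl : ∀ z : ℤ, 2 * μ + z ≠ 0) (n : ℕ) :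
    Matrix.det (Matrix.of fun i k : Fin n => rowEntry μ i k) = productSide n μ := by
  have hv : ∀ m, colEntry (2 * μ) m m ≠ 0 := fun m => colEntry_ne_zero _ hl m m le_rfl
  induction n with
  | zero => simp [productSide]
  | succ n ih =>
    have h0 := det_rowEntry_mul_prod μ hl n
    have h1 := det_rowEntry_mul_prod μ hl (n + 1)
    rw [prod_range_succ, prod_range_succ, ← h0, ih] at h1
    apply mul_right_cancel₀ (hv n)
    apply mul_right_cancel₀ (prod_ne_zero_iff.2 fun m (_ : m ∈ range n) => hv m)
    rw [productSide_succ μ hl]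
    linear_combination h1

theorem two_mul_add_third_ne_zero (N : ℕ) (z : ℤ) : 2 * ((N : F) + 1 / 3) + z ≠ 0 := by
  intro h
  have h1 : ((6 * N + 2 + 3 * z : ℤ) : F) = 0 := by
    push_cast
    linear_combination 3 * h
  rw [Int.cast_eq_zero] at h1
  omega

end

/-- Determinant evaluation (eq. (3.35) of [Krat, "Advanced Determinant Calculus"]):
`det_{0≤i,j≤n−1}(C(μ+i+j, 2i−j) + 2·C(μ+i+j+2, 2i−j+1))
 = 2^n ∏_{i=1}^n (μ+i)_{⌊i/2⌋}(μ+3n−⌊(3i−1)/2⌋+1/2)_{⌊(i+1)/2⌋}/(2i−1)!!`,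
where `(a)_k` is the ascending Pochhammer symbol and `(2i−1)!!` the double factorial. -/
theorem stmt_13 (n : ℕ) (F : Type*) [Field F] [CharZero F] (μ : F) :
    Matrix.det (Matrix.of fun i j : Fin n =>
        genBinom F (μ + ((i : ℕ) : F) + ((j : ℕ) : F))
            (2 * ((i : ℕ) : ℤ) - ((j : ℕ) : ℤ)) +
          2 * genBinom F (μ + ((i : ℕ) : F) + ((j : ℕ) : F) + 2)
            (2 * ((i : ℕ) : ℤ) - ((j : ℕ) : ℤ) + 1)) =
      2 ^ n *
        ∏ i ∈ Icc 1 n,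
          ((ascPochhammer F (i / 2)).eval (μ + (i : F)) *
              (ascPochhammer F ((i + 1) / 2)).eval
                (μ + 3 * (n : F) - (((3 * i - 1) / 2 : ℕ) : F) + 1 / 2)) /
            ((2 * i - 1).doubleFactorial : F) := by
  obtain ⟨p, hp⟩ := exists_polynomial_det (F := F) n
  obtain ⟨q, hq⟩ := exists_polynomial_productSide (F := F) n
  rw [prod_Icc_eq_productSide, hp, hq]
  congr 1
  refine Polynomial.eq_of_infinite_eval_eq p q (Set.infinite_of_injective_forall_mem
    (f := fun N : ℕ => (N : F) + 1 / 3) (fun a b h => by simpa using h) fun N => ?_)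
  rw [Set.mem_ofPred_eq, ← hp, ← hq, det_entry_eq_det_rowEntry]
  exact det_rowEntry_eq_productSide _ (two_mul_add_third_ne_zero N) n
end
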